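/- Let n ≥ 4 be an integer. There exist real constants C > 0, δ > 0 and K > 0 such that for every real B ≥ 1, the number N(B) of tuples (a_0,…,a_n) ∈ ℤ^{n+1} satisfying a_0 + ⋯ + a_n = 0, gcd(a_0,…,a_n) = 1, max_{0≤i≤n} |a_i| ≤ B, and such that every a_i is squareful, satisfies |N(B) − C·B^{(n−1)/2}| ≤ K·B^{(n−1)/2−δ}. -/

import Mathlib

/-- An integer `a` is squareful if `p^2 ∣ a` for every prime `p` dividing `a`. -/
def Squareful (a : ℤ) : Prop := ∀ p : ℕ, p.Prime → (p : ℤ) ∣ a → (p : ℤ)^2 ∣ a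

namespace SquarefulCount

open Finset

/-! ### The divisor bound -/

theorem card_divisors_le_rpow {ε : ℝ} (hε : 0 < ε) :
    ∃ C : ℝ, 1 ≤ C ∧ ∀ n : ℕ, n ≠ 0 → (n.divisors.card : ℝ) ≤ C * (n : ℝ) ^ ε := by
  set t : ℝ := ε * Real.log 2
  have ht : 0 < t := mul_pos hε (Real.log_pos (by norm_num))
  set c : ℝ := 1 + 1 / t
  have hc : 1 ≤ c := by have := one_div_pos.2 ht; simp only [c]; linarith
  obtain ⟨M, hM⟩ := exists_nat_ge ((2 : ℝ) ^ (1 / ε))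
  refine ⟨c ^ M, one_le_pow₀ hc, fun n hn => ?_⟩
  have hn' : (n : ℝ) ^ ε = ∏ p ∈ n.primeFactors, ((p : ℝ) ^ ε) ^ (n.factorization p) := by
    conv_lhs => rw [← Nat.prod_factorization_pow_eq_self hn]
    rw [Finsupp.prod, Nat.support_factorization]
    push_cast
    rw [← Real.finsetProd_rpow _ _ (fun i _ => by positivity)]
    refine prod_congr rfl fun p _ => ?_
    rw [← Real.rpow_natCast, ← Real.rpow_natCast, ← Real.rpow_mul (by positivity),
      ← Real.rpow_mul (by positivity), mul_comm]
  rw [Nat.card_divisors hn, hn']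
  push_cast
  have key : ∀ p ∈ n.primeFactors, ((n.factorization p : ℝ) + 1) ≤
      (if p < M then c else 1) * ((p : ℝ) ^ ε) ^ (n.factorization p) := by
    intro p hp
    have hp2 : (2 : ℝ) ≤ p := by exact_mod_cast (Nat.prime_of_mem_primeFactors hp).two_le
    set a := n.factorization p
    split_ifs with h
    · have h1 : 1 + t * a ≤ ((p : ℝ) ^ ε) ^ a := by
        calc 1 + t * a ≤ Real.exp (t * a) := by linarith [Real.add_one_le_exp (t * a)]
          _ = ((2 : ℝ) ^ ε) ^ a := by
            rw [Real.rpow_def_of_pos (by norm_num), ← Real.exp_nat_mul]; congr 1; simp only [t]; ring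
          _ ≤ _ := by gcongr
      calc (a : ℝ) + 1 ≤ c * (1 + t * a) := by
            simp only [c]
            have : (1 + 1 / t) * (1 + t * a) = 1 + t * a + 1 / t + a := by field_simp; ring
            rw [this]
            have := one_div_pos.2 ht
            have : 0 ≤ t * (a : ℝ) := by positivity
            linarith
        _ ≤ _ := by gcongr
    · have h1 : (2 : ℝ) ≤ (p : ℝ) ^ ε := by
        have : (2 : ℝ) ^ (1 / ε) ≤ p := hM.trans (by exact_mod_cast not_lt.1 h)
        calc (2 : ℝ) = ((2 : ℝ) ^ (1 / ε)) ^ ε := by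
              rw [← Real.rpow_mul (by norm_num)]; field_simp; simp
          _ ≤ _ := by gcongr
      calc (a : ℝ) + 1 ≤ (2 : ℝ) ^ a := by exact_mod_cast Nat.lt_two_pow_self
        _ ≤ 1 * ((p : ℝ) ^ ε) ^ a := by rw [one_mul]; gcongr
  calc ∏ p ∈ n.primeFactors, ((n.factorization p : ℝ) + 1)
      ≤ ∏ p ∈ n.primeFactors, ((if p < M then c else 1) * ((p : ℝ) ^ ε) ^ (n.factorization p)) :=
        prod_le_prod (fun _ _ => by positivity) key
    _ = (∏ p ∈ n.primeFactors, (if p < M then c else 1)) *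
        ∏ p ∈ n.primeFactors, ((p : ℝ) ^ ε) ^ (n.factorization p) := prod_mul_distrib
    _ ≤ _ := by
      gcongr
      rw [prod_ite]
      simp only [prod_const, one_pow, mul_one]
      refine pow_le_pow_right₀ hc ?_
      calc _ ≤ (range M).card := card_le_card fun p hp => by simp at hp ⊢; exact hp.2
        _ = M := card_range M

/-! ### Parametrizing squareful integers -/

theorem squareful_cube_mul_sq (y x : ℕ) : Squareful ((y ^ 3 * x ^ 2 : ℕ) : ℤ) := by
  intro p hp h
  have h' : p ∣ y ^ 3 * x ^ 2 := by exact_mod_cast h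
  have : p ^ 2 ∣ y ^ 3 * x ^ 2 := by
    rcases (Nat.Prime.dvd_mul hp).1 h' with h1 | h1
    · have := hp.dvd_of_dvd_pow h1
      exact Dvd.dvd.mul_right ((pow_dvd_pow_of_dvd this 2).trans (pow_dvd_pow y (by norm_num))) _
    · have := hp.dvd_of_dvd_pow h1
      exact Dvd.dvd.mul_left (pow_dvd_pow_of_dvd this 2) _
  exact_mod_cast this

theorem exists_cube_mul_sq {a : ℕ} (ha : 0 < a) (h : Squareful (a : ℤ)) :
    ∃ y x : ℕ, Squarefree y ∧ 0 < y ∧ 0 < x ∧ y ^ 3 * x ^ 2 = a := by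
  obtain ⟨y, b, hb⟩ := Nat.sq_mul_squarefree a
  obtain ⟨hab, hy⟩ := hb
  have hdvd : y ∣ b := by
    have hyb : y ∣ b ^ 2 := by
      rw [Nat.dvd_iff_prime_pow_dvd_dvd]
      intro p k hp hk
      rcases Nat.eq_zero_or_pos k with rfl | hk0
      · simp
      have hk1 : k = 1 := by
        by_contra hne
        have : p ^ 2 ∣ y := (pow_dvd_pow p (by omega)).trans hk
        rw [pow_two] at this
        exact hp.one_lt.ne' (Nat.isUnit_iff.1 (hy p this))
      subst hk1
      rw [pow_one] at hk ⊢
      have hpa : (p : ℤ) ∣ a := by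
        rw [← hab]; exact_mod_cast hk.mul_left _
      have h2 : p ^ 2 ∣ b ^ 2 * y := by rw [hab]; exact_mod_cast h p hp hpa
      by_contra hpb
      have hcop : Nat.Coprime (p ^ 2) (b ^ 2) := by
        apply Nat.Coprime.pow_left
        exact (Nat.Prime.coprime_iff_not_dvd hp).2 hpb
      have : p ^ 2 ∣ y := hcop.dvd_of_dvd_mul_left h2
      rw [pow_two] at this
      exact hp.one_lt.ne' (Nat.isUnit_iff.1 (hy p this))
    exact (hy.dvd_pow_iff_dvd (by norm_num)).1 hyb
  obtain ⟨x, rfl⟩ := hdvd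
  refine ⟨y, x, hy, ?_, ?_, by rw [← hab]; ring⟩
  · rcases Nat.eq_zero_or_pos y with rfl | h
    · simp at hab; omega
    · exact h
  · rcases Nat.eq_zero_or_pos x with rfl | h
    · simp at hab; omega
    · exact h

theorem cube_mul_sq_inj {y y' x x' : ℕ} (hy : Squarefree y) (hy' : Squarefree y')
    (hx : 0 < x) (hx' : 0 < x') (h : y ^ 3 * x ^ 2 = y' ^ 3 * x' ^ 2) : y = y' ∧ x = x' := by
  have hyy : y = y' := by
    refine Nat.eq_of_factorization_eq hy.ne_zero hy'.ne_zero fun p => ?_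
    have h1 := hy.natFactorization_le_one p
    have h2 := hy'.natFactorization_le_one p
    have := congrArg (fun n => n.factorization p) h
    rw [Nat.factorization_mul (pow_ne_zero _ hy.ne_zero) (pow_ne_zero _ hx.ne'),
      Nat.factorization_mul (pow_ne_zero _ hy'.ne_zero) (pow_ne_zero _ hx'.ne')] at this
    simp at this
    omega
  subst hyy
  refine ⟨rfl, ?_⟩
  have h3 : 0 < y ^ 3 := pow_pos (Nat.pos_of_ne_zero hy.ne_zero) 3
  have := Nat.eq_of_mul_eq_mul_left h3 h
  exact Nat.pow_left_injective (by norm_num : 2 ≠ 0) this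

theorem dvd_cube_mul_sq_iff {d y x : ℕ} (hd : Squarefree d) :
    d ∣ y ^ 3 * x ^ 2 ↔ d / d.gcd y ∣ x := by
  have hd0 : 0 < d := Nat.pos_of_ne_zero hd.ne_zero
  have hg : 0 < d.gcd y := Nat.gcd_pos_of_pos_left _ hd0
  constructor
  · intro h
    have h1 : d ∣ y * x := by
      rw [← hd.dvd_pow_iff_dvd (show 3 ≠ 0 by norm_num)]
      exact h.trans ⟨x, by ring⟩
    have hc : Nat.Coprime (d / d.gcd y) (y / d.gcd y) := Nat.coprime_div_gcd_div_gcd hg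
    refine hc.dvd_of_dvd_mul_left ?_
    have : d.gcd y * (d / d.gcd y) ∣ d.gcd y * (y / d.gcd y * x) := by
      rw [Nat.mul_div_cancel' (Nat.gcd_dvd_left d y), ← mul_assoc,
        Nat.mul_div_cancel' (Nat.gcd_dvd_right d y)]
      exact h1
    exact Nat.dvd_of_mul_dvd_mul_left hg this
  · intro h
    have : d ∣ y * x := by
      rw [← Nat.mul_div_cancel' (Nat.gcd_dvd_left d y)]
      exact mul_dvd_mul (Nat.gcd_dvd_right d y) h
    exact this.trans ⟨y ^ 2 * x, by ring⟩

/-- The coefficient `c` such that the squareful positive multiples of `d` with cubic part `y` are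
the numbers `c * x ^ 2`. -/
def coeff (d y : ℕ) : ℕ := y ^ 3 * (d / d.gcd y) ^ 2

theorem coeff_one (y : ℕ) : coeff 1 y = y ^ 3 := by simp [coeff]

theorem coeff_pos {d y : ℕ} (hd : 0 < d) (hy : 0 < y) : 0 < coeff d y := by
  have : 0 < d / d.gcd y := Nat.div_pos (Nat.gcd_le_left y hd) (Nat.gcd_pos_of_pos_left _ hd)
  unfold coeff; positivity

theorem cube_le_coeff {d y : ℕ} (hd : 0 < d) : y ^ 3 ≤ coeff d y := by
  have : 0 < d / d.gcd y := Nat.div_pos (Nat.gcd_le_left y hd) (Nat.gcd_pos_of_pos_left _ hd)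
  unfold coeff
  exact Nat.le_mul_of_pos_right _ (by positivity)

/-! ### Exponential sums -/

/-- The additive character `t ↦ exp (2πit)`. -/
noncomputable def ee (t : ℝ) : ℂ := Complex.exp (Complex.I * (2 * Real.pi * t : ℝ))

theorem ee_add (s t : ℝ) : ee (s + t) = ee s * ee t := by
  unfold ee; rw [← Complex.exp_add]; congr 1; push_cast; ring

theorem ee_zero : ee 0 = 1 := by simp [ee]

theorem norm_ee (t : ℝ) : ‖ee t‖ = 1 := by
  unfold ee; exact Complex.norm_exp_I_mul_ofReal _

theorem conj_ee (t : ℝ) : (starRingEnd ℂ) (ee t) = ee (-t) := by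
  unfold ee; rw [← Complex.exp_conj]; congr 1
  rw [map_mul, Complex.conj_I, Complex.conj_ofReal]; push_cast; ring

theorem ee_int (m : ℤ) : ee m = 1 := by
  unfold ee; rw [Complex.exp_eq_one_iff]; exact ⟨m, by push_cast; ring⟩

theorem ee_sum {ι : Type*} (s : Finset ι) (f : ι → ℝ) : ee (∑ i ∈ s, f i) = ∏ i ∈ s, ee (f i) := by
  unfold ee; rw [← Complex.exp_sum]; congr 1; push_cast; simp only [Finset.mul_sum]

theorem ee_nat_mul (n : ℕ) (t : ℝ) : ee (n * t) = ee t ^ n := by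
  unfold ee; rw [← Complex.exp_nat_mul]; congr 1; push_cast; ring

theorem continuous_ee : Continuous ee := by
  unfold ee; fun_prop

theorem norm_ee_sub_le (s t : ℝ) : ‖ee s - ee t‖ ≤ 2 * Real.pi * |s - t| := by
  have h : ee s - ee t = (ee (s - t) - 1) * ee t := by
    rw [sub_mul, ← ee_add, one_mul]; congr 2; ring
  rw [h, norm_mul, norm_ee, mul_one]
  refine (Real.norm_exp_I_mul_ofReal_sub_one_le).trans ?_
  rw [Real.norm_eq_abs, abs_mul, abs_of_pos Real.two_pi_pos]

theorem integral_ee_int_mul (m : ℤ) (a : ℝ) :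
    ∫ x in a..(a + 1), ee (m * x) = if m = 0 then 1 else 0 := by
  split_ifs with h
  · subst h; simp [ee_zero]
  · have hc : (2 * Real.pi * m * Complex.I : ℂ) ≠ 0 := by
      simp [Real.pi_ne_zero, h]
    have : ∀ x : ℝ, ee (m * x) = Complex.exp ((2 * Real.pi * m * Complex.I) * x) := by
      intro x; unfold ee; congr 1; push_cast; ring
    simp_rw [this]
    rw [integral_exp_mul_complex hc]
    have h2 : Complex.exp (2 * Real.pi * m * Complex.I * ((a + 1 : ℝ) : ℂ)) =
        Complex.exp (2 * Real.pi * m * Complex.I * (a : ℂ)) := by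
      rw [← this, ← this, mul_add, mul_one, ee_add, ee_int, mul_one]
    rw [h2, sub_self, zero_div]

theorem integral_sum_ee {ι : Type*} (T : Finset ι) (φ : ι → ℤ) (a : ℝ) :
    ∫ x in a..(a + 1), ∑ i ∈ T, ee (φ i * x) = ((T.filter (fun i => φ i = 0)).card : ℂ) := by
  have hint : ∀ i ∈ T, IntervalIntegrable (fun x : ℝ => ee (φ i * x)) MeasureTheory.volume
      a (a + 1) := fun i _ =>
    (show Continuous fun x : ℝ => ee (φ i * x) from
      continuous_ee.comp (by fun_prop)).intervalIntegrable _ _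
  rw [intervalIntegral.integral_finsetSum hint]
  simp_rw [integral_ee_int_mul]
  rw [Finset.sum_boole]

theorem norm_sum_ee_mul_le {θ K : ℝ} (hK : 0 < K) (h : 1 / K ≤ |θ - round θ|) (M : ℕ) :
    ‖∑ x ∈ range M, ee (θ * x)‖ ≤ K := by
  set t := θ - round θ with ht
  have ht0 : 0 < |t| := lt_of_lt_of_le (by positivity) h
  have hth : |t| ≤ 1 / 2 := abs_sub_round θ
  have hz : ee θ = ee t := by
    have : θ = t + (round θ : ℤ) := by rw [ht]; ring
    rw [this, ee_add, ee_int, mul_one]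
  have hlow : 4 * |t| ≤ ‖ee θ - 1‖ := by
    rw [hz]; unfold ee
    rw [Complex.norm_exp_I_mul_ofReal_sub_one, Real.norm_eq_abs, abs_mul, abs_two]
    have h1 : |Real.sin (2 * Real.pi * t / 2)| = Real.sin (Real.pi * |t|) := by
      have e : 2 * Real.pi * t / 2 = Real.pi * t := by ring
      rw [e]
      have hs : 0 ≤ Real.sin (Real.pi * |t|) := by
        apply Real.sin_nonneg_of_nonneg_of_le_pi (by positivity)
        nlinarith [Real.pi_pos]
      rcases abs_cases t with ⟨h1, h2⟩ | ⟨h1, h2⟩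
      · rw [h1] at hs ⊢; exact abs_of_nonneg hs
      · rw [h1] at hs ⊢
        rw [mul_neg, Real.sin_neg] at hs ⊢
        rw [abs_of_nonpos]; linarith
    rw [h1]
    have := Real.mul_le_sin (x := Real.pi * |t|) (by positivity) (by nlinarith [Real.pi_pos])
    have e : 2 / Real.pi * (Real.pi * |t|) = 2 * |t| := by field_simp
    linarith
  have hne : ee θ ≠ 1 := by
    intro h0; rw [h0] at hlow; simp at hlow; linarith
  have hsum : ∑ x ∈ range M, ee (θ * x) = (ee θ ^ M - 1) / (ee θ - 1) := by
    rw [← geom_sum_eq hne]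
    refine sum_congr rfl fun x _ => ?_
    rw [mul_comm, ee_nat_mul]
  rw [hsum, norm_div]
  have hnum : ‖ee θ ^ M - 1‖ ≤ 2 := by
    refine (norm_sub_le _ _).trans ?_
    rw [norm_pow, norm_ee]; norm_num
  rw [div_le_iff₀ (by linarith)]
  have h4 : 1 ≤ K * |t| := by
    rw [div_le_iff₀ hK] at h; linarith
  nlinarith

theorem norm_sum_ee_le_card {ι : Type*} (s : Finset ι) (f : ι → ℝ) :
    ‖∑ x ∈ s, ee (f x)‖ ≤ s.card := by
  refine (norm_sum_le _ _).trans ?_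
  simp [norm_ee]

theorem normSq_sum_range (f : ℕ → ℂ) (N : ℕ) :
    ‖∑ x ∈ range N, f x‖ ^ 2 = ∑ x ∈ range N, ‖f x‖ ^ 2 +
      2 * (∑ h ∈ range N, ∑ x ∈ range (N - 1 - h), f (x + (h + 1)) * (starRingEnd ℂ) (f x)).re := by
  induction N with
  | zero => simp
  | succ N ih =>
    have e1 : ∑ h ∈ range (N + 1), ∑ x ∈ range (N + 1 - 1 - h),
          f (x + (h + 1)) * (starRingEnd ℂ) (f x) =
        ∑ h ∈ range N, ∑ x ∈ range (N - 1 - h), f (x + (h + 1)) * (starRingEnd ℂ) (f x) +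
          f N * (starRingEnd ℂ) (∑ x ∈ range N, f x) := by
      rw [sum_range_succ]
      simp only [Nat.add_sub_cancel, Nat.sub_self, range_zero, sum_empty, add_zero]
      rw [map_sum, mul_sum, ← sum_range_reflect (fun x => f N * (starRingEnd ℂ) (f x)),
        ← sum_add_distrib]
      refine sum_congr rfl fun h hh => ?_
      have hh' := mem_range.1 hh
      have e2 : N - h = (N - 1 - h) + 1 := by omega
      rw [e2, sum_range_succ]
      congr 3
      omega
    rw [e1, sum_range_succ, sum_range_succ, Complex.add_re, mul_add, ← Complex.normSq_eq_norm_sq,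
      Complex.normSq_add, Complex.normSq_eq_norm_sq, Complex.normSq_eq_norm_sq, ih]
    have : (f N * (starRingEnd ℂ) (∑ x ∈ range N, f x)).re =
        ((∑ x ∈ range N, f x) * (starRingEnd ℂ) (f N)).re := by
      simp; ring
    rw [this]; ring

theorem normSq_sum_range_le (f : ℕ → ℂ) (N : ℕ) :
    ‖∑ x ∈ range N, f x‖ ^ 2 ≤ ∑ x ∈ range N, ‖f x‖ ^ 2 +
      2 * ∑ h ∈ range N, ‖∑ x ∈ range (N - 1 - h), f (x + (h + 1)) * (starRingEnd ℂ) (f x)‖ := by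
  rw [normSq_sum_range]
  gcongr
  exact (Complex.re_le_norm _).trans (norm_sum_le _ _)

theorem card_near_int_le {α : ℝ} {r : ℤ} {q : ℕ} (hq : 0 < q) (hrq : IsCoprime r (q : ℤ))
    (hα : |α - r / q| ≤ 1 / (q : ℝ) ^ 2) {δ : ℝ} (hδ : 0 < δ) (H : ℕ) :
    (((range H).filter (fun h : ℕ => |h * α - round (h * α)| < δ)).card : ℝ) ≤
      (H / q + 1) * (2 * q * δ + 3) := by
  have hq' : (0 : ℝ) < q := by exact_mod_cast hq
  set s := (range H).filter (fun h : ℕ => |h * α - round (h * α)| < δ)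
  have hmaps : ∀ h ∈ s, h / q ∈ range (H / q + 1) := by
    intro h hh
    have := mem_range.1 (mem_filter.1 hh).1
    rw [mem_range]
    exact Nat.lt_succ_of_le (Nat.div_le_div_right this.le)
  rw [card_eq_sum_card_fiberwise hmaps]
  push_cast
  have hfib : ∀ b ∈ range (H / q + 1), ((s.filter (fun h => h / q = b)).card : ℝ) ≤
      2 * q * δ + 3 := by
    intro b _
    set β := α - r / q with hβ
    set v : ℝ := -(b * q ^ 2 * β)
    set u : ℝ := q * δ + 1
    have hu : 0 ≤ u := by positivity
    have hcard : (s.filter (fun h => h / q = b)).card ≤ (Icc ⌈v - u⌉ ⌊v + u⌋).card := by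
      refine card_le_card_of_injOn (fun h : ℕ => (h : ℤ) * r - q * round (h * α)) ?_ ?_
      · intro h hh
        obtain ⟨hhs, hb⟩ := mem_filter.1 (mem_coe.1 hh)
        have hnear := (mem_filter.1 hhs).2
        have hj : (h : ℝ) = b * q + (h % q : ℕ) := by
          rw [← hb]; exact_mod_cast (Nat.div_add_mod' h q).symm
        have hjq : ((h % q : ℕ) : ℝ) ≤ q := by exact_mod_cast (Nat.mod_lt h hq).le
        have e : (((h : ℤ) * r - q * round (h * α) : ℤ) : ℝ) - v =
            q * (h * α - round (h * α)) - (h % q : ℕ) * q * β := by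
          have hr : (r : ℝ) = q * α - q * β := by rw [hβ]; field_simp; ring
          push_cast
          simp only [v]
          rw [hr]
          have := hj
          linear_combination (-(q : ℝ) * β) * this
        have hb1 : |q * (h * α - round (h * α)) - (h % q : ℕ) * q * β| ≤ u := by
          refine (abs_sub _ _).trans ?_
          rw [abs_mul, abs_mul, abs_of_pos hq', abs_mul, abs_of_pos hq',
            abs_of_nonneg (Nat.cast_nonneg (h % q) : (0 : ℝ) ≤ ((h % q : ℕ) : ℝ))]
          have h1 : q * |h * α - round (h * α)| ≤ q * δ := by gcongr
          have h2 : ((h % q : ℕ) : ℝ) * q * |β| ≤ q * q * (1 / (q : ℝ) ^ 2) := by gcongr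
          have h3 : (q : ℝ) * q * (1 / (q : ℝ) ^ 2) = 1 := by field_simp
          simp only [u]; linarith
        rw [← e, abs_le] at hb1
        simp only [coe_Icc, Set.mem_Icc]
        exact ⟨Int.ceil_le.2 (by linarith), Int.le_floor.2 (by linarith)⟩
      · intro h hh h' hh' heq
        have hb := (mem_filter.1 (mem_coe.1 hh)).2
        have hb' := (mem_filter.1 (mem_coe.1 hh')).2
        simp only at heq
        have hdvd : (q : ℤ) ∣ ((h : ℤ) - h') := by
          refine hrq.symm.dvd_of_dvd_mul_right ?_
          exact ⟨round (h * α) - round (h' * α), by linear_combination heq⟩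
        have hmod : h % q = h' % q := by
          have := (Int.emod_emod_of_dvd h (dvd_refl (q : ℤ)))
          have h5 : (h : ℤ) % q = h' % q := Int.emod_eq_emod_iff_emod_sub_eq_zero.2
            (Int.emod_eq_zero_of_dvd hdvd)
          exact_mod_cast h5
        rw [← Nat.div_add_mod h q, ← Nat.div_add_mod h' q, hb, hb', hmod]
    have hcard2 : ((Icc ⌈v - u⌉ ⌊v + u⌋).card : ℝ) ≤ 2 * u + 1 := by
      rw [Int.card_Icc]
      have h1 := Int.floor_le (v + u)
      have h2 := Int.le_ceil (v - u)
      rcases le_total 0 (⌊v + u⌋ + 1 - ⌈v - u⌉) with h0 | h0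
      · have : (((⌊v + u⌋ + 1 - ⌈v - u⌉).toNat : ℤ) : ℝ) = ((⌊v + u⌋ + 1 - ⌈v - u⌉ : ℤ) : ℝ) := by
          rw [Int.toNat_of_nonneg h0]
        rw [Int.cast_natCast] at this
        rw [this]; push_cast; linarith
      · rw [Int.toNat_of_nonpos h0]; simp; linarith
    calc _ ≤ ((Icc ⌈v - u⌉ ⌊v + u⌋).card : ℝ) := by exact_mod_cast hcard
      _ ≤ 2 * u + 1 := hcard2
      _ = _ := by simp only [u]; ring
  refine (sum_le_sum hfib).trans ?_
  rw [sum_const, card_range, nsmul_eq_mul]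
  gcongr
  push_cast
  have : ((H / q : ℕ) : ℝ) ≤ H / q := Nat.cast_div_le
  linarith

/-! ### Quadratic Weyl sums on minor arcs -/

theorem normSq_quadratic_sum_le {c : ℕ} (hc : 0 < c) {α : ℝ} {r : ℤ} {q : ℕ} (hq : 0 < q)
    (hrq : IsCoprime r (q : ℤ)) (hα : |α - r / q| ≤ 1 / (q : ℝ) ^ 2) {K : ℝ} (hK : 0 < K) (N : ℕ) :
    ‖∑ x ∈ range N, ee (α * (c * ((x : ℝ) + 1) ^ 2))‖ ^ 2 ≤
      N + 2 * (N * K + N * (((2 * c * N + 1 : ℕ) / q + 1) * (2 * q * (1 / K) + 3))) := by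
  refine (normSq_sum_range_le _ N).trans ?_
  have h1 : ∑ x ∈ range N, ‖ee (α * (c * ((x : ℝ) + 1) ^ 2))‖ ^ 2 = N := by simp [norm_ee]
  rw [h1]
  gcongr
  set bad := (range (2 * c * N + 1)).filter (fun h : ℕ => |h * α - round (h * α)| < 1 / K)
  have hinner : ∀ h ∈ range N, ‖∑ x ∈ range (N - 1 - h),
      ee (α * (c * (((x + (h + 1) : ℕ) : ℝ) + 1) ^ 2)) *
        (starRingEnd ℂ) (ee (α * (c * ((x : ℝ) + 1) ^ 2)))‖ ≤
      K + N * (if 2 * c * (h + 1) ∈ bad then 1 else 0) := by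
    intro h hh
    have hh' := mem_range.1 hh
    have e : ∀ x : ℕ, ee (α * (c * (((x + (h + 1) : ℕ) : ℝ) + 1) ^ 2)) *
        (starRingEnd ℂ) (ee (α * (c * ((x : ℝ) + 1) ^ 2))) =
        ee (α * c * ((h + 1) ^ 2 + 2 * (h + 1))) * ee (((2 * c * (h + 1) : ℕ) * α) * x) := by
      intro x
      rw [conj_ee, ← ee_add, ← ee_add]
      congr 1; push_cast; ring
    simp_rw [e]
    rw [← mul_sum, norm_mul, norm_ee, one_mul]
    split_ifs with hb
    · rw [mul_one]
      refine (norm_sum_ee_le_card _ _).trans ?_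
      rw [card_range]
      have : ((N - 1 - h : ℕ) : ℝ) ≤ N := by exact_mod_cast (by omega)
      linarith
    · rw [mul_zero, add_zero]
      refine norm_sum_ee_mul_le hK ?_ _
      by_contra hlt
      refine hb (mem_filter.2 ⟨?_, not_le.1 hlt⟩)
      rw [mem_range, Nat.lt_succ_iff]
      exact Nat.mul_le_mul_left _ hh'
  refine (sum_le_sum hinner).trans ?_
  rw [sum_add_distrib, ← mul_sum, sum_const, card_range, nsmul_eq_mul]
  gcongr
  have hcard : ∑ h ∈ range N, (if 2 * c * (h + 1) ∈ bad then (1 : ℝ) else 0) ≤ bad.card := by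
    rw [sum_boole]
    have : ((range N).filter (fun h => 2 * c * (h + 1) ∈ bad)).card ≤ bad.card := by
      refine card_le_card_of_injOn (fun h => 2 * c * (h + 1)) ?_ ?_
      · intro h hh; exact (mem_filter.1 hh).2
      · intro a _ b _ hab
        have := Nat.eq_of_mul_eq_mul_left (by positivity : 0 < 2 * c) hab
        omega
    exact_mod_cast this
  exact hcard.trans (card_near_int_le hq hrq hα (by positivity) _)

/-- The Weyl sum over `x ≥ 1` with `c * x ^ 2 ≤ B`. -/
noncomputable def W (c : ℕ) (α B : ℝ) : ℂ :=
  ∑ x ∈ range ⌊√(B / c)⌋₊, ee (α * (c * ((x : ℝ) + 1) ^ 2))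

theorem floor_sqrt_div_le {c : ℕ} (B : ℝ) : (⌊√(B / c)⌋₊ : ℝ) ≤ √B / √c := by
  rw [← Real.sqrt_div' _ (Nat.cast_nonneg c)]
  exact Nat.floor_le (Real.sqrt_nonneg _)

theorem norm_W_le (c : ℕ) (α B : ℝ) : ‖W c α B‖ ≤ √B / √c := by
  refine (norm_sum_ee_le_card _ _).trans ?_
  rw [card_range]
  exact floor_sqrt_div_le B

theorem norm_W_minor_le {c : ℕ} (hc : 0 < c) {α B T : ℝ} (hT : 1 ≤ T) (hB : T ^ 8 ≤ B)
    {r : ℤ} {q : ℕ} (hq : T ^ 4 ≤ q) (hqB : (q : ℝ) ≤ B / T ^ 4)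
    (hrq : IsCoprime r (q : ℤ)) (hα : |α - r / q| ≤ 1 / (q : ℝ) ^ 2) :
    ‖W c α B‖ ≤ 7 * (√B / T) := by
  have hT0 : 0 < T := by linarith
  have hB0 : 0 < B := lt_of_lt_of_le (by positivity) hB
  have hq0' : (0 : ℝ) < q := lt_of_lt_of_le (by positivity) hq
  have hq0 : 0 < q := by exact_mod_cast hq0'
  set b := √B with hb
  have hbb : b ^ 2 = B := Real.sq_sqrt hB0.le
  have hb0 : 0 < b := Real.sqrt_pos.2 hB0
  have hbT : T ^ 4 ≤ b := by
    apply Real.le_sqrt_of_sq_le; rw [← pow_mul]; exact hB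
  set K : ℝ := b / T ^ 2 with hKdef
  have hK : 0 < K := by positivity
  have hc' : (1 : ℝ) ≤ c := by exact_mod_cast hc
  set N := ⌊√(B / c)⌋₊ with hN
  have h := normSq_quadratic_sum_le hc hq0 hrq hα hK N
  have hcN : c * (N : ℝ) ^ 2 ≤ B := by
    have : (N : ℝ) ^ 2 ≤ B / c := by
      have h1 : (N : ℝ) ≤ √(B / c) := Nat.floor_le (Real.sqrt_nonneg _)
      calc (N : ℝ) ^ 2 ≤ √(B / c) ^ 2 := by gcongr
        _ = _ := Real.sq_sqrt (by positivity)
    rw [le_div_iff₀ (by linarith)] at this; linarith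
  have hNb : (N : ℝ) ≤ b := by
    apply Real.le_sqrt_of_sq_le
    nlinarith [sq_nonneg (N : ℝ)]
  have hT1 : 1 ≤ T ^ 2 := one_le_pow₀ hT
  have hb1 : 1 ≤ b := by nlinarith [one_le_pow₀ hT (n := 4)]
  have hX : ‖W c α B‖ ^ 2 ≤ 43 * (B / T ^ 2) := by
    refine h.trans ?_
    have e1 : (N : ℝ) ≤ B / T ^ 2 := by
      rw [le_div_iff₀ (by positivity)]
      calc N * T ^ 2 ≤ b * T ^ 4 := by
            gcongr
            norm_num
        _ ≤ b * b := by gcongr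
        _ = B := by rw [← hbb]; ring
    have e2 : N * K ≤ B / T ^ 2 := by
      rw [← hbb, hKdef]
      calc N * (b / T ^ 2) ≤ b * (b / T ^ 2) := by gcongr
        _ = _ := by ring
    have e3 : N * (2 * c * N + 1) ≤ 3 * B := by
      have : (N : ℝ) ≤ B := by nlinarith
      nlinarith
    have e4 : (N * (2 * c * N + 1)) / q * (2 * q * (1 / K)) ≤ 6 * (B / T ^ 2) := by
      calc (N * (2 * c * N + 1)) / q * (2 * q * (1 / K)) =
            (N * (2 * c * N + 1)) * (2 / K) := by field_simp
        _ ≤ (3 * B) * (2 / K) := by gcongr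
        _ = 6 * (b * T ^ 2) := by rw [← hbb, hKdef]; field_simp; ring
        _ ≤ 6 * (B / T ^ 2) := by
          gcongr
          rw [le_div_iff₀ (by positivity), ← hbb]
          calc b * T ^ 2 * T ^ 2 = b * T ^ 4 := by ring
            _ ≤ b * b := by gcongr
            _ = _ := by ring
    have e5 : (N * (2 * c * N + 1)) / q * 3 ≤ 9 * (B / T ^ 2) := by
      calc (N * (2 * c * N + 1)) / q * 3 ≤ (3 * B) / T ^ 2 * 3 := by
            gcongr
            exact le_trans (by gcongr <;> first | exact hT | norm_num) hq
        _ = _ := by ring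
    have e6 : N * (2 * q * (1 / K)) ≤ 2 * (B / T ^ 2) := by
      calc N * (2 * q * (1 / K)) ≤ b * (2 * (B / T ^ 4) * (1 / K)) := by gcongr
        _ = _ := by rw [hKdef]; field_simp
    push_cast
    have e7 : (N : ℝ) * (((2 * c * N + 1) / q + 1) * (2 * q * (1 / K) + 3)) =
        (N * (2 * c * N + 1)) / q * (2 * q * (1 / K)) + (N * (2 * c * N + 1)) / q * 3 +
        N * (2 * q * (1 / K)) + 3 * N := by ring
    rw [e7]
    linarith
  refine abs_le_of_sq_le_sq' ?_ (by positivity) |>.2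
  refine hX.trans ?_
  rw [mul_pow, div_pow, hbb]
  have : 0 ≤ B / T ^ 2 := by positivity
  linarith

/-! ### Quadratic Weyl sums on major arcs -/

theorem norm_sum_periodic_mul_sub_le {w : ℕ → ℂ} {q : ℕ} (hq : 0 < q) (hw : ∀ x, ‖w x‖ ≤ 1)
    (hper : ∀ x, w (x + q) = w x) {e : ℝ → ℂ} (he : Continuous e) {L X : ℝ}
    (hL : ∀ s t, 0 ≤ s → s ≤ X → 0 ≤ t → t ≤ X → ‖e s - e t‖ ≤ L * |s - t|) (hL0 : 0 ≤ L)
    (M : ℕ) (hM : ((q * M : ℕ) : ℝ) ≤ X) :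
    ‖∑ x ∈ range (q * M), w x * e (x + 1) -
      ((∑ j ∈ range q, w j) / q) * ∫ t in (0 : ℝ)..((q * M : ℕ) : ℝ), e t‖ ≤ M * (q * (L * q)) := by
  induction M with
  | zero => simp
  | succ M ih =>
    have hq' : (0 : ℝ) < q := by exact_mod_cast hq
    have hqc : (q : ℂ) ≠ 0 := by exact_mod_cast hq.ne'
    have hle : ((q * M : ℕ) : ℝ) ≤ ((q * (M + 1) : ℕ) : ℝ) := by
      exact_mod_cast Nat.mul_le_mul_left q (Nat.le_succ M)
    have ih' := ih (hle.trans hM)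
    have hint : ∀ a b : ℝ, IntervalIntegrable e MeasureTheory.volume a b :=
      fun a b => he.intervalIntegrable a b
    have hend : ((q * (M + 1) : ℕ) : ℝ) = ((q * M : ℕ) : ℝ) + q := by push_cast; ring
    rw [← intervalIntegral.integral_add_adjacent_intervals (hint 0 ((q * M : ℕ) : ℝ))
      (hint ((q * M : ℕ) : ℝ) _)]
    rw [show q * (M + 1) = q * M + q by ring, sum_range_add] at *
    have hwp : ∀ j, w (q * M + j) = w j := by
      intro j
      clear ih ih' hle hM hend
      induction M with
      | zero => simp
      | succ M ihM => rw [show q * (M + 1) + j = (q * M + j) + q by ring, hper, ihM]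
    set A := ((q * M : ℕ) : ℝ) with hA
    have hA0 : 0 ≤ A := Nat.cast_nonneg _
    have hblock : ‖∑ j ∈ range q, w (q * M + j) * e (((q * M + j : ℕ) : ℝ) + 1) -
        ((∑ j ∈ range q, w j) / q) * ∫ t in A..((q * M + q : ℕ) : ℝ), e t‖ ≤ q * (L * q) := by
      have e1 : ∑ j ∈ range q, w (q * M + j) * e (((q * M + j : ℕ) : ℝ) + 1) -
          ((∑ j ∈ range q, w j) / q) * ∫ t in A..((q * M + q : ℕ) : ℝ), e t =
          ∑ j ∈ range q, w j * (1 / q) *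
            ∫ t in A..((q * M + q : ℕ) : ℝ), (e (((q * M + j : ℕ) : ℝ) + 1) - e t) := by
        rw [sum_div, sum_mul, ← sum_sub_distrib]
        refine sum_congr rfl fun j _ => ?_
        rw [intervalIntegral.integral_sub intervalIntegrable_const (hint _ _),
          intervalIntegral.integral_const, hwp, hend]
        simp only [add_sub_cancel_left, Complex.real_smul, Complex.ofReal_natCast]
        field_simp
      rw [e1]
      have e2 : ∀ j ∈ range q, ‖w j * (1 / q) *
            ∫ t in A..((q * M + q : ℕ) : ℝ), (e (((q * M + j : ℕ) : ℝ) + 1) - e t)‖ ≤ L * q := by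
        intro j hj
        have hj' := mem_range.1 hj
        have hj1 : (j : ℝ) + 1 ≤ q := by exact_mod_cast hj'
        have hj0 : (0 : ℝ) ≤ j := Nat.cast_nonneg j
        have hI : ‖∫ t in A..((q * M + q : ℕ) : ℝ), (e (((q * M + j : ℕ) : ℝ) + 1) - e t)‖ ≤
            (L * q) * |((q * M + q : ℕ) : ℝ) - A| := by
          refine intervalIntegral.norm_integral_le_of_norm_le_const fun t ht => ?_
          rw [Set.uIoc_of_le hle] at ht
          have hs : ((q * M + j : ℕ) : ℝ) + 1 = A + (j + 1) := by rw [hA]; push_cast; ring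
          rw [hs]
          rw [hend] at ht hM
          refine (hL _ _ (by linarith) (by linarith) (by linarith [ht.1]) (ht.2.trans hM)).trans ?_
          gcongr
          rw [abs_le]; constructor <;> linarith [ht.1, ht.2]
        rw [hend, add_sub_cancel_left, abs_of_pos hq'] at hI
        rw [norm_mul, norm_mul, norm_div, norm_one, Complex.norm_natCast]
        rw [← hend] at hI
        calc ‖w j‖ * (1 / q) * ‖∫ t in A..((q * M + q : ℕ) : ℝ),
                (e (((q * M + j : ℕ) : ℝ) + 1) - e t)‖ ≤ 1 * (1 / q) * (L * q * q) := by
              gcongr; exact hw j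
          _ = L * q := by field_simp
      refine (norm_sum_le _ _).trans ((sum_le_sum e2).trans ?_)
      rw [sum_const, card_range, nsmul_eq_mul]
    have e3 : ∑ x ∈ range (q * M), w x * e (x + 1) +
        ∑ j ∈ range q, w (q * M + j) * e (((q * M + j : ℕ) : ℝ) + 1) -
        ((∑ j ∈ range q, w j) / q) * ((∫ t in (0 : ℝ)..A, e t) +
          ∫ t in A..((q * M + q : ℕ) : ℝ), e t) =
        (∑ x ∈ range (q * M), w x * e (x + 1) -
          ((∑ j ∈ range q, w j) / q) * (∫ t in (0 : ℝ)..A, e t)) +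
        (∑ j ∈ range q, w (q * M + j) * e (((q * M + j : ℕ) : ℝ) + 1) -
        ((∑ j ∈ range q, w j) / q) * ∫ t in A..((q * M + q : ℕ) : ℝ), e t) := by ring
    rw [e3]
    refine (norm_add_le _ _).trans ((add_le_add ih' hblock).trans ?_)
    push_cast
    linarith

/-- The Gauss sum attached to `c` at `r / q`. -/
noncomputable def G (q : ℕ) (r : ℤ) (c : ℕ) : ℂ :=
  ∑ j ∈ range q, ee ((r : ℝ) / q * (c * ((j : ℝ) + 1) ^ 2))

/-- The oscillatory integral `∫₀¹ exp (2πi u t²) dt`. -/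
noncomputable def osc (u : ℝ) : ℂ := ∫ t in (0 : ℝ)..1, ee (u * t ^ 2)

theorem norm_osc_le (u : ℝ) : ‖osc u‖ ≤ 1 := by
  have := intervalIntegral.norm_integral_le_of_norm_le_const (a := 0) (b := 1)
    (f := fun t : ℝ => ee (u * t ^ 2)) (C := 1) (fun t _ => (norm_ee _).le)
  simpa [osc] using this

theorem continuous_osc : Continuous osc := by
  unfold osc
  refine intervalIntegral.continuous_parametric_intervalIntegral_of_continuous' ?_ 0 1
  exact continuous_ee.comp (by fun_prop)

theorem norm_G_le (q : ℕ) (r : ℤ) (c : ℕ) : ‖G q r c‖ ≤ q := by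
  refine (norm_sum_ee_le_card _ _).trans ?_
  rw [card_range]

theorem norm_W_major_sub_le {c : ℕ} (hc : 0 < c) {q : ℕ} (hq : 0 < q) (r : ℤ) (β : ℝ) {B : ℝ}
    (hB : 0 ≤ B) :
    ‖W c (r / q + β) B - G q r c / q * ((√B / √c : ℝ) * osc (β * B))‖ ≤
      13 * q * (1 + |β| * B) := by
  have hq' : (0 : ℝ) < q := by exact_mod_cast hq
  have hq1 : (1 : ℝ) ≤ q := by exact_mod_cast hq
  have hc' : (0 : ℝ) < c := by exact_mod_cast hc
  set X : ℝ := √(B / c) with hX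
  have hX0 : 0 ≤ X := Real.sqrt_nonneg _
  have hXX : c * X ^ 2 = B := by rw [hX, Real.sq_sqrt (by positivity)]; field_simp
  have hXe : √B / √c = X := by rw [hX, Real.sqrt_div' _ hc'.le]
  set N := ⌊X⌋₊ with hN
  have hNX : (N : ℝ) ≤ X := Nat.floor_le hX0
  have hXN : X < N + 1 := Nat.lt_floor_add_one X
  set w : ℕ → ℂ := fun x => ee ((r : ℝ) / q * (c * ((x : ℝ) + 1) ^ 2)) with hw
  set e : ℝ → ℂ := fun t => ee (β * c * t ^ 2) with he
  have hec : Continuous e := continuous_ee.comp (by fun_prop)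
  have hper : ∀ x, w (x + q) = w x := by
    intro x
    simp only [hw]
    have : (r : ℝ) / q * (c * (((x + q : ℕ) : ℝ) + 1) ^ 2) =
        (r : ℝ) / q * (c * ((x : ℝ) + 1) ^ 2) + ((r * c * (2 * (x + 1) + q) : ℤ) : ℝ) := by
      push_cast; field_simp; ring
    rw [this, ee_add, ee_int, mul_one]
  set L : ℝ := 4 * Real.pi * (|β| * c * X) with hLdef
  have hL0 : 0 ≤ L := by positivity
  have hL : ∀ s t, 0 ≤ s → s ≤ X → 0 ≤ t → t ≤ X → ‖e s - e t‖ ≤ L * |s - t| := by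
    intro s t hs hsX ht htX
    refine (norm_ee_sub_le _ _).trans ?_
    have : β * c * s ^ 2 - β * c * t ^ 2 = β * c * (s + t) * (s - t) := by ring
    rw [this, abs_mul, abs_mul, abs_mul, abs_of_pos hc', abs_of_nonneg (add_nonneg hs ht)]
    calc 2 * Real.pi * (|β| * c * (s + t) * |s - t|) ≤
          2 * Real.pi * (|β| * c * (2 * X) * |s - t|) := by
          gcongr; linarith
      _ = _ := by rw [hLdef]; ring
  set M := N / q with hM
  have hqM : q * M ≤ N := Nat.mul_div_le N q
  have hqMX : ((q * M : ℕ) : ℝ) ≤ X := le_trans (by exact_mod_cast hqM) hNX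
  have hNq : N < q * M + q := by
    have := Nat.lt_div_mul_add (a := N) hq
    rw [mul_comm]; exact this
  have hmain := norm_sum_periodic_mul_sub_le (w := w) hq (fun x => (norm_ee _).le) hper hec hL hL0 M hqMX
  have hW : W c (r / q + β) B = ∑ x ∈ range N, w x * e (x + 1) := by
    unfold W
    refine sum_congr rfl fun x _ => ?_
    simp only [hw, he]
    rw [← ee_add]; congr 1; ring
  have hosc : (X : ℂ) * osc (β * B) = ∫ t in (0 : ℝ)..X, e t := by
    have h1 := intervalIntegral.smul_integral_comp_mul_left (a := 0) (b := 1) e X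
    rw [mul_zero, mul_one] at h1
    rw [← h1, Complex.real_smul]
    congr 1
    unfold osc
    refine intervalIntegral.integral_congr fun t _ => ?_
    simp only [he]
    congr 1; rw [← hXX]; ring
  have hsplit : ∑ x ∈ range N, w x * e (x + 1) = ∑ x ∈ range (q * M), w x * e (x + 1) +
      ∑ x ∈ range (N - q * M), w (q * M + x) * e (((q * M + x : ℕ) : ℝ) + 1) := by
    rw [← sum_range_add]; congr 2; omega
  have hrest : ‖∑ x ∈ range (N - q * M), w (q * M + x) * e (((q * M + x : ℕ) : ℝ) + 1)‖ ≤ q := by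
    refine (norm_sum_le _ _).trans ?_
    simp only [norm_mul, hw, he, norm_ee, mul_one, sum_const, card_range, nsmul_eq_mul]
    exact_mod_cast (by omega : N - q * M ≤ q)
  have hIrest : ‖∫ t in ((q * M : ℕ) : ℝ)..X, e t‖ ≤ q + 1 := by
    refine (intervalIntegral.norm_integral_le_of_norm_le_const
      (C := 1) (fun t _ => (norm_ee _).le)).trans ?_
    rw [one_mul, abs_of_nonneg (by linarith)]
    have : (N : ℝ) ≤ ((q * M : ℕ) : ℝ) + q := by exact_mod_cast hNq.le
    linarith
  have hG : ‖G q r c / q‖ ≤ 1 := by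
    rw [norm_div, Complex.norm_natCast, div_le_one hq']; exact norm_G_le q r c
  rw [hXe, hosc, hW, hsplit, ← intervalIntegral.integral_add_adjacent_intervals
    (hec.intervalIntegrable 0 ((q * M : ℕ) : ℝ)) (hec.intervalIntegrable ((q * M : ℕ) : ℝ) X)]
  have hGw : G q r c = ∑ j ∈ range q, w j := rfl
  rw [← hGw] at hmain
  have e4 : ∀ a b g i₁ i₂ : ℂ, a + b - g * (i₁ + i₂) = (a - g * i₁) + (b - g * i₂) := by
    intros; ring
  rw [e4]
  have h3 : ‖G q r c / q * ∫ t in ((q * M : ℕ) : ℝ)..X, e t‖ ≤ q + 1 := by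
    rw [norm_mul]
    calc _ ≤ 1 * ((q : ℝ) + 1) := by gcongr
      _ = _ := one_mul _
  have h4 : M * (q * (L * q)) ≤ 13 * q * (|β| * B) := by
    calc M * (q * (L * q)) = ((q * M : ℕ) : ℝ) * (L * q) := by push_cast; ring
      _ ≤ X * (L * q) := by gcongr
      _ = 4 * Real.pi * q * (|β| * (c * X ^ 2)) := by rw [hLdef]; ring
      _ = 4 * Real.pi * q * (|β| * B) := by rw [hXX]
      _ ≤ _ := by
        gcongr
        linarith [Real.pi_lt_d2]
  refine (norm_add_le _ _).trans ((add_le_add hmain (norm_sub_le _ _)).trans ?_)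
  linarith

/-! ### The sets of squareful multiples of `d` and their generating functions -/

open Classical in
/-- Positive squareful multiples of `d` up to `B`. -/
noncomputable def P (d : ℕ) (B : ℝ) : Finset ℕ :=
  (Icc 1 ⌊B⌋₊).filter (fun a => Squareful (a : ℤ) ∧ d ∣ a)

open Classical in
/-- Squarefree positive integers up to `B`. -/
noncomputable def Y (B : ℝ) : Finset ℕ := (Icc 1 ⌊B⌋₊).filter Squarefree

/-- Squareful multiples of `d` of absolute value at most `B`. -/
noncomputable def S (d : ℕ) (B : ℝ) : Finset ℤ :=
  insert 0 ((P d B).image (fun a : ℕ => (a : ℤ)) ∪ (P d B).image (fun a : ℕ => -(a : ℤ)))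

/-- The generating function of `P d B`. -/
noncomputable def g (d : ℕ) (B α : ℝ) : ℂ := ∑ a ∈ P d B, ee ((a : ℝ) * α)

/-- The generating function of `S d B`. -/
noncomputable def f (d : ℕ) (B α : ℝ) : ℂ := ∑ a ∈ S d B, ee ((a : ℝ) * α)

theorem mem_P {d : ℕ} {B : ℝ} {a : ℕ} :
    a ∈ P d B ↔ 0 < a ∧ (a : ℝ) ≤ B ∧ Squareful (a : ℤ) ∧ d ∣ a := by
  classical
  unfold P
  rw [mem_filter, mem_Icc]
  constructor
  · rintro ⟨⟨h1, h2⟩, h3⟩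
    exact ⟨h1, (Nat.le_floor_iff' (by omega)).1 h2, h3⟩
  · rintro ⟨h1, h2, h3⟩
    exact ⟨⟨h1, Nat.le_floor h2⟩, h3⟩

theorem mem_Y {B : ℝ} {y : ℕ} : y ∈ Y B ↔ 0 < y ∧ (y : ℝ) ≤ B ∧ Squarefree y := by
  classical
  unfold Y
  rw [mem_filter, mem_Icc]
  constructor
  · rintro ⟨⟨h1, h2⟩, h3⟩
    exact ⟨h1, (Nat.le_floor_iff' (by omega)).1 h2, h3⟩
  · rintro ⟨h1, h2, h3⟩
    exact ⟨⟨h1, Nat.le_floor h2⟩, h3⟩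

theorem squareful_neg {a : ℤ} : Squareful (-a) ↔ Squareful a := by simp [Squareful]

theorem squareful_zero : Squareful 0 := by simp [Squareful]

theorem mem_S {d : ℕ} {B : ℝ} (hB : 0 ≤ B) {a : ℤ} :
    a ∈ S d B ↔ (|a| : ℝ) ≤ B ∧ Squareful a ∧ (d : ℤ) ∣ a := by
  unfold S
  simp only [mem_insert, mem_union, mem_image, mem_P]
  constructor
  · rintro (rfl | ⟨b, ⟨hb0, hbB, hs, hd⟩, rfl⟩ | ⟨b, ⟨hb0, hbB, hs, hd⟩, rfl⟩)
    · simp [squareful_zero, hB]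
    · refine ⟨by simpa using hbB, hs, by exact_mod_cast hd⟩
    · refine ⟨by simpa using hbB, squareful_neg.2 hs, ?_⟩
      rw [dvd_neg]; exact_mod_cast hd
  · rintro ⟨h1, h2, h3⟩
    rcases lt_trichotomy a 0 with h | h | h
    · right; right
      obtain ⟨b, hb⟩ := Int.eq_ofNat_of_zero_le (neg_pos.2 h).le
      obtain rfl : a = -b := by omega
      refine ⟨b, ⟨by omega, by simpa using h1, squareful_neg.1 h2, ?_⟩, rfl⟩
      rw [dvd_neg] at h3; exact_mod_cast h3
    · left; exact h
    · right; left
      obtain ⟨b, hb⟩ := Int.eq_ofNat_of_zero_le h.le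
      subst hb
      exact ⟨b, ⟨by omega, by simpa using h1, h2, by exact_mod_cast h3⟩, rfl⟩

theorem sum_S {M : Type*} [AddCommMonoid M] (d : ℕ) (B : ℝ) (F : ℤ → M) :
    ∑ a ∈ S d B, F a = F 0 + (∑ a ∈ P d B, F a + ∑ a ∈ P d B, F (-(a : ℤ))) := by
  unfold S
  rw [sum_insert, sum_union, sum_image, sum_image]
  · intro a _ b _ h; simpa using h
  · intro a _ b _ h; simpa using h
  · rw [disjoint_left]
    intro a ha ha'
    obtain ⟨b, hb, rfl⟩ := mem_image.1 ha
    obtain ⟨b', hb', h⟩ := mem_image.1 ha'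
    have := (mem_P.1 hb).1
    have := (mem_P.1 hb').1
    omega
  · intro h
    rcases mem_union.1 h with h | h <;> obtain ⟨b, hb, h⟩ := mem_image.1 h <;>
      have := (mem_P.1 hb).1 <;> omega

theorem card_S (d : ℕ) (B : ℝ) : (S d B).card = 1 + 2 * (P d B).card := by
  rw [card_eq_sum_ones, sum_S]; simp; ring

theorem f_eq (d : ℕ) (B α : ℝ) : f d B α = 1 + (g d B α + (starRingEnd ℂ) (g d B α)) := by
  unfold f g
  rw [sum_S d B (fun a : ℤ => ee ((a : ℝ) * α)), map_sum]
  simp only [Int.cast_zero, zero_mul, ee_zero, Int.cast_natCast, Int.cast_neg, neg_mul, conj_ee]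

theorem norm_f_le (d : ℕ) (B α : ℝ) : ‖f d B α‖ ≤ 1 + 2 * ‖g d B α‖ := by
  rw [f_eq]
  refine (norm_add_le _ _).trans ?_
  have := norm_add_le (g d B α) ((starRingEnd ℂ) (g d B α))
  rw [RCLike.norm_conj] at this
  rw [norm_one]; linarith

theorem continuous_f (d : ℕ) (B : ℝ) : Continuous (f d B) := by
  unfold f
  exact continuous_finsetSum _ fun a _ => continuous_ee.comp (by fun_prop)

theorem continuous_g (d : ℕ) (B : ℝ) : Continuous (g d B) := by
  unfold g
  exact continuous_finsetSum _ fun a _ => continuous_ee.comp (by fun_prop)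

theorem norm_f_le_card (d : ℕ) (B α : ℝ) : ‖f d B α‖ ≤ (S d B).card := norm_sum_ee_le_card _ _

theorem sum_P {M : Type*} [AddCommMonoid M] {d : ℕ} (hd : Squarefree d) {B : ℝ} (hB : 0 ≤ B)
    (F : ℕ → M) :
    ∑ a ∈ P d B, F a =
      ∑ y ∈ Y B, ∑ x ∈ range ⌊√(B / coeff d y)⌋₊, F (coeff d y * (x + 1) ^ 2) := by
  have hd0 : 0 < d := Nat.pos_of_ne_zero hd.ne_zero
  have hq : ∀ y, 0 < d / d.gcd y := fun y =>
    Nat.div_pos (Nat.gcd_le_left y hd0) (Nat.gcd_pos_of_pos_left _ hd0)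
  have hce : ∀ y x, coeff d y * x ^ 2 = y ^ 3 * (d / d.gcd y * x) ^ 2 := by
    intro y x; unfold coeff; ring
  have hlt : ∀ y, 0 < y → ∀ x : ℕ,
      x < ⌊√(B / coeff d y)⌋₊ ↔ ((coeff d y * (x + 1) ^ 2 : ℕ) : ℝ) ≤ B := by
    intro y hy x
    have hc : (0 : ℝ) < coeff d y := by exact_mod_cast coeff_pos hd0 hy
    rw [← Nat.add_one_le_iff, Nat.le_floor_iff (Real.sqrt_nonneg _), Real.le_sqrt' (by positivity),
      le_div_iff₀ hc]
    push_cast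
    rw [mul_comm]
  rw [sum_sigma']
  symm
  refine sum_nbij (fun p => coeff d p.1 * (p.2 + 1) ^ 2) ?_ ?_ ?_ (fun _ _ => rfl)
  · rintro ⟨y, x⟩ h
    simp only [mem_sigma, mem_range, mem_Y] at h
    obtain ⟨⟨hy0, hyB, hy⟩, hx⟩ := h
    rw [mem_P]
    refine ⟨mul_pos (coeff_pos hd0 hy0) (by positivity), (hlt y hy0 x).1 hx, ?_, ?_⟩
    · rw [hce]; exact squareful_cube_mul_sq _ _
    · rw [hce, dvd_cube_mul_sq_iff hd]; exact Nat.dvd_mul_right _ _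
  · rintro ⟨y, x⟩ h ⟨y', x'⟩ h' heq
    simp only [coe_sigma, Set.mem_sigma_iff, mem_coe, mem_Y] at h h'
    simp only [hce] at heq
    obtain ⟨h1, h2⟩ := cube_mul_sq_inj h.1.2.2 h'.1.2.2 (mul_pos (hq y) x.succ_pos)
      (mul_pos (hq y') x'.succ_pos) heq
    subst h1
    have := Nat.eq_of_mul_eq_mul_left (hq y) h2
    obtain rfl : x = x' := by omega
    rfl
  · intro a ha
    obtain ⟨ha0, haB, hs, hda⟩ := mem_P.1 (mem_coe.1 ha)
    obtain ⟨y, z, hy, hy0, hz0, rfl⟩ := exists_cube_mul_sq ha0 hs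
    obtain ⟨x, rfl⟩ := (dvd_cube_mul_sq_iff hd).1 hda
    have hx : 0 < x := Nat.pos_of_mul_pos_left hz0
    obtain ⟨x, rfl⟩ : ∃ x', x = x' + 1 := ⟨x - 1, by omega⟩
    rw [← hce] at haB
    refine ⟨⟨y, x⟩, ?_, hce _ _⟩
    simp only [coe_sigma, Set.mem_sigma_iff, mem_coe, mem_Y, mem_range]
    refine ⟨⟨hy0, le_trans ?_ haB, hy⟩, (hlt y hy0 x).2 haB⟩
    rw [hce]
    have : y ≤ y ^ 3 * (d / d.gcd y * (x + 1)) ^ 2 := by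
      calc y ≤ y ^ 3 := Nat.le_self_pow (by norm_num) y
        _ ≤ _ := Nat.le_mul_of_pos_right _ (by positivity)
    exact_mod_cast this

theorem g_eq {d : ℕ} (hd : Squarefree d) {B : ℝ} (hB : 0 ≤ B) (α : ℝ) :
    g d B α = ∑ y ∈ Y B, W (coeff d y) α B := by
  unfold g W
  rw [sum_P hd hB (fun a : ℕ => ee ((a : ℝ) * α))]
  refine sum_congr rfl fun y _ => sum_congr rfl fun x _ => ?_
  congr 1; push_cast; ring

theorem card_P_le_sum {d : ℕ} (hd : Squarefree d) {B : ℝ} (hB : 0 ≤ B) :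
    ((P d B).card : ℝ) ≤ ∑ y ∈ Y B, √B / √(coeff d y) := by
  rw [card_eq_sum_ones, sum_P hd hB]
  push_cast
  refine sum_le_sum fun y _ => ?_
  simp only [sum_const, card_range, nsmul_eq_mul, mul_one]
  exact floor_sqrt_div_le B

theorem sum_Ioc_inv_sqrt_cube_le {m n : ℕ} (hm : 0 < m) (hmn : m ≤ n) :
    ∑ y ∈ Ioc m n, 1 / √((y : ℝ) ^ 3) ≤ 2 / √m - 2 / √n := by
  induction n, hmn using Nat.le_induction with
  | base => simp
  | succ n hmn ih =>
    rw [← sum_Ioc_consecutive _ hmn n.le_succ, Nat.Ioc_succ_singleton, sum_singleton]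
    have hn : (0 : ℝ) < n := by exact_mod_cast lt_of_lt_of_le hm hmn
    set a := √(n : ℝ) with ha
    have ha0 : 0 < a := Real.sqrt_pos.2 hn
    have haa : a ^ 2 = n := Real.sq_sqrt hn.le
    push_cast
    set b := √((n : ℝ) + 1) with hb
    have hb0 : 0 < b := Real.sqrt_pos.2 (by linarith)
    have hbb : b ^ 2 = n + 1 := Real.sq_sqrt (by linarith)
    have hab : a ≤ b := Real.sqrt_le_sqrt (by linarith)
    have e : √(((n : ℝ) + 1) ^ 3) = b ^ 3 := by
      rw [← hbb, ← pow_mul, mul_comm 2 3, pow_mul, Real.sqrt_sq (by positivity)]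
    rw [e]
    have h : 1 / b ^ 3 ≤ 2 / a - 2 / b := by
      have h1 : 2 / a - 2 / b = 2 / (a * b * (a + b)) := by
        field_simp; nlinarith
      rw [h1, div_le_div_iff₀ (by positivity) (by positivity)]
      have h2 : a * b * (a + b) ≤ b * b * (b + b) := by gcongr
      nlinarith
    linarith

theorem sum_Y_tail_le {B : ℝ} {m : ℕ} (hm : 0 < m) :
    ∑ y ∈ (Y B).filter (fun y => m < y), 1 / √((y : ℝ) ^ 3) ≤ 2 / √m := by
  have h1 : ∑ y ∈ (Y B).filter (fun y => m < y), 1 / √((y : ℝ) ^ 3) ≤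
      ∑ y ∈ Ioc m (m + ⌊B⌋₊), 1 / √((y : ℝ) ^ 3) := by
    refine sum_le_sum_of_subset_of_nonneg ?_ (fun _ _ _ => by positivity)
    intro y hy
    obtain ⟨hy1, hy2⟩ := mem_filter.1 hy
    obtain ⟨_, h2, _⟩ := mem_Y.1 hy1
    rw [mem_Ioc]
    exact ⟨hy2, (Nat.le_floor h2).trans (Nat.le_add_left _ _)⟩
  refine h1.trans ((sum_Ioc_inv_sqrt_cube_le hm (Nat.le_add_right _ _)).trans ?_)
  have : (0 : ℝ) ≤ 2 / √((m + ⌊B⌋₊ : ℕ) : ℝ) := by positivity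
  linarith

theorem one_div_sqrt_coeff_le {d y : ℕ} (hd : 0 < d) (hy : 0 < y) :
    1 / √(coeff d y : ℝ) ≤ 1 / √((y : ℝ) ^ 3) := by
  have : (0 : ℝ) < (y : ℝ) ^ 3 := by positivity
  gcongr
  exact_mod_cast cube_le_coeff hd

theorem sum_tail_coeff_le {d : ℕ} (hd : 0 < d) {B : ℝ} {m : ℕ} (hm : 0 < m) :
    ∑ y ∈ (Y B).filter (fun y => m < y), √B / √(coeff d y) ≤ √B * (2 / √m) := by
  calc _ ≤ ∑ y ∈ (Y B).filter (fun y => m < y), √B * (1 / √((y : ℝ) ^ 3)) := by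
        refine sum_le_sum fun y hy => ?_
        rw [div_eq_mul_one_div]
        exact mul_le_mul_of_nonneg_left (one_div_sqrt_coeff_le hd (mem_Y.1 (mem_filter.1 hy).1).1)
          (Real.sqrt_nonneg _)
    _ ≤ _ := by rw [← mul_sum]; gcongr; exact sum_Y_tail_le hm

theorem sum_coeff_le {d : ℕ} (hd : 0 < d) (s : Finset ℕ) (hs : ∀ y ∈ s, 0 < y) :
    ∑ y ∈ s, 1 / √(coeff d y : ℝ) ≤ 3 := by
  calc _ ≤ ∑ y ∈ s, 1 / √((y : ℝ) ^ 3) :=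
        sum_le_sum fun y hy => one_div_sqrt_coeff_le hd (hs y hy)
    _ ≤ ∑ y ∈ insert 1 (Ioc 1 (1 + s.sup id)), 1 / √((y : ℝ) ^ 3) := by
        refine sum_le_sum_of_subset_of_nonneg ?_ (fun _ _ _ => by positivity)
        intro y hy
        have h1 := hs y hy
        have h2 : id y ≤ s.sup id := le_sup hy
        rw [mem_insert, mem_Ioc]
        simp only [id] at h2
        omega
    _ ≤ 1 + 2 := by
        rw [sum_insert (by simp)]
        have h := sum_Ioc_inv_sqrt_cube_le one_pos (Nat.le_add_right 1 (s.sup id))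
        have : (0 : ℝ) ≤ 2 / √((1 + s.sup id : ℕ) : ℝ) := by positivity
        have h1 : 1 / √(((1 : ℕ) : ℝ) ^ 3) = 1 := by simp
        have h2 : 2 / √((1 : ℕ) : ℝ) = 2 := by simp
        rw [h1]; rw [h2] at h
        linarith
    _ = 3 := by norm_num

theorem exists_card_P_le : ∃ C : ℝ, 1 ≤ C ∧ ∀ (d : ℕ) (B : ℝ), Squarefree d → 0 ≤ B →
    ((P d B).card : ℝ) ≤ C * (√B * (d : ℝ) ^ (-(1 / 4) : ℝ)) := by
  have hsum : Summable (fun n : ℕ => (n : ℝ) ^ (-(5 / 4) : ℝ)) :=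
    Real.summable_nat_rpow.2 (by norm_num)
  refine ⟨1 + ∑' n : ℕ, (n : ℝ) ^ (-(5 / 4) : ℝ), ?_, fun d B hd hB => ?_⟩
  · have : 0 ≤ ∑' n : ℕ, (n : ℝ) ^ (-(5 / 4) : ℝ) := tsum_nonneg fun n => by positivity
    linarith
  have hd0 : 0 < d := Nat.pos_of_ne_zero hd.ne_zero
  have hd' : (0 : ℝ) < d := by exact_mod_cast hd0
  refine (card_P_le_sum hd hB).trans ?_
  have key : ∀ y ∈ Y B, √B / √(coeff d y) ≤
      (√B * (d : ℝ) ^ (-(1 / 4) : ℝ)) * (y : ℝ) ^ (-(5 / 4) : ℝ) := by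
    intro y hy
    have hy0 : (0 : ℝ) < y := by exact_mod_cast (mem_Y.1 hy).1
    rw [mul_assoc, div_eq_mul_inv]
    gcongr
    set G := d.gcd y
    have hG0 : 0 < G := Nat.gcd_pos_of_pos_left _ hd0
    have hG : (0 : ℝ) < G := by exact_mod_cast hG0
    have hGd : (G : ℝ) ≤ d := by exact_mod_cast Nat.gcd_le_left y hd0
    have hGy : (G : ℝ) ≤ y := by exact_mod_cast Nat.gcd_le_right d (mem_Y.1 hy).1
    have hdiv : ((d / G : ℕ) : ℝ) = d / G := Nat.cast_div (Nat.gcd_dvd_left d y) hG.ne'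
    have hs : √(coeff d y : ℝ) = (y : ℝ) ^ (3 / 2 : ℝ) * (d / G) := by
      unfold coeff
      push_cast
      rw [hdiv, Real.sqrt_mul (by positivity), Real.sqrt_sq (by positivity),
        Real.sqrt_eq_rpow, ← Real.rpow_natCast, ← Real.rpow_mul hy0.le]
      norm_num
    have hg : (G : ℝ) ≤ (d : ℝ) ^ (3 / 4 : ℝ) * (y : ℝ) ^ (1 / 4 : ℝ) := by
      calc (G : ℝ) = (G : ℝ) ^ (3 / 4 : ℝ) * (G : ℝ) ^ (1 / 4 : ℝ) := by
            rw [← Real.rpow_add hG]; norm_num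
        _ ≤ _ := by gcongr
    rw [hs]
    calc ((y : ℝ) ^ (3 / 2 : ℝ) * (d / G))⁻¹ = G * ((d : ℝ)⁻¹ * (y : ℝ) ^ (-(3 / 2) : ℝ)) := by
          rw [Real.rpow_neg hy0.le]; field_simp
      _ ≤ ((d : ℝ) ^ (3 / 4 : ℝ) * (y : ℝ) ^ (1 / 4 : ℝ)) *
          ((d : ℝ)⁻¹ * (y : ℝ) ^ (-(3 / 2) : ℝ)) := by gcongr
      _ = ((d : ℝ) ^ (3 / 4 : ℝ) * (d : ℝ) ^ (-1 : ℝ)) *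
          ((y : ℝ) ^ (1 / 4 : ℝ) * (y : ℝ) ^ (-(3 / 2) : ℝ)) := by
          rw [Real.rpow_neg_one]; ring
      _ = _ := by
          rw [← Real.rpow_add hd', ← Real.rpow_add hy0]; norm_num
  refine (sum_le_sum key).trans ?_
  rw [← mul_sum, mul_comm]
  gcongr
  have := hsum.sum_le_tsum (Y B) (fun n _ => by positivity)
  linarith

/-! ### The fourth moment -/

theorem normSq_sum_ee {ι : Type*} (A : Finset ι) (φ : ι → ℤ) (x : ℝ) :
    ((‖∑ i ∈ A, ee ((φ i : ℝ) * x)‖ ^ 2 : ℝ) : ℂ) =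
      ∑ p ∈ A ×ˢ A, ee (((φ p.1 - φ p.2 : ℤ) : ℝ) * x) := by
  push_cast
  rw [← Complex.mul_conj', map_sum, sum_mul_sum, sum_product]
  refine sum_congr rfl fun i _ => sum_congr rfl fun j _ => ?_
  rw [conj_ee, ← ee_add]; congr 1; ring

theorem sum_ee_mul_sum_ee {ι κ : Type*} (A : Finset ι) (T : Finset κ) (φ : ι → ℤ) (ψ : κ → ℤ)
    (x : ℝ) : (∑ i ∈ A, ee ((φ i : ℝ) * x)) * ∑ j ∈ T, ee ((ψ j : ℝ) * x) =
      ∑ p ∈ A ×ˢ T, ee (((φ p.1 + ψ p.2 : ℤ) : ℝ) * x) := by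
  rw [sum_mul_sum, sum_product]
  refine sum_congr rfl fun i _ => sum_congr rfl fun j _ => ?_
  rw [← ee_add]; congr 1; push_cast; ring

/-- Solutions of `a - b + (c - e) = 0` in `S d B`. -/
noncomputable def quad (d : ℕ) (B : ℝ) : Finset ((ℤ × ℤ) × ℤ × ℤ) :=
  ((S d B ×ˢ S d B) ×ˢ (S d B ×ˢ S d B)).filter
    (fun p => p.1.1 - p.1.2 + (p.2.1 - p.2.2) = 0)

theorem integral_norm_f_pow_four (d : ℕ) (B a : ℝ) :
    ∫ x in a..(a + 1), ‖f d B x‖ ^ 4 = (quad d B).card := by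
  have h : ∫ x in a..(a + 1), ((‖f d B x‖ ^ 4 : ℝ) : ℂ) = ((quad d B).card : ℂ) := by
    rw [quad, ← integral_sum_ee]
    congr 1; ext x
    rw [← sum_ee_mul_sum_ee (S d B ×ˢ S d B) (S d B ×ˢ S d B) (fun p => p.1 - p.2)
      (fun p => p.1 - p.2), ← normSq_sum_ee (S d B) (fun i => i), ← Complex.ofReal_mul]
    congr 1
    unfold f
    ring
  rw [intervalIntegral.integral_ofReal] at h
  exact_mod_cast h

theorem card_factor_le {m : ℤ} (hm : m ≠ 0) {κ : Type*} (T : Finset κ) (u v w : κ → ℕ)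
    (hT : ∀ t ∈ T, (u t : ℤ) ^ 3 * (((w t : ℤ) + 1) ^ 2 - ((v t : ℤ) + 1) ^ 2) = m)
    (hinj : ∀ t ∈ T, ∀ t' ∈ T, u t = u t' → v t = v t' → w t = w t' → t = t') :
    T.card ≤ m.natAbs.divisors.card ^ 2 := by
  rw [pow_two, ← card_product]
  refine card_le_card_of_injOn (fun t => (u t, v t + w t + 2)) ?_ ?_
  · intro t ht
    have h := hT t ht
    simp only [coe_product, Set.mem_prod, mem_coe, Nat.mem_divisors]
    refine ⟨⟨?_, by omega⟩, ?_, by omega⟩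
    · rw [← Int.natCast_dvd]
      exact ⟨(u t : ℤ) ^ 2 * (((w t : ℤ) + 1) ^ 2 - ((v t : ℤ) + 1) ^ 2), by rw [← h]; ring⟩
    · rw [← Int.natCast_dvd]
      exact ⟨(u t : ℤ) ^ 3 * (w t - v t), by rw [← h]; push_cast; ring⟩
  · intro t ht t' ht' heq
    simp only [Prod.mk.injEq] at heq
    obtain ⟨h1, h2⟩ := heq
    have e1 := hT t ht
    have e2 := hT t' ht'
    rw [← e2, ← h1] at e1
    have hu : (u t : ℤ) ^ 3 ≠ 0 := by
      intro h0; rw [← h1, h0, zero_mul] at e2; exact hm e2.symm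
    have e3 := mul_left_cancel₀ hu e1
    have h2' : (v t : ℤ) + w t + 2 = v t' + w t' + 2 := by exact_mod_cast h2
    have e4 : ((w t : ℤ) - v t) * ((v t : ℤ) + w t + 2) =
        (w t' - v t') * ((v t : ℤ) + w t + 2) := by
      linear_combination e3 - ((w t' : ℤ) - v t') * h2'
    have e5 := mul_right_cancel₀ (by positivity : ((v t : ℤ) + w t + 2) ≠ 0) e4
    exact hinj t ht t' ht' h1 (by omega) (by omega)

/-- A sum over points `y ^ 3 * (x + 1) ^ 2` with `y` in a dyadic block. -/
theorem integral_norm_dyadic_pow_four_le (N : ℕ → ℕ) (j : ℕ) (s : Finset ℕ)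
    (hs : ∀ y ∈ s, Squarefree y) (hj : ∀ y ∈ s, 2 ^ j ≤ y ∧ y < 2 ^ (j + 1))
    {B τ : ℝ} (hN : ∀ y ∈ s, (N y : ℝ) ^ 2 ≤ B / (y : ℝ) ^ 3)
    (hτ : ∀ m : ℕ, 0 < m → (m : ℝ) ≤ B → (m.divisors.card : ℝ) ≤ τ) (a : ℝ) (hB : 0 ≤ B) :
    ∫ x in a..(a + 1), ‖∑ y ∈ s, ∑ z ∈ range (N y),
      ee (((y ^ 3 * (z + 1) ^ 2 : ℕ) : ℝ) * x)‖ ^ 4 ≤ B * (1 + τ ^ 2) := by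
  set φ : (Σ _ : ℕ, ℕ) → ℤ := fun p => ((p.1 ^ 3 * (p.2 + 1) ^ 2 : ℕ) : ℤ) with hφ
  set Pj : Finset (Σ _ : ℕ, ℕ) := s.sigma (fun y => range (N y)) with hPj
  set Tj : Finset (Σ _ : ℕ, ℕ × ℕ) := s.sigma (fun y => range (N y) ×ˢ range (N y)) with hTj
  set ψ : (Σ _ : ℕ, ℕ × ℕ) → ℤ := fun t =>
    ((t.1 ^ 3 * (t.2.1 + 1) ^ 2 : ℕ) : ℤ) - ((t.1 ^ 3 * (t.2.2 + 1) ^ 2 : ℕ) : ℤ) with hψ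
  set gj : ℝ → ℂ := fun x => ∑ y ∈ s, ∑ z ∈ range (N y),
    ee (((y ^ 3 * (z + 1) ^ 2 : ℕ) : ℝ) * x) with hgj
  set gy : ℕ → ℝ → ℂ := fun y x => ∑ z ∈ range (N y),
    ee (((y ^ 3 * (z + 1) ^ 2 : ℕ) : ℝ) * x) with hgy
  have hgyc : ∀ y, Continuous (gy y) := fun y =>
    continuous_finsetSum _ fun z _ => continuous_ee.comp (by fun_prop)
  have hgjc : Continuous gj := continuous_finsetSum _ fun y _ => hgyc y
  have hcards : s.card ≤ 2 ^ j := by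
    have : s ⊆ Ico (2 ^ j) (2 ^ (j + 1)) := fun y hy => mem_Ico.2 (hj y hy)
    refine (card_le_card this).trans ?_
    rw [Nat.card_Ico, pow_succ]; omega
  have hcards' : (s.card : ℝ) ≤ 2 ^ j := by exact_mod_cast hcards
  have hpt : ∀ x, ‖gj x‖ ^ 4 ≤ 2 ^ j * (‖gj x‖ ^ 2 * ∑ y ∈ s, ‖gy y x‖ ^ 2) := by
    intro x
    have h1 : ‖gj x‖ ^ 2 ≤ 2 ^ j * ∑ y ∈ s, ‖gy y x‖ ^ 2 := by
      calc ‖gj x‖ ^ 2 ≤ (∑ y ∈ s, ‖gy y x‖) ^ 2 := by gcongr; exact norm_sum_le _ _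
        _ ≤ s.card * ∑ y ∈ s, ‖gy y x‖ ^ 2 := sq_sum_le_card_mul_sum_sq
        _ ≤ _ := by gcongr
    calc ‖gj x‖ ^ 4 = ‖gj x‖ ^ 2 * ‖gj x‖ ^ 2 := by ring
      _ ≤ ‖gj x‖ ^ 2 * (2 ^ j * ∑ y ∈ s, ‖gy y x‖ ^ 2) := by gcongr
      _ = _ := by ring
  set Q := ((Pj ×ˢ Pj) ×ˢ Tj).filter (fun p => φ p.1.1 - φ p.1.2 + ψ p.2 = 0) with hQ
  have hint : ∫ x in a..(a + 1), ‖gj x‖ ^ 2 * ∑ y ∈ s, ‖gy y x‖ ^ 2 = Q.card := by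
    have h : ∫ x in a..(a + 1), ((‖gj x‖ ^ 2 * ∑ y ∈ s, ‖gy y x‖ ^ 2 : ℝ) : ℂ) =
        (Q.card : ℂ) := by
      rw [hQ, ← integral_sum_ee]
      congr 1; ext x
      rw [← sum_ee_mul_sum_ee (Pj ×ˢ Pj) Tj (fun p => φ p.1 - φ p.2) ψ,
        ← normSq_sum_ee Pj φ, Complex.ofReal_mul]
      congr 1
      · simp only [hgj, hPj, hφ, sum_sigma]
        norm_cast
      · rw [Complex.ofReal_sum, hTj, sum_sigma]
        refine sum_congr rfl fun y _ => ?_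
        have := normSq_sum_ee (range (N y)) (fun z => ((y ^ 3 * (z + 1) ^ 2 : ℕ) : ℤ)) x
        simp only [Int.cast_natCast] at this
        rw [hgy, this]
    rw [intervalIntegral.integral_ofReal] at h
    exact_mod_cast h
  have hstep : ∫ x in a..(a + 1), ‖gj x‖ ^ 4 ≤ 2 ^ j * (Q.card : ℝ) := by
    rw [← hint, ← intervalIntegral.integral_const_mul]
    refine intervalIntegral.integral_mono_on (by linarith) ?_ ?_ (fun x _ => hpt x)
    · exact (hgjc.norm.pow 4).intervalIntegrable _ _
    · refine Continuous.intervalIntegrable ?_ _ _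
      exact continuous_const.mul ((hgjc.norm.pow 2).mul
        (continuous_finsetSum _ fun y _ => ((hgyc y).norm.pow 2)))
  have hpos : ∀ y ∈ s, (0 : ℝ) < y := fun y hy => by
    exact_mod_cast Nat.pos_of_ne_zero (hs y hy).ne_zero
  have hφB : ∀ p ∈ Pj, 0 ≤ φ p ∧ (φ p : ℝ) ≤ B := by
    rintro ⟨y, z⟩ hp
    simp only [hPj, mem_sigma, mem_range] at hp
    refine ⟨by positivity, ?_⟩
    have h1 : ((z : ℝ) + 1) ≤ N y := by exact_mod_cast hp.2
    have h2 : ((z : ℝ) + 1) ^ 2 ≤ B / (y : ℝ) ^ 3 := le_trans (by gcongr) (hN y hp.1)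
    rw [le_div_iff₀ (pow_pos (hpos y hp.1) 3)] at h2
    simp only [hφ]; push_cast; linarith
  have hφinj : ∀ p ∈ Pj, ∀ p' ∈ Pj, φ p = φ p' → p = p' := by
    rintro ⟨y, z⟩ hp ⟨y', z'⟩ hp' h
    simp only [hPj, mem_sigma] at hp hp'
    simp only [hφ] at h
    obtain ⟨rfl, h2⟩ := cube_mul_sq_inj (hs y hp.1) (hs y' hp'.1) z.succ_pos z'.succ_pos
      (by exact_mod_cast h)
    obtain rfl : z = z' := by omega
    rfl
  have hτ0 : 0 ≤ τ ^ 2 := sq_nonneg _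
  have hQcard : (Q.card : ℝ) ≤ (Pj.card : ℝ) ^ 2 * (1 + τ ^ 2) := by
    have e1 : (Q.card : ℝ) = ∑ p ∈ Pj ×ˢ Pj,
        ((Tj.filter (fun t => φ p.1 - φ p.2 + ψ t = 0)).card : ℝ) := by
      rw [hQ, card_filter, sum_product]
      push_cast
      refine sum_congr rfl fun p _ => ?_
      rw [card_filter]; push_cast; rfl
    have e2 : ∀ p ∈ Pj ×ˢ Pj, ((Tj.filter (fun t => φ p.1 - φ p.2 + ψ t = 0)).card : ℝ) ≤
        (if p.1 = p.2 then (Pj.card : ℝ) else 0) + τ ^ 2 := by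
      intro p hp
      obtain ⟨hp1, hp2⟩ := mem_product.1 hp
      split_ifs with heq
      · have : (Tj.filter (fun t => φ p.1 - φ p.2 + ψ t = 0)).card ≤ Pj.card := by
          refine card_le_card_of_injOn (fun t => ⟨t.1, t.2.1⟩) ?_ ?_
          · rintro ⟨y, z, z'⟩ ht
            have := (mem_filter.1 (mem_coe.1 ht)).1
            simp only [hTj, mem_sigma, mem_product] at this
            simp only [hPj, mem_coe, mem_sigma]
            exact ⟨this.1, this.2.1⟩
          · have hzz : ∀ t ∈ Tj.filter (fun t => φ p.1 - φ p.2 + ψ t = 0), t.2.1 = t.2.2 := by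
              intro t ht
              obtain ⟨ht1, ht2⟩ := mem_filter.1 ht
              rw [heq, sub_self, zero_add] at ht2
              simp only [hψ] at ht2
              have h3 : t.1 ^ 3 * (t.2.1 + 1) ^ 2 = t.1 ^ 3 * (t.2.2 + 1) ^ 2 := by
                have := sub_eq_zero.1 ht2; exact_mod_cast this
              have hsq := hs t.1 (mem_sigma.1 ht1).1
              have := (cube_mul_sq_inj hsq hsq t.2.1.succ_pos t.2.2.succ_pos h3).2
              omega
            rintro ⟨y, z, z'⟩ ht ⟨y', w, w'⟩ ht' h
            have h1 := hzz _ ht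
            have h2 := hzz _ ht'
            simp only [Sigma.mk.injEq, heq_eq_eq] at h h1 h2
            obtain ⟨rfl, rfl⟩ := h
            rw [← h1, ← h2]
        have : ((Tj.filter (fun t => φ p.1 - φ p.2 + ψ t = 0)).card : ℝ) ≤ Pj.card := by
          exact_mod_cast this
        linarith
      · rw [zero_add]
        have hm : φ p.1 - φ p.2 ≠ 0 := fun h0 => heq (hφinj _ hp1 _ hp2 (sub_eq_zero.1 h0))
        have h1 := card_factor_le hm (Tj.filter (fun t => φ p.1 - φ p.2 + ψ t = 0))
          (fun t => t.1) (fun t => t.2.1) (fun t => t.2.2) ?_ ?_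
        · have h2 := hτ (φ p.1 - φ p.2).natAbs (Int.natAbs_pos.2 hm) ?_
          · calc ((Tj.filter (fun t => φ p.1 - φ p.2 + ψ t = 0)).card : ℝ) ≤
                ((φ p.1 - φ p.2).natAbs.divisors.card : ℝ) ^ 2 := by exact_mod_cast h1
              _ ≤ τ ^ 2 := by gcongr
          · rw [Nat.cast_natAbs, Int.cast_abs, Int.cast_sub, abs_le]
            have a1 := hφB _ hp1
            have a2 := hφB _ hp2
            have b1 : (0 : ℝ) ≤ φ p.1 := by exact_mod_cast a1.1
            have b2 : (0 : ℝ) ≤ φ p.2 := by exact_mod_cast a2.1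
            constructor <;> linarith [a1.2, a2.2]
        · intro t ht
          have := (mem_filter.1 ht).2
          simp only [hψ] at this
          push_cast at this
          linear_combination -this
        · rintro ⟨y, z, z'⟩ _ ⟨y', w, w'⟩ _ rfl rfl rfl
          rfl
    rw [e1]
    refine (sum_le_sum e2).trans ?_
    rw [sum_add_distrib, sum_const, card_product, nsmul_eq_mul, sum_product]
    have e3 : ∀ p ∈ Pj, ∑ p' ∈ Pj, (if p = p' then (Pj.card : ℝ) else 0) = Pj.card := by
      intro p hp; rw [sum_ite_eq, if_pos hp]
    simp only at e3 ⊢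
    rw [sum_congr rfl e3, sum_const, nsmul_eq_mul]
    push_cast
    apply le_of_eq; ring
  have hPcard : (2 : ℝ) ^ j * (Pj.card : ℝ) ^ 2 ≤ B := by
    have e1 : (Pj.card : ℝ) = ∑ y ∈ s, (N y : ℝ) := by
      rw [hPj, card_sigma]; push_cast; simp
    have e2 : (Pj.card : ℝ) ^ 2 ≤ s.card * ∑ y ∈ s, (N y : ℝ) ^ 2 := by
      rw [e1]; exact sq_sum_le_card_mul_sum_sq
    have e3 : ∑ y ∈ s, (N y : ℝ) ^ 2 ≤ s.card * (B / ((2 : ℝ) ^ j) ^ 3) := by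
      rw [← nsmul_eq_mul]
      refine sum_le_card_nsmul _ _ _ fun y hy => (hN y hy).trans ?_
      gcongr
      exact_mod_cast (hj y hy).1
    calc (2 : ℝ) ^ j * (Pj.card : ℝ) ^ 2 ≤
        (2 : ℝ) ^ j * ((2 : ℝ) ^ j * ((2 : ℝ) ^ j * (B / ((2 : ℝ) ^ j) ^ 3))) := by
          gcongr
          refine e2.trans ?_
          gcongr
          refine e3.trans ?_
          gcongr
      _ = B := by field_simp
  refine hstep.trans ?_
  calc (2 : ℝ) ^ j * (Q.card : ℝ) ≤ (2 : ℝ) ^ j * ((Pj.card : ℝ) ^ 2 * (1 + τ ^ 2)) := by gcongr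
    _ = (2 : ℝ) ^ j * (Pj.card : ℝ) ^ 2 * (1 + τ ^ 2) := by ring
    _ ≤ _ := by gcongr

theorem norm_sum_pow_four_le {ι : Type*} (s : Finset ι) (h : ι → ℂ) :
    ‖∑ i ∈ s, h i‖ ^ 4 ≤ (s.card : ℝ) ^ 3 * ∑ i ∈ s, ‖h i‖ ^ 4 := by
  have h1 : (∑ i ∈ s, ‖h i‖) ^ 2 ≤ s.card * ∑ i ∈ s, ‖h i‖ ^ 2 := sq_sum_le_card_mul_sum_sq
  have h2 : (∑ i ∈ s, ‖h i‖ ^ 2) ^ 2 ≤ s.card * ∑ i ∈ s, (‖h i‖ ^ 2) ^ 2 :=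
    sq_sum_le_card_mul_sum_sq
  calc ‖∑ i ∈ s, h i‖ ^ 4 ≤ (∑ i ∈ s, ‖h i‖) ^ 4 := by gcongr; exact norm_sum_le _ _
    _ = ((∑ i ∈ s, ‖h i‖) ^ 2) ^ 2 := by ring
    _ ≤ (s.card * ∑ i ∈ s, ‖h i‖ ^ 2) ^ 2 := by gcongr
    _ = (s.card : ℝ) ^ 2 * (∑ i ∈ s, ‖h i‖ ^ 2) ^ 2 := by ring
    _ ≤ (s.card : ℝ) ^ 2 * (s.card * ∑ i ∈ s, (‖h i‖ ^ 2) ^ 2) := by gcongr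
    _ = _ := by simp_rw [← pow_mul]; ring

theorem integral_norm_g_pow_four_le {B τ : ℝ} (hB : 1 ≤ B) (hτ1 : 1 ≤ τ)
    (hτ : ∀ m : ℕ, 0 < m → (m : ℝ) ≤ B → (m.divisors.card : ℝ) ≤ τ) (a : ℝ) :
    ∫ x in a..(a + 1), ‖g 1 B x‖ ^ 4 ≤ 2 * (B * τ ^ 6) := by
  have hB0 : 0 ≤ B := by linarith
  set N : ℕ → ℕ := fun y => ⌊√(B / coeff 1 y)⌋₊ with hN
  set J := Nat.log 2 ⌊B⌋₊ + 1 with hJ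
  set s : ℕ → Finset ℕ := fun j => (Y B).filter (fun y => Nat.log 2 y = j) with hs
  set h : ℕ → ℝ → ℂ := fun j x => ∑ y ∈ s j, ∑ z ∈ range (N y),
      ee (((y ^ 3 * (z + 1) ^ 2 : ℕ) : ℝ) * x) with hh
  have hhc : ∀ j, Continuous (h j) := fun j => continuous_finsetSum _ fun y _ =>
    continuous_finsetSum _ fun z _ => continuous_ee.comp (by fun_prop)
  have hg : ∀ x, g 1 B x = ∑ j ∈ range J, h j x := by
    intro x
    unfold g
    rw [sum_P squarefree_one hB0 (fun a : ℕ => ee ((a : ℝ) * x))]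
    have hmaps : ∀ y ∈ Y B, Nat.log 2 y ∈ range J := by
      intro y hy
      rw [mem_range, hJ, Nat.lt_succ_iff]
      exact Nat.log_mono_right (Nat.le_floor (mem_Y.1 hy).2.1)
    rw [← sum_fiberwise_of_maps_to hmaps]
    simp only [hh, hs, hN, coeff_one]
  have hfl : 1 ≤ ⌊B⌋₊ := Nat.le_floor (by simpa using hB)
  have hJτ : (J : ℝ) ≤ τ := by
    have h1 := hτ (2 ^ Nat.log 2 ⌊B⌋₊) (by positivity) (by
      have : 2 ^ Nat.log 2 ⌊B⌋₊ ≤ ⌊B⌋₊ := Nat.pow_log_le_self 2 (by omega)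
      calc ((2 ^ Nat.log 2 ⌊B⌋₊ : ℕ) : ℝ) ≤ ⌊B⌋₊ := by exact_mod_cast this
        _ ≤ B := Nat.floor_le hB0)
    rw [Nat.divisors_prime_pow Nat.prime_two, card_map, card_range] at h1
    exact h1
  have hblock : ∀ j, ∫ x in a..(a + 1), ‖h j x‖ ^ 4 ≤ B * (1 + τ ^ 2) := by
    intro j
    refine integral_norm_dyadic_pow_four_le N j (s j) ?_ ?_ ?_ hτ a hB0
    · intro y hy; exact (mem_Y.1 (mem_filter.1 hy).1).2.2
    · intro y hy
      obtain ⟨h1, h2⟩ := mem_filter.1 hy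
      have hy0 := (mem_Y.1 h1).1
      rw [← h2]
      exact ⟨Nat.pow_log_le_self 2 hy0.ne', Nat.lt_pow_succ_log_self (by norm_num) y⟩
    · intro y hy
      simp only [hN, coeff_one]
      calc (⌊√(B / ((y ^ 3 : ℕ) : ℝ))⌋₊ : ℝ) ^ 2 ≤ √(B / ((y ^ 3 : ℕ) : ℝ)) ^ 2 := by
            gcongr; exact Nat.floor_le (Real.sqrt_nonneg _)
        _ = B / (y : ℝ) ^ 3 := by rw [Real.sq_sqrt (by positivity)]; push_cast; rfl
  calc ∫ x in a..(a + 1), ‖g 1 B x‖ ^ 4 ≤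
      ∫ x in a..(a + 1), (J : ℝ) ^ 3 * ∑ j ∈ range J, ‖h j x‖ ^ 4 := by
        refine intervalIntegral.integral_mono_on (by linarith) ?_ ?_ ?_
        · exact ((continuous_g 1 B).norm.pow 4).intervalIntegrable _ _
        · exact (continuous_const.mul (continuous_finsetSum _ fun j _ =>
            ((hhc j).norm.pow 4))).intervalIntegrable _ _
        · intro x _
          rw [hg]
          simpa using norm_sum_pow_four_le (range J) (fun j => h j x)
    _ = (J : ℝ) ^ 3 * ∑ j ∈ range J, ∫ x in a..(a + 1), ‖h j x‖ ^ 4 := by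
        rw [intervalIntegral.integral_const_mul, intervalIntegral.integral_finsetSum]
        exact fun j _ => ((hhc j).norm.pow 4).intervalIntegrable _ _
    _ ≤ (J : ℝ) ^ 3 * ∑ j ∈ range J, B * (1 + τ ^ 2) := by
        gcongr with j hj; exact hblock j
    _ = (J : ℝ) ^ 4 * (B * (1 + τ ^ 2)) := by
        rw [sum_const, card_range, nsmul_eq_mul]; ring
    _ ≤ τ ^ 4 * (B * (τ ^ 2 + τ ^ 2)) := by
        gcongr
        exact one_le_pow₀ hτ1
    _ = _ := by ring

theorem quad_card_one_le {B τ : ℝ} (hB : 1 ≤ B) (hτ1 : 1 ≤ τ)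
    (hτ : ∀ m : ℕ, 0 < m → (m : ℝ) ≤ B → (m.divisors.card : ℝ) ≤ τ) :
    ((quad 1 B).card : ℝ) ≤ 264 * (B * τ ^ 6) := by
  rw [← integral_norm_f_pow_four 1 B 0]
  calc ∫ x in (0 : ℝ)..(0 + 1), ‖f 1 B x‖ ^ 4 ≤
      ∫ x in (0 : ℝ)..(0 + 1), (8 + 128 * ‖g 1 B x‖ ^ 4) := by
        refine intervalIntegral.integral_mono_on (by linarith) ?_ ?_ ?_
        · exact ((continuous_f 1 B).norm.pow 4).intervalIntegrable _ _
        · exact (continuous_const.add (continuous_const.mul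
            ((continuous_g 1 B).norm.pow 4))).intervalIntegrable _ _
        · intro x _
          have h1 := norm_f_le 1 B x
          set t := ‖g 1 B x‖
          have ht : 0 ≤ t := norm_nonneg _
          calc ‖f 1 B x‖ ^ 4 ≤ (1 + 2 * t) ^ 4 := by gcongr
            _ ≤ 8 + 128 * t ^ 4 := by
              nlinarith [sq_nonneg (1 - 2 * t), sq_nonneg (1 - 4 * t ^ 2), sq_nonneg (1 + 2 * t),
                mul_nonneg (sq_nonneg (1 - 2 * t)) (sq_nonneg (1 + 2 * t)),
                sq_nonneg (2 * t - 4 * t ^ 2), mul_nonneg ht (sq_nonneg (1 - 2 * t))]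
    _ = 8 + 128 * ∫ x in (0 : ℝ)..(0 + 1), ‖g 1 B x‖ ^ 4 := by
        rw [intervalIntegral.integral_add, intervalIntegral.integral_const_mul]
        · simp
        · exact intervalIntegrable_const
        · exact (continuous_const.mul ((continuous_g 1 B).norm.pow 4)).intervalIntegrable _ _
    _ ≤ 8 + 128 * (2 * (B * τ ^ 6)) := by
        gcongr; exact integral_norm_g_pow_four_le hB hτ1 hτ 0
    _ ≤ _ := by
        have : 1 * 1 ≤ B * τ ^ 6 := mul_le_mul hB (one_le_pow₀ hτ1) (by norm_num) (by linarith)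
        linarith

theorem S_subset (d : ℕ) (B : ℝ) (hB : 0 ≤ B) : S d B ⊆ S 1 B := by
  intro a ha
  rw [mem_S hB] at ha ⊢
  exact ⟨ha.1, ha.2.1, by simp⟩

theorem quad_subset (d : ℕ) (B : ℝ) (hB : 0 ≤ B) : quad d B ⊆ quad 1 B := by
  refine filter_subset_filter _ ?_
  have := S_subset d B hB
  exact product_subset_product (product_subset_product this this)
    (product_subset_product this this)

theorem integral_norm_f_pow_four_le {B τ : ℝ} (hB : 1 ≤ B) (hτ1 : 1 ≤ τ)
    (hτ : ∀ m : ℕ, 0 < m → (m : ℝ) ≤ B → (m.divisors.card : ℝ) ≤ τ) (d : ℕ) (a : ℝ) :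
    ∫ x in a..(a + 1), ‖f d B x‖ ^ 4 ≤ 264 * (B * τ ^ 6) := by
  rw [integral_norm_f_pow_four]
  refine le_trans ?_ (quad_card_one_le hB hτ1 hτ)
  exact_mod_cast card_le_card (quad_subset d B (by linarith))

theorem sum_quad_card_le {B τ : ℝ} (hB : 1 ≤ B) (hτ1 : 1 ≤ τ)
    (hτ : ∀ m : ℕ, 0 < m → (m : ℝ) ≤ B → (m.divisors.card : ℝ) ≤ τ) :
    ∑ d ∈ Icc 1 ⌊√B⌋₊, ((quad d B).card : ℝ) ≤ 265 * (B * τ ^ 7) := by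
  have hB0 : 0 ≤ B := by linarith
  have hcount : ∀ d, ((quad d B).card : ℝ) =
      ∑ p ∈ quad 1 B, if p ∈ quad d B then (1 : ℝ) else 0 := by
    intro d
    rw [sum_boole]
    congr 2
    ext p
    rw [mem_filter]
    exact ⟨fun h => ⟨quad_subset d B hB0 h, h⟩, fun h => h.2⟩
  simp_rw [hcount]
  rw [sum_comm]
  have key : ∀ p ∈ quad 1 B, ∑ d ∈ Icc 1 ⌊√B⌋₊, (if p ∈ quad d B then (1 : ℝ) else 0) ≤
      (if p = 0 then B else 0) + τ := by
    intro p hp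
    rw [sum_boole]
    have hmem : ∀ d, p ∈ quad d B → ((d : ℤ) ∣ p.1.1 ∧ (d : ℤ) ∣ p.1.2) ∧
        ((d : ℤ) ∣ p.2.1 ∧ (d : ℤ) ∣ p.2.2) := by
      intro d h
      have := (mem_filter.1 h).1
      simp only [mem_product, mem_S hB0] at this
      exact ⟨⟨this.1.1.2.2, this.1.2.2.2⟩, this.2.1.2.2, this.2.2.2.2⟩
    split_ifs with h0
    · have : (((Icc 1 ⌊√B⌋₊).filter (fun d => p ∈ quad d B)).card : ℝ) ≤ ⌊√B⌋₊ := by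
        exact_mod_cast (card_filter_le _ _).trans (by simp)
      have h2 : (⌊√B⌋₊ : ℝ) ≤ √B := Nat.floor_le (Real.sqrt_nonneg _)
      have h3 : √B ≤ B := Real.sqrt_le_iff.2 ⟨hB0, by nlinarith⟩
      linarith
    · rw [zero_add]
      have hval : ∀ b : ℤ, b ∈ S 1 B → b ≠ 0 → (∀ d, p ∈ quad d B → (d : ℤ) ∣ b) →
          (((Icc 1 ⌊√B⌋₊).filter (fun d => p ∈ quad d B)).card : ℝ) ≤ τ := by
        intro b hb hb0 hd
        have h1 := ((mem_S hB0).1 hb).1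
        refine le_trans ?_ (hτ b.natAbs (Int.natAbs_pos.2 hb0) ?_)
        · have : (Icc 1 ⌊√B⌋₊).filter (fun d => p ∈ quad d B) ⊆ b.natAbs.divisors := by
            intro d hdd
            rw [Nat.mem_divisors]
            exact ⟨Int.natCast_dvd.1 (hd d (mem_filter.1 hdd).2), Int.natAbs_ne_zero.2 hb0⟩
          exact_mod_cast card_le_card this
        · rw [Nat.cast_natAbs, Int.cast_abs]; exact h1
      have hpS := (mem_filter.1 hp).1
      simp only [mem_product] at hpS
      by_contra hcon
      apply h0
      refine Prod.ext (Prod.ext ?_ ?_) (Prod.ext ?_ ?_)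
      · by_contra h; exact hcon (hval _ hpS.1.1 h fun d hd => (hmem d hd).1.1)
      · by_contra h; exact hcon (hval _ hpS.1.2 h fun d hd => (hmem d hd).1.2)
      · by_contra h; exact hcon (hval _ hpS.2.1 h fun d hd => (hmem d hd).2.1)
      · by_contra h; exact hcon (hval _ hpS.2.2 h fun d hd => (hmem d hd).2.2)
  refine (sum_le_sum key).trans ?_
  rw [sum_add_distrib, sum_const, nsmul_eq_mul]
  have e1 : ∑ p ∈ quad 1 B, (if p = 0 then B else 0) ≤ B := by
    rw [sum_ite_eq']
    split_ifs
    · exact le_rfl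
    · exact hB0
  have e2 : ((quad 1 B).card : ℝ) * τ ≤ 264 * (B * τ ^ 6) * τ := by
    gcongr; exact quad_card_one_le hB hτ1 hτ
  have e3 : B * 1 ≤ B * τ ^ 7 := by gcongr; exact one_le_pow₀ hτ1
  nlinarith

/-! ### Counting tuples by orthogonality -/

/-- Tuples in `S d B` with sum zero. -/
noncomputable def tuples (k d : ℕ) (B : ℝ) : Finset (Fin k → ℤ) :=
  (Fintype.piFinset (fun _ : Fin k => S d B)).filter (fun a => ∑ i, a i = 0)

theorem integral_f_pow (k d : ℕ) (B a : ℝ) :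
    ∫ x in a..(a + 1), f d B x ^ k = ((tuples k d B).card : ℂ) := by
  rw [tuples, ← integral_sum_ee]
  congr 1; ext x
  have h := Finset.prod_univ_sum (fun _ : Fin k => S d B) (fun _ a => ee ((a : ℝ) * x))
  rw [prod_const, card_univ, Fintype.card_fin] at h
  unfold f
  rw [h]
  refine sum_congr rfl fun p _ => ?_
  rw [← ee_sum, ← sum_mul]
  push_cast; rfl

theorem norm_g_le {d : ℕ} (hd : Squarefree d) {B : ℝ} (hB : 0 ≤ B) (α : ℝ) :
    ‖g d B α‖ ≤ 3 * √B := by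
  rw [g_eq hd hB]
  have hd0 : 0 < d := Nat.pos_of_ne_zero hd.ne_zero
  calc _ ≤ ∑ y ∈ Y B, √B * (1 / √(coeff d y : ℝ)) := by
        refine (norm_sum_le _ _).trans (sum_le_sum fun y _ => ?_)
        rw [mul_one_div]; exact norm_W_le _ _ _
    _ ≤ √B * 3 := by
        rw [← mul_sum]; gcongr
        exact sum_coeff_le hd0 _ fun y hy => (mem_Y.1 hy).1
    _ = _ := mul_comm _ _

theorem norm_f_le_sqrt {d : ℕ} (hd : Squarefree d) {B : ℝ} (hB : 1 ≤ B) (α : ℝ) :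
    ‖f d B α‖ ≤ 7 * √B := by
  have h1 := norm_f_le d B α
  have h2 := norm_g_le hd (by linarith : 0 ≤ B) α
  have h3 : 1 ≤ √B := Real.one_le_sqrt.2 hB
  linarith

theorem sqrt_nat_sq (Z : ℕ) : √((Z ^ 2 : ℕ) : ℝ) = Z := by
  push_cast; exact Real.sqrt_sq (Nat.cast_nonneg Z)

theorem norm_sum_W_tail_le {d : ℕ} (hd : 0 < d) (B α : ℝ) {Z : ℕ} (hZ : 0 < Z) :
    ‖∑ y ∈ (Y B).filter (fun y => Z ^ 2 < y), W (coeff d y) α B‖ ≤ √B * (2 / Z) := by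
  calc _ ≤ ∑ y ∈ (Y B).filter (fun y => Z ^ 2 < y), √B / √(coeff d y) :=
        (norm_sum_le _ _).trans (sum_le_sum fun y _ => norm_W_le _ _ _)
    _ ≤ √B * (2 / √((Z ^ 2 : ℕ) : ℝ)) := sum_tail_coeff_le hd (by positivity)
    _ = _ := by rw [sqrt_nat_sq]

theorem card_Y_filter_le (B : ℝ) (m : ℕ) : ((Y B).filter (fun y => ¬ m < y)).card ≤ m := by
  have : (Y B).filter (fun y => ¬ m < y) ⊆ Icc 1 m := by
    intro y hy
    obtain ⟨h1, h2⟩ := mem_filter.1 hy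
    rw [mem_Icc]
    exact ⟨(mem_Y.1 h1).1, not_lt.1 h2⟩
  simpa using card_le_card this

theorem norm_g_minor_le {d : ℕ} (hd : Squarefree d) {α B T : ℝ} (hT : 1 ≤ T) (hB : T ^ 8 ≤ B)
    {Z : ℕ} (hZ : 0 < Z)
    {r : ℤ} {q : ℕ} (hq : T ^ 4 ≤ q) (hqB : (q : ℝ) ≤ B / T ^ 4)
    (hrq : IsCoprime r (q : ℤ)) (hα : |α - r / q| ≤ 1 / (q : ℝ) ^ 2) :
    ‖g d B α‖ ≤ √B * (7 * Z ^ 2 / T + 2 / Z) := by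
  have hB0 : 0 ≤ B := le_trans (by positivity) hB
  have hd0 : 0 < d := Nat.pos_of_ne_zero hd.ne_zero
  rw [g_eq hd hB0, ← sum_filter_add_sum_filter_not (Y B) (fun y => Z ^ 2 < y)]
  refine (norm_add_le _ _).trans ?_
  have h1 := norm_sum_W_tail_le hd0 B α hZ
  have h2 : ‖∑ y ∈ (Y B).filter (fun y => ¬ Z ^ 2 < y), W (coeff d y) α B‖ ≤
      (Z : ℝ) ^ 2 * (7 * (√B / T)) := by
    calc _ ≤ ∑ y ∈ (Y B).filter (fun y => ¬ Z ^ 2 < y), 7 * (√B / T) := by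
          refine (norm_sum_le _ _).trans (sum_le_sum fun y hy => ?_)
          exact norm_W_minor_le (coeff_pos hd0 (mem_Y.1 (mem_filter.1 hy).1).1) hT hB hq hqB hrq hα
      _ = ((Y B).filter (fun y => ¬ Z ^ 2 < y)).card * (7 * (√B / T)) := by
          rw [sum_const, nsmul_eq_mul]
      _ ≤ _ := by
          gcongr
          exact_mod_cast card_Y_filter_le B (Z ^ 2)
  calc _ ≤ √B * (2 / Z) + (Z : ℝ) ^ 2 * (7 * (√B / T)) := add_le_add h1 h2
    _ = _ := by ring

/-- A truncated singular sum. -/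
noncomputable def sing (d V q : ℕ) (r : ℤ) : ℂ :=
  ∑ y ∈ Y ((V : ℝ) ^ 2), G q r (coeff d y) / q * ((1 / √(coeff d y : ℝ) : ℝ) : ℂ)

theorem norm_sing_le {d : ℕ} (hd : 0 < d) (V : ℕ) {q : ℕ} (hq : 0 < q) (r : ℤ) :
    ‖sing d V q r‖ ≤ 3 := by
  have hq' : (0 : ℝ) < q := by exact_mod_cast hq
  refine le_trans ((norm_sum_le _ _).trans (sum_le_sum fun y _ => ?_))
    (sum_coeff_le hd (Y ((V : ℝ) ^ 2)) fun y hy => (mem_Y.1 hy).1)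
  rw [norm_mul, norm_div, Complex.norm_natCast, Complex.norm_real, Real.norm_of_nonneg (by positivity)]
  refine mul_le_of_le_one_left (by positivity) ?_
  rw [div_le_one hq']; exact norm_G_le q r _

theorem Y_filter_eq {B : ℝ} {V : ℕ} (hV : (V : ℝ) ^ 2 ≤ B) :
    (Y B).filter (fun y => ¬ V ^ 2 < y) = Y ((V : ℝ) ^ 2) := by
  ext y
  rw [mem_filter, mem_Y, mem_Y, not_lt]
  have : y ≤ V ^ 2 ↔ (y : ℝ) ≤ (V : ℝ) ^ 2 := by exact_mod_cast Iff.rfl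
  rw [this]
  constructor
  · rintro ⟨⟨h1, h2, h3⟩, h4⟩; exact ⟨h1, h4, h3⟩
  · rintro ⟨h1, h2, h3⟩; exact ⟨⟨h1, h2.trans hV, h3⟩, h2⟩

theorem norm_g_major_sub_le {d : ℕ} (hd : Squarefree d) {B : ℝ} {V : ℕ} (hV0 : 0 < V)
    (hV : (V : ℝ) ^ 2 ≤ B) {q : ℕ} (hq : 0 < q) (r : ℤ) (β : ℝ) :
    ‖g d B (r / q + β) - √B * (sing d V q r * osc (β * B))‖ ≤
      V ^ 2 * (13 * q * (1 + |β| * B)) + √B * (2 / V) := by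
  have hB0 : 0 ≤ B := le_trans (by positivity) hV
  have hd0 : 0 < d := Nat.pos_of_ne_zero hd.ne_zero
  rw [g_eq hd hB0, ← sum_filter_add_sum_filter_not (Y B) (fun y => V ^ 2 < y), Y_filter_eq hV]
  have e1 : (√B : ℂ) * (sing d V q r * osc (β * B)) =
      ∑ y ∈ Y ((V : ℝ) ^ 2), G q r (coeff d y) / q *
        ((√B / √(coeff d y : ℝ) : ℝ) * osc (β * B)) := by
    unfold sing
    rw [sum_mul, mul_sum]
    refine sum_congr rfl fun y _ => ?_
    push_cast; ring
  rw [e1, add_sub_assoc, ← sum_sub_distrib, add_comm]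
  refine (norm_add_le _ _).trans (add_le_add ?_ (norm_sum_W_tail_le hd0 B _ hV0))
  have hc : ((Y ((V : ℝ) ^ 2)).card : ℝ) ≤ (V : ℝ) ^ 2 := by
    rw [← Y_filter_eq hV]
    exact_mod_cast card_Y_filter_le B (V ^ 2)
  calc _ ≤ ∑ y ∈ Y ((V : ℝ) ^ 2), 13 * q * (1 + |β| * B) := by
        refine (norm_sum_le _ _).trans (sum_le_sum fun y hy => ?_)
        exact norm_W_major_sub_le (coeff_pos hd0 (mem_Y.1 hy).1) hq r β hB0
    _ = (Y ((V : ℝ) ^ 2)).card * (13 * q * (1 + |β| * B)) := by rw [sum_const, nsmul_eq_mul]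
    _ ≤ _ := by gcongr

/-- The model for `f d B (r / q + u / B) / √B`. -/
noncomputable def model (d V q : ℕ) (r : ℤ) (u : ℝ) : ℂ :=
  sing d V q r * osc u + (starRingEnd ℂ) (sing d V q r * osc u)

theorem continuous_model (d V q : ℕ) (r : ℤ) : Continuous (model d V q r) := by
  unfold model
  exact (continuous_const.mul continuous_osc).add
    (Complex.continuous_conj.comp (continuous_const.mul continuous_osc))

theorem norm_model_le {d : ℕ} (hd : 0 < d) (V : ℕ) {q : ℕ} (hq : 0 < q) (r : ℤ) (u : ℝ) :
    ‖model d V q r u‖ ≤ 7 := by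
  have h1 : ‖sing d V q r * osc u‖ ≤ 3 * 1 := by
    rw [norm_mul]
    exact mul_le_mul (norm_sing_le hd V hq r) (norm_osc_le u) (norm_nonneg _) (by norm_num)
  unfold model
  refine (norm_add_le _ _).trans ?_
  rw [RCLike.norm_conj]
  linarith

theorem norm_f_div_sub_model_le {d : ℕ} (hd : Squarefree d) {B : ℝ} (hB : 1 ≤ B) {V : ℕ}
    (hV0 : 0 < V) (hV : (V : ℝ) ^ 2 ≤ B) {q : ℕ} (hq : 0 < q) (r : ℤ) (u : ℝ) :
    ‖f d B (r / q + u / B) / √B - model d V q r u‖ ≤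
      (1 + 26 * V ^ 2 * q * (1 + |u|)) / √B + 4 / V := by
  have hB0 : 0 < B := by linarith
  have hb : 0 < √B := Real.sqrt_pos.2 hB0
  have hbc : (√B : ℂ) ≠ 0 := by exact_mod_cast hb.ne'
  have h := norm_g_major_sub_le hd hV0 hV hq r (u / B)
  have e1 : u / B * B = u := by field_simp
  rw [abs_div, abs_of_pos hB0, e1, div_mul_cancel₀ _ hB0.ne'] at h
  set D := g d B (r / q + u / B) - √B * (sing d V q r * osc u) with hD
  have e2 : f d B (r / q + u / B) / √B - model d V q r u =
      (1 + (D + (starRingEnd ℂ) D)) / √B := by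
    rw [f_eq, hD, model]
    simp only [map_sub, map_mul, Complex.conj_ofReal]
    field_simp
    ring
  rw [e2, norm_div, Complex.norm_real, Real.norm_of_nonneg hb.le, div_le_iff₀ hb]
  have h2 : ‖1 + (D + (starRingEnd ℂ) D)‖ ≤ 1 + 2 * ‖D‖ := by
    refine (norm_add_le _ _).trans ?_
    have := norm_add_le D ((starRingEnd ℂ) D)
    rw [RCLike.norm_conj] at this
    rw [norm_one]; linarith
  refine h2.trans ?_
  rw [add_mul, div_mul_cancel₀ _ hb.ne']
  have e3 : √B * (2 / V) * 2 = 4 / V * √B := by ring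
  linarith

/-! ### Dissection into arcs -/

/-- Pairs `(q, r)` with `1 ≤ r ≤ q ≤ Q` and `r` coprime to `q`. -/
def arcs (Q : ℕ) : Finset (ℕ × ℕ) :=
  (Icc 1 Q ×ˢ Icc 1 Q).filter (fun i => i.2 ≤ i.1 ∧ i.1.Coprime i.2)

theorem mem_arcs {Q : ℕ} {i : ℕ × ℕ} :
    i ∈ arcs Q ↔ (0 < i.1 ∧ i.1 ≤ Q) ∧ 0 < i.2 ∧ i.2 ≤ i.1 ∧ i.1.Coprime i.2 := by
  unfold arcs
  rw [mem_filter, mem_product, mem_Icc, mem_Icc]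
  constructor
  · rintro ⟨⟨⟨h1, h2⟩, h3, h4⟩, h5, h6⟩; exact ⟨⟨h1, h2⟩, h3, h5, h6⟩
  · rintro ⟨⟨h1, h2⟩, h3, h5, h6⟩; exact ⟨⟨⟨h1, h2⟩, h3, h5.trans h2⟩, h5, h6⟩

theorem card_arcs_le (Q : ℕ) : (arcs Q).card ≤ Q ^ 2 := by
  refine (card_filter_le _ _).trans ?_
  rw [card_product]; simp [pow_two]

/-- The major arc around `r / q`. -/
def arc (Q : ℕ) (B : ℝ) (i : ℕ × ℕ) : Set ℝ :=
  Set.Icc ((i.2 : ℝ) / i.1 + (-(Q : ℝ)) / B) ((i.2 : ℝ) / i.1 + (Q : ℝ) / B)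

theorem arc_subset {Q : ℕ} {B : ℝ} (hB : 2 * (Q : ℝ) ^ 3 < B) {i : ℕ × ℕ} (hi : i ∈ arcs Q) :
    arc Q B i ⊆ Set.Ioc ((Q : ℝ) / B) ((Q : ℝ) / B + 1) := by
  obtain ⟨⟨hq0, hqQ⟩, hr0, hrq, -⟩ := mem_arcs.1 hi
  have hq0' : (1 : ℝ) ≤ i.1 := by exact_mod_cast hq0
  have hqQ' : (i.1 : ℝ) ≤ Q := by exact_mod_cast hqQ
  have hr0' : (1 : ℝ) ≤ i.2 := by exact_mod_cast hr0
  have hrq' : (i.2 : ℝ) ≤ i.1 := by exact_mod_cast hrq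
  have hB0 : 0 < B := lt_of_le_of_lt (by positivity) hB
  intro x hx
  obtain ⟨h1, h2⟩ := hx
  have hle : (i.2 : ℝ) / i.1 ≤ 1 := div_le_one_of_le₀ hrq' (by linarith)
  refine ⟨?_, by linarith⟩
  have hlow : 2 * ((Q : ℝ) / B) < (i.2 : ℝ) / i.1 := by
    rw [← mul_div_assoc, div_lt_div_iff₀ hB0 (by linarith)]
    have hQ1 : (1 : ℝ) ≤ Q := hq0'.trans hqQ'
    have h3 : (2 * Q : ℝ) * i.1 ≤ 2 * Q ^ 3 := by
      calc (2 * Q : ℝ) * i.1 ≤ 2 * Q * Q := by gcongr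
        _ = 2 * (Q ^ 2 * 1) := by ring
        _ ≤ 2 * (Q ^ 2 * Q) := by gcongr
        _ = _ := by ring
    have h4 : 1 * B ≤ i.2 * B := by gcongr
    linarith
  rw [neg_div] at h1
  linarith

theorem arc_disjoint {Q : ℕ} {B : ℝ} (hB : 2 * (Q : ℝ) ^ 3 < B) {i j : ℕ × ℕ}
    (hi : i ∈ arcs Q) (hj : j ∈ arcs Q) (hij : i ≠ j) : Disjoint (arc Q B i) (arc Q B j) := by
  obtain ⟨⟨hq0, hqQ⟩, hr0, hrq, hc⟩ := mem_arcs.1 hi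
  obtain ⟨⟨hq0', hqQ'⟩, hr0', hrq', hc'⟩ := mem_arcs.1 hj
  have hB0 : 0 < B := lt_of_le_of_lt (by positivity) hB
  have a1 : (1 : ℝ) ≤ i.1 := by exact_mod_cast hq0
  have a2 : (1 : ℝ) ≤ j.1 := by exact_mod_cast hq0'
  have b1 : (i.1 : ℝ) ≤ Q := by exact_mod_cast hqQ
  have b2 : (j.1 : ℝ) ≤ Q := by exact_mod_cast hqQ'
  rw [Set.disjoint_left]
  intro x hx hx'
  obtain ⟨h1, h2⟩ := hx
  obtain ⟨h3, h4⟩ := hx'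
  rw [neg_div] at h1 h3
  have hne : (i.2 : ℤ) * j.1 - j.2 * i.1 ≠ 0 := by
    intro h0
    have h5 : i.2 * j.1 = j.2 * i.1 := by
      have := sub_eq_zero.1 h0; exact_mod_cast this
    have d1 : i.1 ∣ j.1 := hc.dvd_of_dvd_mul_left ⟨j.2, by rw [h5]; ring⟩
    have d2 : j.1 ∣ i.1 := hc'.dvd_of_dvd_mul_left ⟨i.2, by rw [← h5]; ring⟩
    have h6 := Nat.dvd_antisymm d1 d2
    rw [h6] at h5
    exact hij (Prod.ext h6 (Nat.eq_of_mul_eq_mul_right hq0' h5))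
  have habs : (1 : ℝ) ≤ |(i.2 : ℝ) * j.1 - j.2 * i.1| := by
    have := Int.one_le_abs hne
    exact_mod_cast this
  have hdiff : |(i.2 : ℝ) / i.1 - j.2 / j.1| ≤ 2 * (Q / B) := by
    rw [abs_le]; constructor <;> linarith
  have e : (i.2 : ℝ) / i.1 - j.2 / j.1 = (i.2 * j.1 - j.2 * i.1) / (i.1 * j.1) := by
    field_simp
  rw [e, abs_div, abs_of_pos (by positivity : (0 : ℝ) < i.1 * j.1), div_le_iff₀ (by positivity)]
    at hdiff
  have h7 : 2 * ((Q : ℝ) / B) * (i.1 * j.1) ≤ 2 * ((Q : ℝ) / B) * (Q * Q) := by gcongr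
  have h8 : 2 * ((Q : ℝ) / B) * (Q * Q) = 2 * Q ^ 3 / B := by ring
  have h9 : 2 * (Q : ℝ) ^ 3 / B < 1 := (div_lt_one hB0).2 hB
  linarith

theorem exists_minor_approx {Q : ℕ} (hQ : 0 < Q) {B : ℝ} (hB : 2 * (Q : ℝ) ^ 3 < B) {α : ℝ}
    (hα : α ∈ Set.Ioc ((Q : ℝ) / B) ((Q : ℝ) / B + 1)) (hmin : ∀ i ∈ arcs Q, α ∉ arc Q B i) :
    ∃ (r : ℤ) (q : ℕ), (Q : ℝ) ≤ q ∧ (q : ℝ) ≤ B / Q ∧ IsCoprime r (q : ℤ) ∧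
      |α - r / q| ≤ 1 / (q : ℝ) ^ 2 := by
  have hB0 : 0 < B := lt_of_le_of_lt (by positivity) hB
  have hQ1 : (1 : ℝ) ≤ Q := by exact_mod_cast hQ
  have hBQ : 1 ≤ B / Q := by
    rw [le_div_iff₀ (by linarith)]
    have : (Q : ℝ) ≤ Q ^ 3 := le_self_pow₀ hQ1 (by norm_num)
    nlinarith
  have hn : 0 < ⌊B / Q⌋₊ := Nat.floor_pos.2 hBQ
  obtain ⟨p, hp1, hp2⟩ := Real.exists_rat_abs_sub_le_and_den_le α hn
  have hden : (0 : ℝ) < p.den := by exact_mod_cast p.den_pos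
  have hden1 : (1 : ℝ) ≤ p.den := by exact_mod_cast p.den_pos
  have hpe : (p : ℝ) = (p.num : ℝ) / p.den := Rat.cast_def p
  have hdle : (p.den : ℝ) ≤ B / Q :=
    le_trans (by exact_mod_cast hp2) (Nat.floor_le (by positivity))
  have happ : |α - p.num / p.den| ≤ (Q / B) / p.den := by
    rw [← hpe]
    refine hp1.trans ?_
    rw [div_div, div_le_div_iff₀ (by positivity) (by positivity)]
    have := (Nat.lt_floor_add_one (B / Q)).le
    rw [div_le_iff₀ (by linarith)] at this
    nlinarith
  have hcop : p.den.Coprime p.num.natAbs := p.reduced.symm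
  refine ⟨p.num, p.den, ?_, hdle, ?_, ?_⟩
  · by_contra hlt
    rw [not_le] at hlt
    have hle : p.den ≤ Q := by exact_mod_cast hlt.le
    have happ2 : |α - p.num / p.den| ≤ Q / B :=
      happ.trans (div_le_self (by positivity) hden1)
    have hpos : 0 < p.num := by
      have h1 := (abs_le.1 happ2).2
      have : (0 : ℝ) < (p.num : ℝ) / p.den := by linarith [hα.1]
      have := (div_pos_iff_of_pos_right hden).1 this
      exact_mod_cast this
    obtain ⟨r, hr⟩ := Int.eq_ofNat_of_zero_le hpos.le
    have hr0 : 0 < r := by omega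
    rw [hr] at happ2 hcop
    simp only [Int.natAbs_natCast, Int.cast_natCast] at happ2 hcop
    have hrd : r ≤ p.den := by
      by_contra hgt
      have h2 : (p.den : ℝ) + 1 ≤ r := by exact_mod_cast (not_le.1 hgt)
      have h3 := (abs_le.1 happ2).1
      have h4 : 1 + 1 / (Q : ℝ) ≤ r / p.den := by
        calc 1 + 1 / (Q : ℝ) ≤ 1 + 1 / p.den := by gcongr
          _ = (p.den + 1) / p.den := by field_simp
          _ ≤ _ := by gcongr
      have h5 : 2 * ((Q : ℝ) / B) < 1 / Q := by
        rw [← mul_div_assoc, div_lt_div_iff₀ hB0 (by linarith)]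
        have : (Q : ℝ) ^ 2 ≤ Q ^ 3 := pow_le_pow_right₀ hQ1 (by norm_num)
        nlinarith
      linarith [hα.2]
    refine hmin (p.den, r) (mem_arcs.2 ⟨⟨p.den_pos, hle⟩, hr0, hrd, hcop⟩) ?_
    unfold arc
    rw [Set.mem_Icc, neg_div]
    rw [abs_le] at happ2
    simp only
    constructor <;> linarith [happ2.1, happ2.2]
  · exact Int.isCoprime_iff_gcd_eq_one.2 p.reduced
  · refine happ.trans ?_
    rw [div_le_div_iff₀ hden (by positivity)]
    have h1 : (p.den : ℝ) * (Q / B) ≤ 1 := by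
      calc (p.den : ℝ) * (Q / B) ≤ (B / Q) * (Q / B) := by gcongr
        _ = 1 := by field_simp
    nlinarith

theorem norm_pow_sub_pow_le {x y : ℂ} {M : ℝ} (hx : ‖x‖ ≤ M) (hy : ‖y‖ ≤ M) (k : ℕ) :
    ‖x ^ (k + 1) - y ^ (k + 1)‖ ≤ (k + 1) * M ^ k * ‖x - y‖ := by
  have hM : 0 ≤ M := (norm_nonneg _).trans hx
  induction k with
  | zero => simp
  | succ k ih =>
    have e : x ^ (k + 1 + 1) - y ^ (k + 1 + 1) =
        (x ^ (k + 1) - y ^ (k + 1)) * x + y ^ (k + 1) * (x - y) := by ring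
    rw [e]
    refine (norm_add_le _ _).trans ?_
    rw [norm_mul, norm_mul, norm_pow]
    calc _ ≤ ((k + 1) * M ^ k * ‖x - y‖) * M + M ^ (k + 1) * ‖x - y‖ := by gcongr
      _ = _ := by push_cast; ring

/-- The model for the normalized number of tuples, independent of `B`. -/
noncomputable def modelCount (k d V Q : ℕ) : ℂ :=
  ∑ i ∈ arcs Q, ∫ u in (-(Q : ℝ))..Q, model d V i.1 i.2 u ^ k

theorem norm_tuples_sub_modelCount_le {d : ℕ} (hd : Squarefree d) (l : ℕ) {T V Z : ℕ} (hT : 0 < T)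
    (hV : 0 < V) (hZ : 0 < Z) {B τ : ℝ} (hB : 1 ≤ B) (hVB : (V : ℝ) ^ 2 ≤ B)
    (hTB : 2 * ((T ^ 4 : ℕ) : ℝ) ^ 3 < B) (hτ1 : 1 ≤ τ)
    (hτ : ∀ m : ℕ, 0 < m → (m : ℝ) ≤ B → (m.divisors.card : ℝ) ≤ τ) :
    ‖((tuples (l + 5) d B).card : ℂ) / (√B : ℂ) ^ (l + 3) - modelCount (l + 5) d V (T ^ 4)‖ ≤
      (1 / √B + 2 * (7 * Z ^ 2 / T + 2 / Z)) * 7 ^ l * (264 * τ ^ 6) +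
      2 * (T : ℝ) ^ 12 * ((l + 5) * 7 ^ (l + 4) *
        ((1 + 52 * V ^ 2 * T ^ 8) / √B + 4 / V)) := by
  set Q := T ^ 4 with hQdef
  have hQ : 0 < Q := by positivity
  have hQ1 : (1 : ℝ) ≤ Q := by exact_mod_cast hQ
  have hB0 : 0 < B := by linarith
  set b := √B with hbdef
  have hb : 0 < b := Real.sqrt_pos.2 hB0
  have hbb : b ^ 2 = B := Real.sq_sqrt hB0.le
  have hbc : (b : ℂ) ≠ 0 := by exact_mod_cast hb.ne'
  have hBc : (B : ℂ) = (b : ℂ) ^ 2 := by rw [← hbb]; push_cast; rfl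
  set F := f d B with hF
  have hFc : Continuous F := continuous_f d B
  set X := Set.Ioc ((Q : ℝ) / B) ((Q : ℝ) / B + 1) with hX
  set Mj : Set ℝ := ⋃ i ∈ arcs Q, arc Q B i with hMj
  have hMX : Mj ⊆ X := Set.iUnion₂_subset fun i hi => arc_subset hTB hi
  have hMm : MeasurableSet Mj := Finset.measurableSet_biUnion _ fun i _ => measurableSet_Icc
  have hcount := integral_f_pow (l + 5) d B ((Q : ℝ) / B)
  rw [intervalIntegral.integral_of_le (by linarith)] at hcount
  have hXint : ∀ k, MeasureTheory.IntegrableOn (fun x => F x ^ k) X := fun k =>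
    ((hFc.pow k).integrableOn_Icc).mono_set Set.Ioc_subset_Icc_self
  have hXnint : ∀ k, MeasureTheory.IntegrableOn (fun x => ‖F x‖ ^ k) X := fun k =>
    ((hFc.norm.pow k).integrableOn_Icc).mono_set Set.Ioc_subset_Icc_self
  have hsplit : ∫ x in X, F x ^ (l + 5) =
      (∫ x in Mj, F x ^ (l + 5)) + ∫ x in X \ Mj, F x ^ (l + 5) := by
    rw [MeasureTheory.setIntegral_sdiff hMm (hXint _) hMX, add_sub_cancel]
  -- minor arcs
  set m := b * (1 / b + 2 * (7 * Z ^ 2 / T + 2 / Z)) with hm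
  have hm0 : 0 ≤ m := by positivity
  have hminor : ‖∫ x in X \ Mj, F x ^ (l + 5)‖ ≤ m * (7 * b) ^ l * (264 * (B * τ ^ 6)) := by
    have h1 : ‖∫ x in X \ Mj, F x ^ (l + 5)‖ ≤
        ∫ x in X \ Mj, (m * (7 * b) ^ l) * ‖F x‖ ^ 4 := by
      refine (MeasureTheory.norm_integral_le_integral_norm _).trans ?_
      refine MeasureTheory.setIntegral_mono_on ?_ ?_ (measurableSet_Ioc.diff hMm) ?_
      · exact ((hXint _).mono_set Set.sdiff_subset).norm
      · exact ((hXnint _).mono_set Set.sdiff_subset).const_mul _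
      · intro x hx
        have hmin : ‖F x‖ ≤ m := by
          obtain ⟨r, q, h1, h2, h3, h4⟩ := exists_minor_approx hQ hTB hx.1 (by
            intro i hi hxi
            exact hx.2 (Set.mem_iUnion₂.2 ⟨i, hi, hxi⟩))
          have hT1 : (1 : ℝ) ≤ T := by exact_mod_cast hT
          have hQe : (Q : ℝ) = (T : ℝ) ^ 4 := by rw [hQdef]; push_cast; rfl
          have hT8 : (T : ℝ) ^ 8 ≤ B := by
            rw [hQe, ← pow_mul] at hTB
            have : (T : ℝ) ^ 8 ≤ (T : ℝ) ^ (4 * 3) := pow_le_pow_right₀ hT1 (by norm_num)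
            linarith [pow_nonneg (by linarith : (0 : ℝ) ≤ T) (4 * 3)]
          rw [hQe] at h1 h2
          have h5 := norm_g_minor_le hd hT1 hT8 hZ h1 h2 h3 h4
          have h6 := norm_f_le d B x
          calc ‖F x‖ ≤ 1 + 2 * ‖g d B x‖ := h6
            _ ≤ 1 + 2 * (b * (7 * Z ^ 2 / T + 2 / Z)) := by gcongr
            _ = m := by rw [hm]; field_simp
        have h7 : ‖F x‖ ≤ 7 * b := norm_f_le_sqrt hd hB x
        rw [norm_pow]
        calc ‖F x‖ ^ (l + 5) = ‖F x‖ * ‖F x‖ ^ l * ‖F x‖ ^ 4 := by ring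
          _ ≤ m * (7 * b) ^ l * ‖F x‖ ^ 4 := by gcongr
    refine h1.trans ?_
    rw [MeasureTheory.integral_const_mul]
    gcongr
    calc ∫ x in X \ Mj, ‖F x‖ ^ 4 ≤ ∫ x in X, ‖F x‖ ^ 4 := by
          refine MeasureTheory.setIntegral_mono_set (hXnint 4) ?_ ?_
          · exact Filter.Eventually.of_forall fun x => by positivity
          · exact Filter.Eventually.of_forall Set.sdiff_subset
      _ ≤ _ := by
          have := integral_norm_f_pow_four_le hB hτ1 hτ d ((Q : ℝ) / B)
          rwa [intervalIntegral.integral_of_le (by linarith)] at this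
  -- major arcs
  have hmajor : (∫ x in Mj, F x ^ (l + 5)) = (b : ℂ) ^ (l + 3) *
      ∑ i ∈ arcs Q, ∫ u in (-(Q : ℝ))..Q, (F ((i.2 : ℝ) / i.1 + u / B) / b) ^ (l + 5) := by
    have hme : ∀ i ∈ arcs Q, MeasurableSet (arc Q B i) := fun i _ => measurableSet_Icc
    rw [hMj, MeasureTheory.integral_biUnion_finset _ hme
      (fun i hi j hj hij => arc_disjoint hTB hi hj hij)
      (fun i hi => (hXint _).mono_set (arc_subset hTB hi)), mul_sum]
    refine sum_congr rfl fun i hi => ?_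
    have hle : (i.2 : ℝ) / i.1 + (-(Q : ℝ)) / B ≤ (i.2 : ℝ) / i.1 + (Q : ℝ) / B := by
      gcongr; linarith
    unfold arc
    rw [MeasureTheory.integral_Icc_eq_integral_Ioc, ← intervalIntegral.integral_of_le hle]
    have h1 := intervalIntegral.integral_comp_add_div (a := -(Q : ℝ)) (b := Q)
      (fun x => F x ^ (l + 5)) hB0.ne' ((i.2 : ℝ) / i.1)
    simp_rw [div_pow]
    rw [intervalIntegral.integral_div, h1, Complex.real_smul, hBc]
    field_simp
    ring
  have hmodel : ‖(∑ i ∈ arcs Q, ∫ u in (-(Q : ℝ))..Q,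
      (F ((i.2 : ℝ) / i.1 + u / B) / b) ^ (l + 5)) - modelCount (l + 5) d V Q‖ ≤
      2 * (T : ℝ) ^ 12 * ((l + 5) * 7 ^ (l + 4) *
        ((1 + 52 * V ^ 2 * T ^ 8) / b + 4 / V)) := by
    unfold modelCount
    rw [← sum_sub_distrib]
    set E := (l + 5 : ℝ) * 7 ^ (l + 4) * ((1 + 52 * V ^ 2 * T ^ 8) / b + 4 / V) with hE
    have hE0 : 0 ≤ E := by positivity
    have hone : ∀ i ∈ arcs Q, ‖(∫ u in (-(Q : ℝ))..Q,
        (F ((i.2 : ℝ) / i.1 + u / B) / b) ^ (l + 5)) -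
        ∫ u in (-(Q : ℝ))..Q, model d V i.1 i.2 u ^ (l + 5)‖ ≤ E * (2 * Q) := by
      intro i hi
      obtain ⟨⟨hq0, hqQ⟩, -⟩ := mem_arcs.1 hi
      have hqQ' : (i.1 : ℝ) ≤ Q := by exact_mod_cast hqQ
      rw [← intervalIntegral.integral_sub]
      rotate_left
      · exact ((hFc.comp (by fun_prop)).div_const _ |>.pow _).intervalIntegrable _ _
      · exact ((continuous_model _ _ _ _).pow _).intervalIntegrable _ _
      refine (intervalIntegral.norm_integral_le_of_norm_le_const (C := E) fun u hu => ?_).trans ?_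
      · rw [Set.uIoc_of_le (by linarith)] at hu
        have hu' : |u| ≤ Q := abs_le.2 ⟨hu.1.le, hu.2⟩
        have h1 := norm_f_div_sub_model_le hd hB hV hVB hq0 (i.2 : ℤ) u
        rw [Int.cast_natCast] at h1
        have h2 : ‖F ((i.2 : ℝ) / i.1 + u / B) / b‖ ≤ 7 := by
          rw [norm_div, Complex.norm_real, Real.norm_of_nonneg hb.le, div_le_iff₀ hb]
          exact norm_f_le_sqrt hd hB _
        have h3 := norm_model_le (Nat.pos_of_ne_zero hd.ne_zero) V hq0 (i.2 : ℤ) u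
        have h4 := norm_pow_sub_pow_le h2 h3 (l + 4)
        push_cast at h4
        refine h4.trans ?_
        rw [hE]
        have h5 : (l : ℝ) + 4 + 1 = l + 5 := by ring
        rw [h5]
        gcongr
        refine h1.trans ?_
        have h6 : (T : ℝ) ^ 8 = Q * Q := by rw [hQdef]; push_cast; ring
        gcongr ?_ / b + _
        rw [h6]
        have h7 : 26 * (V : ℝ) ^ 2 * i.1 * (1 + |u|) ≤ 26 * (V : ℝ) ^ 2 * Q * (Q + Q) := by
          gcongr
        calc 1 + 26 * (V : ℝ) ^ 2 * i.1 * (1 + |u|) ≤ 1 + 26 * (V : ℝ) ^ 2 * Q * (Q + Q) := by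
              linarith
          _ = _ := by ring
      · rw [abs_of_nonneg (by linarith)]
        apply le_of_eq; ring
    refine (norm_sum_le _ _).trans ((sum_le_sum hone).trans ?_)
    rw [sum_const, nsmul_eq_mul]
    have hca : ((arcs Q).card : ℝ) ≤ (Q : ℝ) ^ 2 := by exact_mod_cast card_arcs_le Q
    calc ((arcs Q).card : ℝ) * (E * (2 * Q)) ≤ (Q : ℝ) ^ 2 * (E * (2 * Q)) := by gcongr
      _ = 2 * (T : ℝ) ^ 12 * E := by rw [hQdef]; push_cast; ring
  have hfin : ((tuples (l + 5) d B).card : ℂ) / (b : ℂ) ^ (l + 3) - modelCount (l + 5) d V Q =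
      (∫ x in X \ Mj, F x ^ (l + 5)) / (b : ℂ) ^ (l + 3) +
      ((∑ i ∈ arcs Q, ∫ u in (-(Q : ℝ))..Q, (F ((i.2 : ℝ) / i.1 + u / B) / b) ^ (l + 5)) -
        modelCount (l + 5) d V Q) := by
    rw [← hcount, hsplit, hmajor, add_div, mul_div_cancel_left₀ _ (pow_ne_zero _ hbc)]
    ring
  rw [hfin]
  refine (norm_add_le _ _).trans (add_le_add ?_ hmodel)
  rw [norm_div, norm_pow, Complex.norm_real, Real.norm_of_nonneg hb.le, div_le_iff₀ (by positivity)]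
  refine hminor.trans (le_of_eq ?_)
  rw [hm, ← hbb]; ring

/-! ### Sieving by the greatest common divisor -/

theorem sq_dvd_of_squareful {d : ℕ} (hd : Squarefree d) {a : ℤ} (ha : Squareful a) (h0 : a ≠ 0)
    (hda : (d : ℤ) ∣ a) : d ^ 2 ∣ a.natAbs := by
  have hm : a.natAbs ≠ 0 := Int.natAbs_ne_zero.2 h0
  have hdm : d ∣ a.natAbs := Int.natCast_dvd.1 hda
  refine (Nat.factorization_prime_le_iff_dvd (pow_ne_zero 2 hd.ne_zero) hm).1 fun p hp => ?_
  rw [Nat.factorization_pow]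
  simp only [Finsupp.coe_smul, Pi.smul_apply, smul_eq_mul]
  have h1 := hd.natFactorization_le_one p
  by_cases hpd : p ∣ d
  · have h2 : p ^ 2 ∣ a.natAbs := by
      have := ha p hp ((Int.natCast_dvd_natCast.2 hpd).trans hda)
      rw [← Int.natCast_pow] at this
      exact Int.natCast_dvd.1 this
    have := (hp.pow_dvd_iff_le_factorization hm).1 h2
    omega
  · rw [Nat.factorization_eq_zero_of_not_dvd hpd]; simp

theorem mem_tuples {k d : ℕ} {B : ℝ} (hB : 0 ≤ B) {a : Fin k → ℤ} :
    a ∈ tuples k d B ↔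
      (∀ i, (|a i| : ℝ) ≤ B ∧ Squareful (a i) ∧ (d : ℤ) ∣ a i) ∧ ∑ i, a i = 0 := by
  unfold tuples
  simp only [mem_filter, Fintype.mem_piFinset, mem_S hB]

/-- Primitive tuples of squareful integers of height at most `B` with sum zero. -/
noncomputable def primTuples (k : ℕ) (B : ℝ) : Finset (Fin k → ℤ) :=
  (tuples k 1 B).filter (fun a => univ.gcd a = 1)

theorem sum_moebius_dvd_gcd {k : ℕ} {B : ℝ} (hB : 0 ≤ B) {a : Fin k → ℤ} (ha : a ∈ tuples k 1 B)
    (h0 : a ≠ 0) :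
    ∑ d ∈ Icc 1 ⌊√B⌋₊, (if ∀ i, (d : ℤ) ∣ a i then ArithmeticFunction.moebius d else 0) =
      if univ.gcd a = 1 then 1 else 0 := by
  rw [mem_tuples hB] at ha
  obtain ⟨j, hj⟩ := Function.ne_iff.1 h0
  simp only [Pi.zero_apply] at hj
  have hG0 : univ.gcd a ≠ 0 := by
    intro h
    exact hj (Finset.gcd_eq_zero_iff.1 h j (mem_univ j))
  have hG1 : 0 ≤ univ.gcd a := by
    have := Finset.normalize_gcd (s := univ) (f := a)
    rw [← this, ← Int.abs_eq_normalize]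
    exact abs_nonneg _
  obtain ⟨m, hm⟩ := Int.eq_ofNat_of_zero_le hG1
  have hm0 : m ≠ 0 := by rintro rfl; exact hG0 (by simpa using hm)
  have hdvd : ∀ d : ℕ, (∀ i, (d : ℤ) ∣ a i) ↔ d ∣ m := by
    intro d
    rw [← Int.natCast_dvd_natCast, ← hm, Finset.dvd_gcd_iff]
    simp
  simp_rw [hdvd]
  rw [← sum_filter]
  have h1 : ∑ d ∈ (Icc 1 ⌊√B⌋₊).filter (fun d => d ∣ m), ArithmeticFunction.moebius d =
      ∑ d ∈ m.divisors, ArithmeticFunction.moebius d := by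
    refine sum_subset ?_ ?_
    · intro d hd
      exact Nat.mem_divisors.2 ⟨(mem_filter.1 hd).2, hm0⟩
    · intro d hd hd'
      have hdm := (Nat.mem_divisors.1 hd).1
      refine ArithmeticFunction.moebius_eq_zero_of_not_squarefree fun hsq => hd' ?_
      refine mem_filter.2 ⟨mem_Icc.2 ⟨Nat.pos_of_mem_divisors hd, Nat.le_floor ?_⟩, hdm⟩
      have h2 := sq_dvd_of_squareful hsq (ha.1 j).2.1 hj ((hdvd d).2 hdm j)
      have h3 : ((d ^ 2 : ℕ) : ℝ) ≤ ((a j).natAbs : ℕ) := by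
        exact_mod_cast Nat.le_of_dvd (Int.natAbs_pos.2 hj) h2
      rw [Nat.cast_natAbs] at h3
      refine Real.le_sqrt_of_sq_le ?_
      have := (ha.1 j).1
      push_cast at h3
      linarith
  rw [h1, ← ArithmeticFunction.coe_mul_zeta_apply, ArithmeticFunction.moebius_mul_coe_zeta,
    ArithmeticFunction.one_apply, hm]
  simp

theorem card_primTuples {k : ℕ} {B : ℝ} (hB : 0 ≤ B) :
    ((primTuples k B).card : ℤ) =
      ∑ d ∈ Icc 1 ⌊√B⌋₊, ArithmeticFunction.moebius d * ((tuples k d B).card - 1) := by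
  have hz : ∀ d, (0 : Fin k → ℤ) ∈ tuples k d B := fun d => by
    rw [mem_tuples hB]; simp [hB, squareful_zero]
  have e1 : ((primTuples k B).card : ℤ) =
      ∑ a ∈ (tuples k 1 B).erase 0, if univ.gcd a = 1 then 1 else 0 := by
    unfold primTuples
    rw [card_filter]
    push_cast
    rw [← add_sum_erase _ _ (hz 1), if_neg, zero_add]
    rw [Finset.gcd_eq_zero_iff.2 (by simp)]
    simp
  rw [e1, ← sum_congr rfl fun a ha => sum_moebius_dvd_gcd hB (mem_of_mem_erase ha)
    (ne_of_mem_erase ha), sum_comm]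
  refine sum_congr rfl fun d _ => ?_
  rw [← sum_filter, sum_const, nsmul_eq_mul, mul_comm]
  congr 1
  have e2 : ((tuples k 1 B).erase 0).filter (fun a => ∀ i, (d : ℤ) ∣ a i) =
      (tuples k d B).erase 0 := by
    ext a
    simp only [mem_filter, mem_erase, mem_tuples hB]
    constructor
    · rintro ⟨⟨h1, h2, h3⟩, h4⟩
      exact ⟨h1, fun i => ⟨(h2 i).1, (h2 i).2.1, h4 i⟩, h3⟩
    · rintro ⟨h1, h2, h3⟩
      exact ⟨⟨h1, fun i => ⟨(h2 i).1, (h2 i).2.1, by simp⟩, h3⟩, fun i => (h2 i).2.2⟩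
  rw [e2, card_erase_of_mem (hz d), Nat.cast_sub (card_pos.2 ⟨_, hz d⟩)]
  simp

theorem card_tuples_le {d : ℕ} (hd : Squarefree d) (l : ℕ) {B : ℝ} (hB : 1 ≤ B) :
    ((tuples (l + 5) d B).card : ℝ) ≤ (S d B).card * (7 * √B) ^ l * (quad d B).card := by
  have h1 := integral_f_pow (l + 5) d B 0
  have h2 := integral_norm_f_pow_four d B 0
  have hc := continuous_f d B
  calc ((tuples (l + 5) d B).card : ℝ) = ‖∫ x in (0 : ℝ)..(0 + 1), f d B x ^ (l + 5)‖ := by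
        rw [h1, Complex.norm_natCast]
    _ ≤ ∫ x in (0 : ℝ)..(0 + 1), ‖f d B x ^ (l + 5)‖ :=
        intervalIntegral.norm_integral_le_integral_norm (by norm_num)
    _ ≤ ∫ x in (0 : ℝ)..(0 + 1), ((S d B).card * (7 * √B) ^ l) * ‖f d B x‖ ^ 4 := by
        refine intervalIntegral.integral_mono_on (by norm_num) ?_ ?_ fun x _ => ?_
        · exact (hc.pow _).norm.intervalIntegrable _ _
        · exact (continuous_const.mul (hc.norm.pow _)).intervalIntegrable _ _
        · rw [norm_pow]
          have h3 := norm_f_le_card d B x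
          have h4 := norm_f_le_sqrt hd hB x
          calc ‖f d B x‖ ^ (l + 5) = ‖f d B x‖ * ‖f d B x‖ ^ l * ‖f d B x‖ ^ 4 := by ring
            _ ≤ _ := by gcongr
    _ = _ := by rw [intervalIntegral.integral_const_mul, h2]

theorem exists_card_S_le : ∃ C : ℝ, 1 ≤ C ∧ ∀ (d : ℕ) (B : ℝ), Squarefree d → 0 ≤ B →
    (d : ℝ) ≤ √B → ((S d B).card : ℝ) ≤ C * (√B * (d : ℝ) ^ (-(1 / 4) : ℝ)) := by
  obtain ⟨C, hC1, hC⟩ := exists_card_P_le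
  refine ⟨1 + 2 * C, by linarith, fun d B hd hB hdB => ?_⟩
  have h1 := hC d B hd hB
  have hd1 : (1 : ℝ) ≤ d := by exact_mod_cast Nat.pos_of_ne_zero hd.ne_zero
  have h2 : 1 ≤ √B * (d : ℝ) ^ (-(1 / 4) : ℝ) := by
    calc (1 : ℝ) ≤ (d : ℝ) ^ (3 / 4 : ℝ) := Real.one_le_rpow hd1 (by norm_num)
      _ = d * (d : ℝ) ^ (-(1 / 4) : ℝ) := by
          rw [← Real.rpow_one_add' (by linarith) (by norm_num)]; norm_num
      _ ≤ _ := by gcongr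
  rw [card_S]
  push_cast
  linarith

theorem exists_card_primTuples_sub_le (l : ℕ) : ∃ C : ℝ, 1 ≤ C ∧ ∀ (R : ℕ) (B τ : ℝ), 0 < R →
    1 ≤ B → (R : ℝ) ^ 4 ≤ √B → 1 ≤ τ →
    (∀ m : ℕ, 0 < m → (m : ℝ) ≤ B → (m.divisors.card : ℝ) ≤ τ) →
    |((primTuples (l + 5) B).card : ℝ) - ∑ d ∈ Icc 1 (R ^ 4),
      (ArithmeticFunction.moebius d : ℝ) * (tuples (l + 5) d B).card| ≤
      C * (√B ^ (l + 3) * τ ^ 7 / R) := by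
  obtain ⟨C, hC1, hC⟩ := exists_card_S_le
  refine ⟨1 + C * 7 ^ l * 265, ?_, fun R B τ hR hB hRB hτ1 hτ => ?_⟩
  · have : 0 ≤ C * 7 ^ l * 265 := by positivity
    linarith
  have hB0 : 0 ≤ B := by linarith
  have hR1 : (1 : ℝ) ≤ R := by exact_mod_cast hR
  set b := √B with hb
  have hb1 : 1 ≤ b := Real.one_le_sqrt.2 hB
  have hbb : b ^ 2 = B := Real.sq_sqrt hB0
  have hRf : R ^ 4 ≤ ⌊b⌋₊ := Nat.le_floor (by push_cast; exact hRB)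
  have habs : ∀ d, |(ArithmeticFunction.moebius d : ℝ)| ≤ 1 := fun d => by
    exact_mod_cast ArithmeticFunction.abs_moebius_le_one (n := d)
  have h1 := card_primTuples (k := l + 5) hB0
  have h1' : ((primTuples (l + 5) B).card : ℝ) =
      ∑ d ∈ Icc 1 ⌊b⌋₊, (ArithmeticFunction.moebius d : ℝ) * ((tuples (l + 5) d B).card - 1) := by
    exact_mod_cast congrArg (Int.cast : ℤ → ℝ) h1
  have hsub : Icc 1 (R ^ 4) ⊆ Icc 1 ⌊b⌋₊ := Icc_subset_Icc_right hRf
  have e1 : ((primTuples (l + 5) B).card : ℝ) - ∑ d ∈ Icc 1 (R ^ 4),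
      (ArithmeticFunction.moebius d : ℝ) * (tuples (l + 5) d B).card =
      (∑ d ∈ Icc 1 ⌊b⌋₊ \ Icc 1 (R ^ 4),
        (ArithmeticFunction.moebius d : ℝ) * (tuples (l + 5) d B).card) -
      ∑ d ∈ Icc 1 ⌊b⌋₊, (ArithmeticFunction.moebius d : ℝ) := by
    rw [h1', sum_sdiff_eq_sub hsub]
    simp_rw [mul_sub, mul_one]
    rw [sum_sub_distrib]; ring
  have h2 : |∑ d ∈ Icc 1 ⌊b⌋₊, (ArithmeticFunction.moebius d : ℝ)| ≤ b := by
    refine (abs_sum_le_sum_abs _ _).trans ((sum_le_sum fun d _ => habs d).trans ?_)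
    simpa using Nat.floor_le (by linarith : 0 ≤ b)
  have h3 : ∀ d ∈ Icc 1 ⌊b⌋₊ \ Icc 1 (R ^ 4),
      |(ArithmeticFunction.moebius d : ℝ) * (tuples (l + 5) d B).card| ≤
      (C * 7 ^ l * (b ^ (l + 1) / R)) * (quad d B).card := by
    intro d hd
    rw [mem_sdiff, mem_Icc, mem_Icc] at hd
    have hdR : R ^ 4 ≤ d := by omega
    by_cases hsq : Squarefree d
    · have h4 := card_tuples_le hsq l hB
      have hdb : (d : ℝ) ≤ b := (Nat.le_floor_iff' (by omega)).1 hd.1.2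
      have h5 := hC d B hsq hB0 hdb
      have h6 : (d : ℝ) ^ (-(1 / 4) : ℝ) ≤ 1 / R := by
        have h7 : (R : ℝ) ^ 4 ≤ d := by exact_mod_cast hdR
        calc (d : ℝ) ^ (-(1 / 4) : ℝ) ≤ ((R : ℝ) ^ 4) ^ (-(1 / 4) : ℝ) :=
              Real.rpow_le_rpow_of_nonpos (by positivity) h7 (by norm_num)
          _ = 1 / R := by
              rw [← Real.rpow_natCast, ← Real.rpow_mul (by positivity)]
              norm_num
              exact Real.rpow_neg_one _
      rw [abs_mul, Nat.abs_cast]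
      calc |(ArithmeticFunction.moebius d : ℝ)| * (tuples (l + 5) d B).card
          ≤ 1 * ((C * (b * (1 / R))) * (7 * b) ^ l * (quad d B).card) := by
            refine mul_le_mul (habs d) (h4.trans ?_) (by positivity) (by norm_num)
            gcongr
            exact h5.trans (by gcongr)
        _ = _ := by rw [mul_pow]; ring
    · rw [ArithmeticFunction.moebius_eq_zero_of_not_squarefree hsq]
      simp only [Int.cast_zero, zero_mul, abs_zero]
      positivity
  have h4 : |∑ d ∈ Icc 1 ⌊b⌋₊ \ Icc 1 (R ^ 4),
      (ArithmeticFunction.moebius d : ℝ) * (tuples (l + 5) d B).card| ≤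
      (C * 7 ^ l * (b ^ (l + 1) / R)) * (265 * (B * τ ^ 7)) := by
    refine (abs_sum_le_sum_abs _ _).trans ((sum_le_sum h3).trans ?_)
    rw [← mul_sum]
    gcongr
    exact (sum_le_sum_of_subset_of_nonneg sdiff_subset fun _ _ _ => by positivity).trans
      (sum_quad_card_le hB hτ1 hτ)
  have h5 : b ≤ b ^ (l + 3) * τ ^ 7 / R := by
    rw [le_div_iff₀ (by linarith)]
    have h6 : (R : ℝ) ≤ b := (le_self_pow₀ hR1 (by norm_num)).trans hRB
    calc b * R ≤ b * b := by gcongr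
      _ = b ^ 2 * 1 := by ring
      _ ≤ b ^ (l + 3) * τ ^ 7 := by
        gcongr
        · omega
        · exact one_le_pow₀ hτ1
  rw [e1]
  refine (abs_sub _ _).trans ((add_le_add h4 h2).trans ?_)
  have e2 : C * 7 ^ l * (b ^ (l + 1) / R) * (265 * (B * τ ^ 7)) =
      C * 7 ^ l * 265 * (b ^ (l + 3) * τ ^ 7 / R) := by rw [← hbb]; ring
  rw [e2]; linarith

/-! ### Convergence of the normalized count -/

/-- The approximation to the normalized number of primitive tuples at scale `R`. -/
noncomputable def scaleModel (l R : ℕ) : ℂ :=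
  ∑ d ∈ Icc 1 (R ^ 4), (ArithmeticFunction.moebius d : ℂ) *
    modelCount (l + 5) d (R ^ 222) ((R ^ 18) ^ 4)

theorem exists_norm_tuples_sub_le (l : ℕ) : ∃ C : ℝ, 1 ≤ C ∧ ∀ (R d : ℕ) (B τ : ℝ),
    Squarefree d → 2 ≤ R → 1 ≤ B → (R : ℝ) ^ 810 ≤ √B → 1 ≤ τ →
    (∀ m : ℕ, 0 < m → (m : ℝ) ≤ B → (m.divisors.card : ℝ) ≤ τ) →
    ‖((tuples (l + 5) d B).card : ℂ) / (√B : ℂ) ^ (l + 3) -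
      modelCount (l + 5) d (R ^ 222) ((R ^ 18) ^ 4)‖ ≤ C * (τ ^ 7 / (R : ℝ) ^ 6) := by
  refine ⟨1 + (19 * 7 ^ l * 264 + 2 * (l + 5) * 7 ^ (l + 4) * 57), ?_,
    fun R d B τ hd hR hB hRB hτ1 hτ => ?_⟩
  · have : (0 : ℝ) ≤ 19 * 7 ^ l * 264 + 2 * (l + 5) * 7 ^ (l + 4) * 57 := by positivity
    linarith
  have hB0 : 0 ≤ B := by linarith
  have hR2 : (2 : ℝ) ≤ R := by exact_mod_cast hR
  have hR1 : (1 : ℝ) ≤ R := by linarith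
  have hR0 : (0 : ℝ) < R := by linarith
  set b := √B with hb
  have hb0 : 0 < b := by rw [hb]; exact Real.sqrt_pos.2 (by linarith)
  have hbb : b ^ 2 = B := Real.sq_sqrt hB0
  have hBR : (R : ℝ) ^ 444 ≤ B := by
    calc (R : ℝ) ^ 444 ≤ R ^ 810 := pow_le_pow_right₀ hR1 (by norm_num)
      _ ≤ ((R : ℝ) ^ 810) ^ 2 := le_self_pow₀ (one_le_pow₀ hR1) (by norm_num)
      _ ≤ b ^ 2 := by gcongr
      _ = B := hbb
  have hVB : ((R ^ 222 : ℕ) : ℝ) ^ 2 ≤ B := by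
    push_cast; rw [← pow_mul]; exact hBR
  have hTB : 2 * (((R ^ 18) ^ 4 : ℕ) : ℝ) ^ 3 < B := by
    push_cast
    rw [← pow_mul, ← pow_mul]
    calc 2 * (R : ℝ) ^ (18 * 4 * 3) ≤ (R : ℝ) * (R : ℝ) ^ (18 * 4 * 3) := by gcongr
      _ = (R : ℝ) ^ 217 := by rw [← pow_succ']
      _ < (R : ℝ) ^ 444 := pow_lt_pow_right₀ (by linarith) (by norm_num)
      _ ≤ B := hBR
  have h1 := norm_tuples_sub_modelCount_le hd l (T := R ^ 18) (V := R ^ 222) (Z := R ^ 6)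
    (by positivity) (by positivity) (by positivity) hB hVB hTB hτ1 hτ
  refine h1.trans ?_
  push_cast
  have e1 : 1 / b ≤ 1 / (R : ℝ) ^ 810 := by gcongr
  have e2 : 1 / (R : ℝ) ^ 810 ≤ 1 / R ^ 6 := by
    gcongr
    norm_num
  have e3 : 7 * ((R : ℝ) ^ 6) ^ 2 / R ^ 18 = 7 * (1 / R ^ 6) := by field_simp
  have e4 : 2 / (R : ℝ) ^ 6 = 2 * (1 / R ^ 6) := by ring
  have e5 : (1 + 52 * ((R : ℝ) ^ 222) ^ 2 * (R ^ 18) ^ 8) / b ≤ 53 * R ^ 588 * (1 / R ^ 810) := by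
    rw [div_eq_mul_one_div]
    gcongr
    rw [← pow_mul, ← pow_mul, mul_assoc, ← pow_add]
    have : 1 ≤ (R : ℝ) ^ 588 := one_le_pow₀ hR1
    norm_num
    linarith
  have h6 : τ ^ 6 ≤ τ ^ 7 := pow_le_pow_right₀ hτ1 (by norm_num)
  have h7 : 1 ≤ τ ^ 7 := one_le_pow₀ hτ1
  rw [e3, e4]
  have e6 : (R : ℝ) ^ 588 * (1 / R ^ 810) = 1 / R ^ 222 := by
    rw [mul_one_div, div_eq_div_iff (by positivity) (by positivity), ← pow_add, one_mul]
  have e7 : ((R : ℝ) ^ 18) ^ 12 * (1 / R ^ 222) = 1 / R ^ 6 := by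
    rw [mul_one_div, div_eq_div_iff (by positivity) (by positivity), ← pow_mul, ← pow_add, one_mul]
  set w := 1 / (R : ℝ) ^ 6 with hw
  have hw0 : 0 ≤ w := by positivity
  have a1 : (1 / b + 2 * (7 * w + 2 * w)) * 7 ^ l * (264 * τ ^ 6) ≤
      (w + 2 * (7 * w + 2 * w)) * 7 ^ l * (264 * τ ^ 7) := by
    gcongr
    exact e1.trans e2
  have a2 : 2 * ((R : ℝ) ^ 18) ^ 12 * ((l + 5) * 7 ^ (l + 4) *
      ((1 + 52 * ((R : ℝ) ^ 222) ^ 2 * (R ^ 18) ^ 8) / b + 4 / R ^ 222)) ≤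
      2 * ((l + 5) * 7 ^ (l + 4) * (57 * w)) * τ ^ 7 := by
    calc _ ≤ 2 * ((R : ℝ) ^ 18) ^ 12 * ((l + 5) * 7 ^ (l + 4) *
        (53 * R ^ 588 * (1 / R ^ 810) + 4 / R ^ 222)) := by gcongr
      _ = 2 * ((l + 5) * 7 ^ (l + 4) * (57 * (((R : ℝ) ^ 18) ^ 12 * (1 / R ^ 222)))) * 1 := by
        rw [mul_assoc 53, e6]; ring
      _ ≤ _ := by rw [e7]; gcongr
  refine (add_le_add a1 a2).trans ?_
  have e8 : τ ^ 7 / (R : ℝ) ^ 6 = w * τ ^ 7 := by rw [hw]; ring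
  rw [e8]
  have : 0 ≤ w * τ ^ 7 := by positivity
  have e9 : (w + 2 * (7 * w + 2 * w)) * 7 ^ l * (264 * τ ^ 7) +
      2 * ((l + 5) * 7 ^ (l + 4) * (57 * w)) * τ ^ 7 =
      (19 * 7 ^ l * 264 + 2 * (l + 5) * 7 ^ (l + 4) * 57) * (w * τ ^ 7) := by ring
  rw [e9, add_mul]
  linarith

theorem exists_norm_primTuples_sub_scaleModel_le (l : ℕ) : ∃ C : ℝ, 1 ≤ C ∧ ∀ (R : ℕ) (B τ : ℝ),
    2 ≤ R → 1 ≤ B → (R : ℝ) ^ 810 ≤ √B → 1 ≤ τ →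
    (∀ m : ℕ, 0 < m → (m : ℝ) ≤ B → (m.divisors.card : ℝ) ≤ τ) →
    ‖((primTuples (l + 5) B).card : ℂ) / (√B : ℂ) ^ (l + 3) - scaleModel l R‖ ≤
      C * (τ ^ 7 / R) := by
  obtain ⟨C₁, hC₁, h₁⟩ := exists_norm_tuples_sub_le l
  obtain ⟨C₂, hC₂, h₂⟩ := exists_card_primTuples_sub_le l
  refine ⟨C₁ + C₂, by linarith, fun R B τ hR hB hRB hτ1 hτ => ?_⟩
  have hR1 : (1 : ℝ) ≤ R := by exact_mod_cast (by omega : 1 ≤ R)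
  have hRB4 : (R : ℝ) ^ 4 ≤ √B := (pow_le_pow_right₀ hR1 (by norm_num)).trans hRB
  have h3 := h₂ R B τ (by omega) hB hRB4 hτ1 hτ
  set b := √B with hb
  have hb0 : 0 < b := by rw [hb]; exact Real.sqrt_pos.2 (by linarith)
  have hbc : (b : ℂ) ^ (l + 3) ≠ 0 := pow_ne_zero _ (by exact_mod_cast hb0.ne')
  have e1 : ((primTuples (l + 5) B).card : ℂ) / (b : ℂ) ^ (l + 3) - scaleModel l R =
      (((primTuples (l + 5) B).card : ℝ) - ∑ d ∈ Icc 1 (R ^ 4),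
        (ArithmeticFunction.moebius d : ℝ) * (tuples (l + 5) d B).card : ℝ) / (b : ℂ) ^ (l + 3) +
      ∑ d ∈ Icc 1 (R ^ 4), (ArithmeticFunction.moebius d : ℂ) *
        (((tuples (l + 5) d B).card : ℂ) / (b : ℂ) ^ (l + 3) -
          modelCount (l + 5) d (R ^ 222) ((R ^ 18) ^ 4)) := by
    unfold scaleModel
    simp_rw [mul_sub]
    rw [sum_sub_distrib]
    push_cast
    rw [sub_div, sum_div]
    simp_rw [mul_div_assoc]
    ring
  rw [e1]
  refine (norm_add_le _ _).trans ?_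
  rw [add_comm C₁, add_mul]
  refine add_le_add ?_ ?_
  · rw [norm_div, norm_pow, Complex.norm_real, Complex.norm_real, Real.norm_of_nonneg hb0.le,
      div_le_iff₀ (by positivity), Real.norm_eq_abs]
    refine h3.trans (le_of_eq ?_)
    ring
  · have h4 : ∀ d ∈ Icc 1 (R ^ 4), ‖(ArithmeticFunction.moebius d : ℂ) *
        (((tuples (l + 5) d B).card : ℂ) / (b : ℂ) ^ (l + 3) -
          modelCount (l + 5) d (R ^ 222) ((R ^ 18) ^ 4))‖ ≤ C₁ * (τ ^ 7 / (R : ℝ) ^ 6) := by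
      intro d _
      by_cases hsq : Squarefree d
      · have h5 := h₁ R d B τ hsq hR hB hRB hτ1 hτ
        rw [norm_mul, Complex.norm_intCast]
        have h6 : |(ArithmeticFunction.moebius d : ℝ)| ≤ 1 := by
          exact_mod_cast ArithmeticFunction.abs_moebius_le_one (n := d)
        calc _ ≤ 1 * _ := mul_le_mul_of_nonneg_right h6 (norm_nonneg _)
          _ ≤ _ := by rw [one_mul]; exact h5
      · rw [ArithmeticFunction.moebius_eq_zero_of_not_squarefree hsq]
        simp only [Int.cast_zero, zero_mul, norm_zero]
        positivity
    refine (norm_sum_le _ _).trans ((sum_le_sum h4).trans ?_)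
    rw [sum_const, nsmul_eq_mul, Nat.card_Icc, Nat.add_sub_cancel]
    push_cast
    have e2 : (R : ℝ) ^ 4 * (C₁ * (τ ^ 7 / (R : ℝ) ^ 6)) = C₁ * (τ ^ 7 / (R : ℝ) ^ 2) := by
      field_simp
    rw [e2]
    gcongr
    exact le_self_pow₀ hR1 (by norm_num)

theorem exists_norm_primTuples_sub_scaleModel_le_sqrt (l : ℕ) : ∃ C : ℝ, 1 ≤ C ∧
    ∀ (R : ℕ) (x : ℝ), 2 ≤ R → (R : ℝ) ≤ x → x ≤ 2 * R →
    ‖((primTuples (l + 5) (x ^ 1620)).card : ℂ) / ((√(x ^ 1620) : ℝ) : ℂ) ^ (l + 3) -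
      scaleModel l R‖ ≤ C / √R := by
  obtain ⟨C₁, hC₁, h₁⟩ := exists_norm_primTuples_sub_scaleModel_le l
  obtain ⟨C₂, hC₂, h₂⟩ := card_divisors_le_rpow (ε := 1 / 22680) (by norm_num)
  refine ⟨C₁ * (C₂ ^ 7 * 2), one_le_mul_of_one_le_of_one_le hC₁ ?_, fun R x hR hRx hxR => ?_⟩
  · exact one_le_mul_of_one_le_of_one_le (one_le_pow₀ hC₂) (by norm_num)
  have hR2 : (2 : ℝ) ≤ R := by exact_mod_cast hR
  have hx1 : 1 ≤ x := by linarith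
  have hx0 : 0 ≤ x := by linarith
  have hB : 1 ≤ x ^ 1620 := one_le_pow₀ hx1
  have hτ1 : 1 ≤ C₂ * x ^ (1 / 14 : ℝ) :=
    one_le_mul_of_one_le_of_one_le hC₂ (Real.one_le_rpow hx1 (by norm_num))
  have hsq : √(x ^ 1620) = x ^ 810 := by
    rw [show x ^ 1620 = (x ^ 810) ^ 2 by rw [← pow_mul], Real.sqrt_sq (by positivity)]
  refine (h₁ R (x ^ 1620) (C₂ * x ^ (1 / 14 : ℝ)) hR hB ?_ hτ1 fun m hm hmB => ?_).trans ?_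
  · rw [hsq]; gcongr
  · refine (h₂ m hm.ne').trans ?_
    have h3 : (m : ℝ) ^ (1 / 22680 : ℝ) ≤ (x ^ 1620) ^ (1 / 22680 : ℝ) := by gcongr
    rw [← Real.rpow_natCast x 1620, ← Real.rpow_mul hx0] at h3
    norm_num at h3 ⊢
    gcongr
  · have e1 : (C₂ * x ^ (1 / 14 : ℝ)) ^ 7 = C₂ ^ 7 * √x := by
      rw [mul_pow, ← Real.rpow_natCast (x ^ (1 / 14 : ℝ)), ← Real.rpow_mul hx0, Real.sqrt_eq_rpow]
      norm_num
    rw [e1, mul_div_assoc C₁]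
    refine mul_le_mul_of_nonneg_left ?_ (by linarith)
    have h4 : √x ≤ 2 * √R := by
      calc √x ≤ √(2 ^ 2 * R) := Real.sqrt_le_sqrt (by linarith)
        _ = 2 * √R := by rw [Real.sqrt_mul (by norm_num), Real.sqrt_sq (by norm_num)]
    have hs : 0 < √(R : ℝ) := Real.sqrt_pos.2 (by linarith)
    rw [div_le_div_iff₀ (by linarith) hs]
    have h5 : √(R : ℝ) * √R = R := Real.mul_self_sqrt (by linarith)
    calc C₂ ^ 7 * √x * √R ≤ C₂ ^ 7 * (2 * √R) * √R := by gcongr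
      _ = C₂ ^ 7 * 2 * (√R * √R) := by ring
      _ = _ := by rw [h5]

theorem tuples_mono (k : ℕ) {B B' : ℝ} (hB : 0 ≤ B) (h : B ≤ B') :
    tuples k 1 B ⊆ tuples k 1 B' := by
  intro a ha
  rw [mem_tuples hB] at ha
  rw [mem_tuples (hB.trans h)]
  exact ⟨fun i => ⟨(ha.1 i).1.trans h, (ha.1 i).2⟩, ha.2⟩

theorem card_primTuples_mono (k : ℕ) {B B' : ℝ} (hB : 0 ≤ B) (h : B ≤ B') :
    (primTuples k B).card ≤ (primTuples k B').card :=
  card_le_card (filter_subset_filter _ (tuples_mono k hB h))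

theorem exists_tendsto_of_scale {u : ℕ → ℂ} {ν : ℝ → ℂ} {C M : ℝ}
    (hu : ∀ (R : ℕ) (x : ℝ), 2 ≤ R → (R : ℝ) ≤ x → x ≤ 2 * R → ‖ν x - u R‖ ≤ C / √R)
    (hM : ∀ x, 1 ≤ x → x ≤ 2 → ‖ν x‖ ≤ M) :
    ∃ c : ℂ, ∃ K : ℝ, 0 < K ∧ ∀ x, 1 ≤ x → ‖ν x - c‖ ≤ K / √x := by
  set r : ℝ := 1 / √2 with hr
  have hs2 : 1 < √(2 : ℝ) := by
    rw [Real.lt_sqrt (by norm_num)]; norm_num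
  have hr0 : 0 < r := by positivity
  have hr1 : r < 1 := by rw [hr, div_lt_one (by linarith)]; exact hs2
  have hrn : ∀ n : ℕ, 1 / √((2 ^ n : ℕ) : ℝ) = r ^ n := by
    intro n
    rw [hr, one_div_pow]
    congr 1
    push_cast
    rw [Real.sqrt_eq_iff_mul_self_eq (by positivity) (by positivity), ← mul_pow,
      Real.mul_self_sqrt (by norm_num)]
  have hC0 : 0 ≤ C := by
    have h := (norm_nonneg _).trans (hu 2 2 le_rfl (by norm_num) (by norm_num))
    by_contra hneg
    have : C / √((2 : ℕ) : ℝ) < 0 := div_neg_of_neg_of_pos (by linarith) (by positivity)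
    linarith
  have hM0 : 0 ≤ M := (norm_nonneg _).trans (hM 1 le_rfl (by norm_num))
  have hu' : ∀ (n : ℕ) (x : ℝ), (2 : ℝ) ^ (n + 1) ≤ x → x ≤ 2 ^ (n + 2) →
      ‖ν x - u (2 ^ (n + 1))‖ ≤ C * r ^ n := by
    intro n x h1 h2
    have h3 := hu (2 ^ (n + 1)) x (by rw [pow_succ]; have := Nat.one_le_two_pow (n := n); omega)
      (by push_cast; exact h1) (by push_cast; rw [← pow_succ']; exact h2)
    refine h3.trans ?_
    rw [div_eq_mul_one_div, hrn]
    gcongr ?_ * ?_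
    exact pow_le_pow_of_le_one hr0.le hr1.le (by omega)
  have hdist : ∀ n, dist (u (2 ^ (n + 1))) (u (2 ^ (n + 1 + 1))) ≤ (2 * C) * r ^ n := by
    intro n
    have h1 := hu' n (2 ^ (n + 2)) (pow_le_pow_right₀ (by norm_num) (by omega)) le_rfl
    have h2 := hu' (n + 1) (2 ^ (n + 2)) le_rfl (pow_le_pow_right₀ (by norm_num) (by omega))
    have h3 : C * r ^ (n + 1) ≤ C * r ^ n := by
      gcongr ?_ * ?_
      exact pow_le_pow_of_le_one hr0.le hr1.le (by omega)
    rw [← dist_eq_norm] at h1 h2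
    have h4 := dist_triangle_left (u (2 ^ (n + 1))) (u (2 ^ (n + 1 + 1))) (ν (2 ^ (n + 2)))
    linarith
  obtain ⟨c, hc⟩ := cauchySeq_tendsto_of_complete (cauchySeq_of_le_geometric r (2 * C) hr1 hdist)
  have hlim := dist_le_of_le_geometric_of_tendsto r (2 * C) hr1 hdist hc
  have hr1' : 0 < 1 - r := by linarith
  refine ⟨c, 2 * (C + 2 * C / (1 - r)) + (M + ‖c‖) * √2 + 1, by positivity, fun x hx => ?_⟩
  have hx0 : 0 < x := by linarith
  have hsx : 0 < √x := Real.sqrt_pos.2 hx0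
  obtain ⟨n, hn1, hn2⟩ := exists_nat_pow_near hx (by norm_num : (1 : ℝ) < 2)
  rw [le_div_iff₀ hsx]
  have p1 : 0 ≤ 2 * (C + 2 * C / (1 - r)) := by positivity
  have p2 : 0 ≤ (M + ‖c‖) * √2 := by positivity
  rcases n with _ | n
  · have hx2 : x ≤ 2 := by simpa using hn2.le
    calc ‖ν x - c‖ * √x ≤ (M + ‖c‖) * √2 := by
          gcongr
          exact (norm_sub_le _ _).trans (by gcongr; exact hM x hx hx2)
      _ ≤ _ := by linarith
  · have h1 := hu' n x hn1 hn2.le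
    have h2 := hlim n
    rw [dist_eq_norm] at h2
    have h3 : ‖ν x - c‖ ≤ (C + 2 * C / (1 - r)) * r ^ n := by
      calc ‖ν x - c‖ = ‖(ν x - u (2 ^ (n + 1))) + (u (2 ^ (n + 1)) - c)‖ := by ring_nf
        _ ≤ C * r ^ n + 2 * C * r ^ n / (1 - r) := (norm_add_le _ _).trans (add_le_add h1 h2)
        _ = _ := by ring
    have h4 : r ^ n * √x ≤ 2 := by
      have h5 : √x ≤ √((2 ^ (n + 2) : ℕ) : ℝ) := Real.sqrt_le_sqrt (by push_cast; exact hn2.le)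
      have h6 := hrn (n + 2)
      have h7 : 0 < √((2 ^ (n + 2) : ℕ) : ℝ) := Real.sqrt_pos.2 (by positivity)
      rw [div_eq_iff h7.ne'] at h6
      have h8 : r ^ 2 = 1 / 2 := by rw [hr, div_pow, Real.sq_sqrt (by norm_num)]; norm_num
      rw [pow_add, h8] at h6
      calc r ^ n * √x ≤ r ^ n * √((2 ^ (n + 2) : ℕ) : ℝ) := by gcongr
        _ ≤ 2 := by linarith
    calc ‖ν x - c‖ * √x ≤ (C + 2 * C / (1 - r)) * r ^ n * √x := by gcongr
      _ = (C + 2 * C / (1 - r)) * (r ^ n * √x) := by ring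
      _ ≤ (C + 2 * C / (1 - r)) * 2 := by gcongr
      _ ≤ _ := by linarith

theorem exists_abs_card_primTuples_sub_le (l : ℕ) : ∃ c K : ℝ, 0 < K ∧ ∀ B : ℝ, 1 ≤ B →
    |((primTuples (l + 5) B).card : ℝ) - c * √B ^ (l + 3)| ≤
      K * (√B ^ (l + 3) * B ^ (-(1 / 3240) : ℝ)) := by
  obtain ⟨C, -, hC⟩ := exists_norm_primTuples_sub_scaleModel_le_sqrt l
  obtain ⟨c, K, hK, h⟩ := exists_tendsto_of_scale (M := (primTuples (l + 5) (2 ^ 1620)).card)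
    hC (by
      intro x hx1 hx2
      rw [norm_div, norm_pow, Complex.norm_real, Complex.norm_natCast,
        Real.norm_of_nonneg (Real.sqrt_nonneg _)]
      have h1 : 1 ≤ √(x ^ 1620) := Real.one_le_sqrt.2 (one_le_pow₀ hx1)
      refine (div_le_self (Nat.cast_nonneg _) (one_le_pow₀ h1)).trans ?_
      have hx0 : 0 ≤ x := by linarith
      exact_mod_cast card_primTuples_mono _ (by positivity) (pow_le_pow_left₀ hx0 hx2 _))
  refine ⟨c.re, K, hK, fun B hB => ?_⟩
  have hB0 : 0 ≤ B := by linarith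
  have h1 := h (B ^ (1 / 1620 : ℝ)) (Real.one_le_rpow hB (by norm_num))
  have e1 : (B ^ (1 / 1620 : ℝ)) ^ 1620 = B := by
    rw [← Real.rpow_natCast, ← Real.rpow_mul hB0]; norm_num
  have e2 : K / √(B ^ (1 / 1620 : ℝ)) = K * B ^ (-(1 / 3240) : ℝ) := by
    rw [Real.sqrt_eq_rpow, ← Real.rpow_mul hB0, Real.rpow_neg hB0, div_eq_mul_inv]; norm_num
  rw [e1, e2] at h1
  set b := √B with hb
  have hb0 : 0 < b := by rw [hb]; exact Real.sqrt_pos.2 (by linarith)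
  have h2 := (Complex.abs_re_le_norm _).trans h1
  have e3 : (((primTuples (l + 5) B).card : ℂ) / (b : ℂ) ^ (l + 3) - c).re =
      ((primTuples (l + 5) B).card : ℝ) / b ^ (l + 3) - c.re := by
    rw [Complex.sub_re, ← Complex.ofReal_pow, ← Complex.ofReal_natCast, ← Complex.ofReal_div,
      Complex.ofReal_re]
  rw [e3] at h2
  have hbp : 0 < b ^ (l + 3) := by positivity
  have e4 : ((primTuples (l + 5) B).card : ℝ) - c.re * b ^ (l + 3) =
      b ^ (l + 3) * (((primTuples (l + 5) B).card : ℝ) / b ^ (l + 3) - c.re) := by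
    field_simp
  rw [e4, abs_mul, abs_of_pos hbp]
  calc _ ≤ b ^ (l + 3) * (K * B ^ (-(1 / 3240) : ℝ)) := by gcongr
    _ = _ := by ring

/-! ### A lower bound for the number of primitive tuples -/

theorem sum_inv_sq_le {M : ℕ} (hM : 2 ≤ M) :
    ∑ d ∈ Icc 2 M, (1 : ℝ) / (d : ℝ) ^ 2 ≤ 3 / 4 - 1 / M := by
  induction M, hM using Nat.le_induction with
  | base => norm_num
  | succ M hM ih =>
    rw [sum_Icc_succ_top (by omega)]
    have hM0 : (0 : ℝ) < M := by exact_mod_cast (by omega : 0 < M)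
    have : (1 : ℝ) / ((M + 1 : ℕ) : ℝ) ^ 2 ≤ 1 / M - 1 / ((M + 1 : ℕ) : ℝ) := by
      push_cast
      rw [div_sub_div _ _ hM0.ne' (by positivity), div_le_div_iff₀ (by positivity) (by positivity)]
      nlinarith
    linarith

/-- Coprime pairs `(u, w)` in `[1, M]` with `w > M / 8`. -/
def coprimePairs (M : ℕ) : Finset (ℕ × ℕ) :=
  (Icc 1 M ×ˢ Icc 1 M).filter (fun p => p.1.Coprime p.2 ∧ M < 8 * p.2)

theorem card_coprimePairs_ge {M : ℕ} (hM : 2 ≤ M) :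
    (M : ℝ) ^ 2 / 8 ≤ (coprimePairs M).card := by
  have hcov : Icc 1 M ×ˢ Icc 1 M ⊆ coprimePairs M ∪ (Icc 1 M ×ˢ Icc 1 (M / 8)) ∪
      (Icc 2 M).biUnion (fun d => (Icc 1 M).filter (d ∣ ·) ×ˢ (Icc 1 M).filter (d ∣ ·)) := by
    intro p hp
    have hp' := mem_product.1 hp
    rw [mem_Icc, mem_Icc] at hp'
    rw [mem_union, mem_union]
    by_cases hc : p.1.Coprime p.2
    · left
      by_cases h8 : M < 8 * p.2
      · left; exact mem_filter.2 ⟨hp, hc, h8⟩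
      · right; rw [mem_product, mem_Icc, mem_Icc]; omega
    · right
      have hg0 : 0 < p.1.gcd p.2 := Nat.gcd_pos_of_pos_left _ hp'.1.1
      have hg : p.1.gcd p.2 ≠ 1 := hc
      have h1 : p.1.gcd p.2 ≤ p.1 := Nat.gcd_le_left _ hp'.1.1
      refine mem_biUnion.2 ⟨p.1.gcd p.2, mem_Icc.2 (by omega), ?_⟩
      rw [mem_product, mem_filter, mem_filter, mem_Icc, mem_Icc]
      exact ⟨⟨hp'.1, Nat.gcd_dvd_left _ _⟩, hp'.2, Nat.gcd_dvd_right _ _⟩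
  have h1 := (card_le_card hcov).trans ((card_union_le _ _).trans
    (add_le_add (card_union_le _ _) card_biUnion_le))
  have hmul : ∀ d, ((Icc 1 M).filter (d ∣ ·)).card = M / d := by
    intro d
    have : (Icc 1 M).filter (d ∣ ·) = (Ioc 0 M).filter (d ∣ ·) := by
      ext x; simp [Nat.succ_le_iff]
    rw [this, Nat.Ioc_filter_dvd_card_eq_div]
  simp only [card_product, Nat.card_Icc, Nat.add_sub_cancel, hmul] at h1
  have h2 : (M : ℝ) * M ≤ (coprimePairs M).card + M * ((M / 8 : ℕ) : ℝ) +
      ∑ d ∈ Icc 2 M, ((M / d : ℕ) : ℝ) * ((M / d : ℕ) : ℝ) := by exact_mod_cast h1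
  have h3 : ((M / 8 : ℕ) : ℝ) ≤ M / 8 := by
    have := Nat.cast_div_le (α := ℝ) (m := M) (n := 8)
    exact_mod_cast this
  have h4 : ∑ d ∈ Icc 2 M, ((M / d : ℕ) : ℝ) * ((M / d : ℕ) : ℝ) ≤ (M : ℝ) ^ 2 * (3 / 4) := by
    calc _ ≤ ∑ d ∈ Icc 2 M, (M : ℝ) ^ 2 * (1 / (d : ℝ) ^ 2) := by
          refine sum_le_sum fun d _ => ?_
          have := Nat.cast_div_le (α := ℝ) (m := M) (n := d)
          calc ((M / d : ℕ) : ℝ) * ((M / d : ℕ) : ℝ) ≤ ((M : ℝ) / d) * ((M : ℝ) / d) := by gcongr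
            _ = _ := by ring
      _ = (M : ℝ) ^ 2 * ∑ d ∈ Icc 2 M, (1 : ℝ) / (d : ℝ) ^ 2 := by rw [mul_sum]
      _ ≤ _ := by
        gcongr
        have := sum_inv_sq_le hM
        have : (0 : ℝ) ≤ 1 / M := by positivity
        linarith
  have h5 : (M : ℝ) * ((M / 8 : ℕ) : ℝ) ≤ M * (M / 8) := by gcongr
  nlinarith

theorem exists_mul_eq_mul_add {u w E : ℕ} (hw : 0 < w) (huw : u.Coprime w) (hE : Even E) :
    ∃ v t : ℕ, v < 2 * w ∧ w * t = u * v + E ∧ Odd (u + v) := by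
  have : NeZero w := ⟨hw.ne'⟩
  set v₀ := (-(E : ZMod w) * (u : ZMod w)⁻¹).val with hv₀
  have hlt : v₀ < w := ZMod.val_lt _
  have hdvd : w ∣ u * v₀ + E := by
    rw [← ZMod.natCast_eq_zero_iff]
    push_cast
    rw [hv₀, ZMod.natCast_zmod_val]
    have := ZMod.coe_mul_inv_eq_one u huw
    linear_combination (-(E : ZMod w)) * this
  by_cases ho : Odd (u + v₀)
  · obtain ⟨t, ht⟩ := hdvd
    exact ⟨v₀, t, by omega, ht.symm, ho⟩
  rw [Nat.not_odd_iff_even] at ho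
  rcases Nat.even_or_odd w with hwe | hwo
  · exfalso
    have hu : Odd u := by
      by_contra h
      rw [Nat.not_odd_iff_even] at h
      have := Nat.dvd_gcd h.two_dvd hwe.two_dvd
      rw [huw] at this
      omega
    have h1 : Even (u * v₀ + E) := (even_iff_two_dvd.2 (hwe.two_dvd.trans hdvd))
    rw [Nat.even_add] at h1 ho
    have h2 := h1.2 hE
    rw [Nat.even_mul] at h2
    have h3 := Nat.not_even_iff_odd.2 hu
    tauto
  · obtain ⟨t, ht⟩ := hdvd
    refine ⟨v₀ + w, t + u, by omega, ?_, ?_⟩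
    · rw [mul_add, ← ht]; ring
    · rw [← add_assoc]; exact ho.add_odd hwo

/-- A tuple of signed squares. -/
def squareTuple {l : ℕ} (u v w t : ℕ) (e : Fin (l + 1) → ℕ) : Fin (l + 5) → ℤ :=
  Fin.cons (((u : ℤ) + v) ^ 2) (Fin.cons (-((u : ℤ) - v) ^ 2) (Fin.cons (((w : ℤ) - t) ^ 2)
    (Fin.cons (-((w : ℤ) + t) ^ 2) (fun i => (4 * (e i : ℤ)) ^ 2))))

theorem squareful_sq (x : ℤ) : Squareful (x ^ 2) := fun _ hp h =>
  pow_dvd_pow_of_dvd ((Nat.prime_iff_prime_int.1 hp).dvd_of_dvd_pow h) 2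

theorem squareTuple_mem {l : ℕ} {u v w t M : ℕ} {e : Fin (l + 1) → ℕ} (hu : u ≤ M) (hw : w ≤ M)
    (hw0 : 0 < w) (h8 : M < 8 * w) (huw : u.Coprime w) (he : ∀ i, e i ≤ M) (hv : v < 2 * w)
    (ht : w * t = u * v + 4 * ∑ i, e i ^ 2) (hodd : Odd (u + v)) :
    squareTuple u v w t e ∈ primTuples (l + 5) ((((32 * l + 35) * M : ℕ) : ℝ) ^ 2) := by
  set L := (32 * l + 35) * M with hL
  have htM : t ≤ (32 * l + 34) * M := by
    refine Nat.le_of_mul_le_mul_left ?_ hw0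
    have h1 : ∑ i, e i ^ 2 ≤ (l + 1) * M ^ 2 := by
      calc ∑ i, e i ^ 2 ≤ ∑ _i : Fin (l + 1), M ^ 2 :=
            sum_le_sum fun i _ => Nat.pow_le_pow_left (he i) 2
        _ = _ := by simp
    have h2 : u * v ≤ M * (2 * w) := Nat.mul_le_mul hu hv.le
    have h3 : M ^ 2 ≤ M * (8 * w) := by rw [pow_two]; exact Nat.mul_le_mul le_rfl h8.le
    have h4 : (l + 1) * M ^ 2 ≤ (l + 1) * (M * (8 * w)) := Nat.mul_le_mul le_rfl h3
    rw [ht]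
    calc u * v + 4 * ∑ i, e i ^ 2 ≤ M * (2 * w) + 4 * ((l + 1) * (M * (8 * w))) := by omega
      _ = _ := by ring
  have hML : 35 * M ≤ L := by rw [hL]; exact Nat.mul_le_mul (by omega) le_rfl
  have hwt : w + t ≤ L := by
    have : L = (32 * l + 34) * M + M := by rw [hL]; ring
    omega
  have hbd : ∀ x : ℤ, |x| ≤ L → (|(x ^ 2 : ℤ)| : ℝ) ≤ ((L : ℕ) : ℝ) ^ 2 ∧
      (|(-x ^ 2 : ℤ)| : ℝ) ≤ ((L : ℕ) : ℝ) ^ 2 := by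
    intro x hx
    have h1 : (|x| : ℝ) ≤ (L : ℕ) := by exact_mod_cast hx
    push_cast
    rw [abs_neg, abs_pow]
    exact ⟨pow_le_pow_left₀ (abs_nonneg _) h1 2, pow_le_pow_left₀ (abs_nonneg _) h1 2⟩
  have b0 := hbd ((u : ℤ) + v) (by rw [abs_le]; constructor <;> omega)
  have b1 := hbd ((u : ℤ) - v) (by rw [abs_le]; constructor <;> omega)
  have b2 := hbd ((w : ℤ) - t) (by rw [abs_le]; constructor <;> omega)
  have b3 := hbd ((w : ℤ) + t) (by rw [abs_le]; constructor <;> omega)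
  unfold primTuples
  rw [mem_filter, mem_tuples (by positivity)]
  refine ⟨⟨?_, ?_⟩, ?_⟩
  · simp only [Nat.cast_one, isUnit_one, IsUnit.dvd, and_true]
    unfold squareTuple
    refine Fin.cases ?_ (Fin.cases ?_ (Fin.cases ?_ (Fin.cases ?_ fun i => ?_)))
    · simp only [Fin.cons_zero]
      exact ⟨b0.1, squareful_sq _⟩
    · simp only [Fin.cons_succ, Fin.cons_zero]
      exact ⟨b1.2, squareful_neg.2 (squareful_sq _)⟩
    · simp only [Fin.cons_succ, Fin.cons_zero]
      exact ⟨b2.1, squareful_sq _⟩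
    · simp only [Fin.cons_succ, Fin.cons_zero]
      exact ⟨b3.2, squareful_neg.2 (squareful_sq _)⟩
    · simp only [Fin.cons_succ]
      refine ⟨(hbd (4 * (e i : ℤ)) ?_).1, squareful_sq _⟩
      have := he i
      rw [abs_le]; constructor <;> omega
  · unfold squareTuple
    rw [Fin.sum_cons, Fin.sum_cons, Fin.sum_cons, Fin.sum_cons]
    have h1 : (w : ℤ) * t = u * v + 4 * ∑ i, (e i : ℤ) ^ 2 := by exact_mod_cast ht
    simp_rw [mul_pow]
    rw [← mul_sum]
    linear_combination (-4 : ℤ) * h1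
  · set G := univ.gcd (squareTuple u v w t e) with hG
    have hdvd : ∀ i, G ∣ squareTuple u v w t e i := fun i => Finset.gcd_dvd (mem_univ i)
    have hGn : normalize G = G := Finset.normalize_gcd
    by_contra hne
    have hna : G.natAbs ≠ 1 := by
      intro h
      apply hne
      rw [← hGn, ← Int.abs_eq_normalize, Int.abs_eq_natAbs, h]; rfl
    obtain ⟨p, hp, hpG⟩ := Nat.exists_prime_and_dvd hna
    have hpG' : (p : ℤ) ∣ G := Int.natCast_dvd.2 hpG
    have hpZ := Nat.prime_iff_prime_int.1 hp
    have d0 : (p : ℤ) ∣ (u : ℤ) + v := hpZ.dvd_of_dvd_pow (hpG'.trans (hdvd 0))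
    have d1 : (p : ℤ) ∣ (u : ℤ) - v :=
      hpZ.dvd_of_dvd_pow ((dvd_neg).1 (hpG'.trans (hdvd (Fin.succ 0))))
    have d2 : (p : ℤ) ∣ (w : ℤ) - t := hpZ.dvd_of_dvd_pow (hpG'.trans (hdvd (Fin.succ (Fin.succ 0))))
    have d3 : (p : ℤ) ∣ (w : ℤ) + t :=
      hpZ.dvd_of_dvd_pow ((dvd_neg).1 (hpG'.trans (hdvd (Fin.succ (Fin.succ (Fin.succ 0))))))
    have hp2 : p ≠ 2 := by
      rintro rfl
      have : 2 ∣ u + v := by exact_mod_cast d0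
      rw [Nat.odd_iff] at hodd
      omega
    have hp2' : ¬ (p : ℤ) ∣ 2 := by
      intro h
      have h' : p ∣ 2 := by exact_mod_cast h
      exact hp2 ((Nat.prime_dvd_prime_iff_eq hp Nat.prime_two).1 h')
    have du : p ∣ u := by
      have h1 : (p : ℤ) ∣ 2 * u := by
        have := dvd_add d0 d1
        rwa [show (u : ℤ) + v + (u - v) = 2 * u by ring] at this
      exact_mod_cast (hpZ.dvd_or_dvd h1).resolve_left hp2'
    have dw : p ∣ w := by
      have h1 : (p : ℤ) ∣ 2 * w := by
        have := dvd_add d2 d3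
        rwa [show (w : ℤ) - t + (w + t) = 2 * w by ring] at this
      exact_mod_cast (hpZ.dvd_or_dvd h1).resolve_left hp2'
    have := Nat.dvd_gcd du dw
    rw [huw] at this
    exact hp.one_lt.ne' (Nat.dvd_one.1 this)

theorem eq_of_sq_add_eq_of_sq_sub_eq {u v u' v' : ℕ} (h1 : ((u : ℤ) + v) ^ 2 = (u' + v') ^ 2)
    (h2 : ((u : ℤ) - v) ^ 2 = (u' - v') ^ 2) (h3 : u ≤ v ↔ u' ≤ v') : u = u' := by
  have e1 : (u : ℤ) + v = u' + v' := by
    rcases sq_eq_sq_iff_eq_or_eq_neg.1 h1 with h | h <;> omega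
  rcases sq_eq_sq_iff_eq_or_eq_neg.1 h2 with h | h <;> omega

theorem card_primTuples_ge (l : ℕ) {M : ℕ} (hM : 2 ≤ M) :
    (M : ℝ) ^ (l + 3) / 32 ≤
      (primTuples (l + 5) ((((32 * l + 35) * M : ℕ) : ℝ) ^ 2)).card := by
  classical
  have hex : ∀ x : (ℕ × ℕ) × (Fin (l + 1) → ℕ), ∃ v t : ℕ, 0 < x.1.2 → x.1.1.Coprime x.1.2 →
      v < 2 * x.1.2 ∧ x.1.2 * t = x.1.1 * v + 4 * ∑ i, x.2 i ^ 2 ∧ Odd (x.1.1 + v) := by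
    intro x
    by_cases h : 0 < x.1.2 ∧ x.1.1.Coprime x.1.2
    · obtain ⟨v, t, hvt⟩ := exists_mul_eq_mul_add (E := 4 * ∑ i, x.2 i ^ 2) h.1 h.2
        ((by decide : Even 4).mul_right _)
      exact ⟨v, t, fun _ _ => hvt⟩
    · exact ⟨0, 0, fun h1 h2 => absurd ⟨h1, h2⟩ h⟩
  choose v t hvt using hex
  set D := coprimePairs M ×ˢ Fintype.piFinset (fun _ : Fin (l + 1) => range M) with hD
  set N := primTuples (l + 5) ((((32 * l + 35) * M : ℕ) : ℝ) ^ 2) with hN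
  let Φ : (ℕ × ℕ) × (Fin (l + 1) → ℕ) → (Fin (l + 5) → ℤ) × (Bool × Bool) := fun x =>
    (squareTuple x.1.1 (v x) x.1.2 (t x) x.2, (decide (x.1.1 ≤ v x), decide (x.1.2 ≤ t x)))
  have hmem : ∀ x ∈ D, Φ x ∈ N ×ˢ (univ : Finset (Bool × Bool)) := by
    intro x hx
    obtain ⟨h1, h2⟩ := mem_product.1 hx
    obtain ⟨h3, hc, h8⟩ := mem_filter.1 h1
    obtain ⟨hu, hw⟩ := mem_product.1 h3
    rw [mem_Icc] at hu hw
    obtain ⟨g1, g2, g3⟩ := hvt x (by omega) hc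
    refine mem_product.2 ⟨squareTuple_mem hu.2 hw.2 (by omega) h8 hc (fun i => ?_) g1 g2 g3,
      mem_univ _⟩
    exact (mem_range.1 (Fintype.mem_piFinset.1 h2 i)).le
  have hinj : Set.InjOn Φ D := by
    rintro ⟨⟨u, w⟩, e⟩ _ ⟨⟨u', w'⟩, e'⟩ _ h
    simp only [Φ, Prod.mk.injEq, decide_eq_decide] at h
    obtain ⟨ha, hb1, hb2⟩ := h
    unfold squareTuple at ha
    obtain ⟨a0, ha⟩ := Fin.cons_inj.1 ha
    obtain ⟨a1, ha⟩ := Fin.cons_inj.1 ha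
    obtain ⟨a2, ha⟩ := Fin.cons_inj.1 ha
    obtain ⟨a3, ha⟩ := Fin.cons_inj.1 ha
    have hu := eq_of_sq_add_eq_of_sq_sub_eq a0 (neg_inj.1 a1) hb1
    have hw := eq_of_sq_add_eq_of_sq_sub_eq (neg_inj.1 a3) a2 hb2
    have he : e = e' := by
      funext i
      have := congrFun ha i
      rcases sq_eq_sq_iff_eq_or_eq_neg.1 this with h | h <;> omega
    rw [hu, hw, he]
  have hcard := card_le_card_of_injOn Φ hmem hinj
  rw [hD, card_product, card_product, Fintype.card_piFinset] at hcard
  simp only [card_range, prod_const, card_univ, Fintype.card_fin, Fintype.card_prod,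
    Fintype.card_bool] at hcard
  have h1 : ((coprimePairs M).card : ℝ) * (M : ℝ) ^ (l + 1) ≤ (N.card : ℝ) * 4 := by
    exact_mod_cast hcard
  have h2 := card_coprimePairs_ge hM
  have h3 : (M : ℝ) ^ 2 / 8 * (M : ℝ) ^ (l + 1) ≤ (coprimePairs M).card * (M : ℝ) ^ (l + 1) := by
    gcongr
  have h4 : (M : ℝ) ^ (l + 3) = (M : ℝ) ^ 2 * (M : ℝ) ^ (l + 1) := by ring
  rw [h4]; linarith

theorem leading_constant_pos {l : ℕ} {c K δ : ℝ} (hδ : 0 < δ)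
    (h : ∀ B : ℝ, 1 ≤ B → |((primTuples (l + 5) B).card : ℝ) - c * √B ^ (l + 3)| ≤
      K * (√B ^ (l + 3) * B ^ (-δ))) : 0 < c := by
  by_contra hc
  rw [not_lt] at hc
  set L : ℝ := 32 * l + 35 with hL
  have hL1 : 1 ≤ L := by
    have : (0 : ℝ) ≤ l := Nat.cast_nonneg l
    linarith
  have hbound : ∀ M : ℕ, 2 ≤ M → 1 / (32 * L ^ (l + 3)) ≤ K * ((L * M) ^ 2) ^ (-δ) := by
    intro M hM
    have hM1 : (1 : ℝ) ≤ M := by exact_mod_cast (by omega : 1 ≤ M)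
    have hLM : 1 ≤ L * M := one_le_mul_of_one_le_of_one_le hL1 hM1
    have h1 := card_primTuples_ge l hM
    have e1 : (((32 * l + 35) * M : ℕ) : ℝ) = L * M := by push_cast; rw [hL]
    rw [e1] at h1
    have h2 := (abs_le.1 (h ((L * M) ^ 2) (one_le_pow₀ hLM))).2
    rw [Real.sqrt_sq (by linarith)] at h2
    have hp : 0 < (L * M) ^ (l + 3) := by positivity
    have h3 : c * (L * M) ^ (l + 3) ≤ 0 := mul_nonpos_of_nonpos_of_nonneg hc hp.le
    have h4 : (M : ℝ) ^ (l + 3) / 32 ≤ (L * M) ^ (l + 3) * (K * ((L * M) ^ 2) ^ (-δ)) := by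
      linarith
    rw [← mul_le_mul_iff_right₀ hp]
    refine le_trans (le_of_eq ?_) h4
    rw [mul_pow]
    field_simp
  have hlim : Filter.Tendsto (fun M : ℕ => K * ((L * (M : ℝ)) ^ 2) ^ (-δ)) Filter.atTop
      (nhds (K * 0)) := by
    refine Filter.Tendsto.const_mul K ((tendsto_rpow_neg_atTop hδ).comp ?_)
    refine (Filter.tendsto_pow_atTop (by norm_num)).comp ?_
    exact Filter.Tendsto.const_mul_atTop (by linarith) tendsto_natCast_atTop_atTop
  rw [mul_zero] at hlim
  have hle := ge_of_tendsto hlim (Filter.eventually_atTop.2 ⟨2, hbound⟩)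
  have : 0 < 1 / (32 * L ^ (l + 3)) := by positivity
  linarith

end SquarefulCount

theorem squareful_hyperplane_count (n : ℕ) (hn : 4 ≤ n) :
    ∃ C > (0:ℝ), ∃ δ > (0:ℝ), ∃ K > (0:ℝ), ∀ B : ℝ, 1 ≤ B →
      |(Set.ncard {a : Fin (n+1) → ℤ |
          (∑ i, a i) = 0 ∧ Finset.univ.gcd a = 1 ∧
          (∀ i, (|a i| : ℝ) ≤ B) ∧ (∀ i, Squareful (a i))} : ℝ)
        - C * B ^ (((n:ℝ) - 1)/2)| ≤ K * B ^ (((n:ℝ) - 1)/2 - δ) := by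
  obtain ⟨l, rfl⟩ := Nat.exists_eq_add_of_le' hn
  obtain ⟨c, K, hK, h⟩ := SquarefulCount.exists_abs_card_primTuples_sub_le l
  refine ⟨c, SquarefulCount.leading_constant_pos (by norm_num) h, 1 / 3240, by norm_num, K, hK,
    fun B hB => ?_⟩
  have hB0 : 0 < B := by linarith
  have hset : {a : Fin (l + 4 + 1) → ℤ | (∑ i, a i) = 0 ∧ Finset.univ.gcd a = 1 ∧
      (∀ i, (|a i| : ℝ) ≤ B) ∧ (∀ i, Squareful (a i))} =
      (SquarefulCount.primTuples (l + 5) B : Set (Fin (l + 5) → ℤ)) := by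
    ext a
    unfold SquarefulCount.primTuples
    simp only [Finset.coe_filter, Set.mem_ofPred_eq, SquarefulCount.mem_tuples hB0.le, Nat.cast_one,
      isUnit_one, IsUnit.dvd, and_true]
    constructor
    · rintro ⟨h1, h2, h3, h4⟩
      exact ⟨⟨fun i => ⟨h3 i, h4 i⟩, h1⟩, h2⟩
    · rintro ⟨⟨h1, h2⟩, h3⟩
      exact ⟨h2, h3, fun i => (h1 i).1, fun i => (h1 i).2⟩
  have hpow : B ^ ((((l + 4 : ℕ) : ℝ) - 1) / 2) = √B ^ (l + 3) := by
    rw [Real.sqrt_eq_rpow, ← Real.rpow_natCast, ← Real.rpow_mul hB0.le]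
    congr 1
    push_cast
    ring
  rw [hset, Set.ncard_coe_finset, sub_eq_add_neg _ (1 / 3240 : ℝ), Real.rpow_add hB0, hpow]
  exact h B hB
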